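/- Let 𝒜 be a homogeneous constant-coefficient differential operator of order k ≥ n on ℝ^n and let 1 < p < ∞. Then 𝒜 is elliptic if and only if for every u ∈ BV^𝒜_loc(ℝ^n), D^{k−n}u ∈ t^{n,p}(x) for ℒ^n-almost every x ∈ ℝ^n. -/

import Mathlib

open MeasureTheory Metric Filter
open scoped ENNReal RealInnerProductSpace Topology

noncomputable section

/-- Euclidean space `ℝ^n`. -/
abbrev Euc (n : ℕ) : Type := EuclideanSpace ℝ (Fin n)

/-- The `i`-th standard basis vector of `ℝ^n`. -/
def stdVec (n : ℕ) (i : Fin n) : Euc n := EuclideanSpace.single i (1 : ℝ)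

/-- Coefficients `A_I : V →ₗ W` (indexed by `I : Fin k → Fin n`) of a homogeneous linear
constant-coefficient differential operator `𝒜 u = ∑_I A_I ∂_I u` of order `k` on `ℝ^n`. -/
abbrev CoeffOp (n k : ℕ) (V W : Type*) [NormedAddCommGroup V] [InnerProductSpace ℝ V]
    [NormedAddCommGroup W] [InnerProductSpace ℝ W] : Type _ :=
  (Fin k → Fin n) → (V →ₗ[ℝ] W)

variable {V W F : Type*}
  [NormedAddCommGroup V] [InnerProductSpace ℝ V] [FiniteDimensional ℝ V]
  [NormedAddCommGroup W] [InnerProductSpace ℝ W] [FiniteDimensional ℝ W]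

/-- The coefficients represent a linear map on symmetric tensors `V ⊙^k ℝ^n`. -/
def IsSymmetricOp (n k : ℕ) (A : CoeffOp n k V W) : Prop :=
  ∀ (I : Fin k → Fin n) (σ : Equiv.Perm (Fin k)), A (I ∘ σ) = A I

/-- The symbol `𝒜[ξ] v = A (v ⊗^k ξ) = ∑_I (∏ i, ξ_{I i}) A_I v`. -/
def symbolMap (n k : ℕ) (A : CoeffOp n k V W) (ξ : Euc n) : V →ₗ[ℝ] W :=
  ∑ I : Fin k → Fin n, (∏ i, ξ (I i)) • A I

/-- Ellipticity: the symbol is injective for all `ξ ≠ 0`. -/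
def IsElliptic (n k : ℕ) (A : CoeffOp n k V W) : Prop :=
  ∀ ξ : Euc n, ξ ≠ 0 → Function.Injective (symbolMap n k A ξ)

/-- Van Schaftingen's cancellation condition: `⋂_{ξ ∈ 𝕊^{n-1}} im 𝒜[ξ] = {0}`. -/
def IsCanceling (n k : ℕ) (A : CoeffOp n k V W) : Prop :=
  (⋂ ξ ∈ sphere (0 : Euc n) 1, (LinearMap.range (symbolMap n k A ξ) : Set W)) = {0}

/-- Inverse of an endomorphism (junk value when not invertible), via matrix inversion. -/
def linInv (f : V →ₗ[ℝ] V) : V →ₗ[ℝ] V :=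
  letI b := Module.finBasis ℝ V
  Matrix.toLin b b ((LinearMap.toMatrix b b f)⁻¹)

/-- `𝒜†[ξ] = (𝒜*[ξ] 𝒜[ξ])⁻¹ 𝒜*[ξ]`. -/
def Adagger (n k : ℕ) (A : CoeffOp n k V W) (ξ : Euc n) : W →ₗ[ℝ] V :=
  linInv (LinearMap.adjoint (symbolMap n k A ξ) ∘ₗ symbolMap n k A ξ) ∘ₗ
    LinearMap.adjoint (symbolMap n k A ξ)

/-- Condition (WC): for every `w ∈ ⋂_{ξ ∈ 𝕊^{n-1}} im 𝒜[ξ]`,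
`∫_{𝕊^{n-1}} 𝒜†[ξ] w ⊗^{k-n} ξ dℋ^{n-1}(ξ) = 0`, written componentwise in the
tensor coordinates indexed by `J : Fin (k-n) → Fin n`. -/
def IsWeaklyCanceling (n k : ℕ) (A : CoeffOp n k V W) : Prop :=
  ∀ w : W, (∀ ξ ∈ sphere (0 : Euc n) 1, w ∈ LinearMap.range (symbolMap n k A ξ)) →
    ∀ J : Fin (k - n) → Fin n,
      (∫ ξ in sphere (0 : Euc n) 1,
        (∏ i, ξ (J i)) • (Adagger n k A ξ w) ∂(μH[(n : ℝ) - 1])) = 0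

section TestFun

variable [NormedAddCommGroup F] [NormedSpace ℝ F]

/-- Compactly supported smooth test function. -/
def IsTestFun (n : ℕ) (φ : Euc n → F) : Prop :=
  ContDiff ℝ (⊤ : ℕ∞) φ ∧ HasCompactSupport φ

/-- Iterated directional derivative `∂_{I 0} ⋯ ∂_{I (m-1)} φ (x)`. -/
def dirDeriv (n m : ℕ) (I : Fin m → Fin n) (φ : Euc n → F) (x : Euc n) : F :=
  iteratedFDeriv ℝ m φ x (fun i => stdVec n (I i))

/-- Smooth functions of degree-`≤ j` polynomial type. -/
def IsPolyDeg (n : ℕ) (j : ℕ) (P : Euc n → F) : Prop :=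
  ContDiff ℝ (⊤ : ℕ∞) P ∧ ∀ x, iteratedFDeriv ℝ (j + 1) P x = 0

end TestFun

/-- Pointwise application of the operator `𝒜` to a smooth map. -/
def Aapply (n k : ℕ) (A : CoeffOp n k V W) (u : Euc n → V) (x : Euc n) : W :=
  ∑ I : Fin k → Fin n, A I (dirDeriv n k I u x)

/-- `𝒜 u = f σ` (a `W`-valued measure with total-variation measure `σ` and polar density `f`)
in the sense of distributions. -/
def HasDistribA (n k : ℕ) (A : CoeffOp n k V W) (u : Euc n → V) (σ : Measure (Euc n))
    (f : Euc n → W) : Prop :=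
  ∀ φ : Euc n → W, IsTestFun n φ →
    ((-1 : ℝ) ^ k) * (∑ I : Fin k → Fin n,
        ∫ x, ⟪u x, LinearMap.adjoint (A I) (dirDeriv n k I φ x)⟫) =
      ∫ x, ⟪f x, φ x⟫ ∂σ

/-- `u ∈ BV^𝒜_loc(ℝ^n)`: `u` is locally integrable and `𝒜 u` is a `W`-valued Radon measure,
given by its polar decomposition `f σ` with `σ` locally finite and `‖f‖ = 1` σ-a.e. -/
def MemBVAloc (n k : ℕ) (A : CoeffOp n k V W) (u : Euc n → V) : Prop :=
  LocallyIntegrable u volume ∧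
    ∃ (σ : Measure (Euc n)) (f : Euc n → W), IsLocallyFiniteMeasure σ ∧
      LocallyIntegrable f σ ∧ (∀ᵐ x ∂σ, ‖f x‖ = 1) ∧ HasDistribA n k A u σ f

/-- `v` is the family of weak derivatives of order `m` of `u` (componentwise, indexed by
`I : Fin m → Fin n`). -/
def IsWeakDerivFamily (n m : ℕ) (u : Euc n → V) (v : (Fin m → Fin n) → Euc n → V) : Prop :=
  (∀ I, LocallyIntegrable (v I) volume) ∧
    ∀ (I : Fin m → Fin n) (φ : Euc n → ℝ), IsTestFun n φ →
      ∫ x, (dirDeriv n m I φ x) • u x = ((-1 : ℝ) ^ m) • ∫ x, φ x • v I x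

/-- `Q r = o(r^a)` as `r ↓ 0`. -/
def SmallO (Q : ℝ → ℝ≥0∞) (a : ℝ) : Prop :=
  Tendsto (fun r => Q r / ENNReal.ofReal (r ^ a)) (𝓝[>] (0 : ℝ)) (𝓝 0)

section Spaces

variable [NormedAddCommGroup F] [NormedSpace ℝ F]

/-- `f ∈ t^{j,p}(x)`: there is a polynomial `P` of degree at most `j` with
`(⨍_{B_r(x)} |f - P|^p)^{1/p} = o(r^j)` as `r ↓ 0`. -/
def MemT (n : ℕ) (j : ℕ) (p : ℝ) (f : Euc n → F) (x : Euc n) : Prop :=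
  ∃ P : Euc n → F, IsPolyDeg n j P ∧
    SmallO (fun r => ((volume (ball x r))⁻¹ *
      ∫⁻ y in ball x r, (‖f y - P y‖₊ : ℝ≥0∞) ^ p) ^ (1 / p)) (j : ℝ)

/-- `f ∈ t^{j,∞}(x)`: there is a polynomial `P` of degree at most `j` with
`‖f - P‖_{L^∞(B_r(x))} = o(r^j)` as `r ↓ 0`. -/
def MemTInf (n : ℕ) (j : ℕ) (f : Euc n → F) (x : Euc n) : Prop :=
  ∃ P : Euc n → F, IsPolyDeg n j P ∧
    SmallO (fun r => essSup (fun y => (‖f y - P y‖₊ : ℝ≥0∞))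
      (volume.restrict (ball x r))) (j : ℝ)

/-- The Lorentz `L^{p,q}` quasi-norm (for `p, q < ∞`). -/
def lorentzNorm {α : Type*} [MeasurableSpace α] (p q : ℝ) (μ : Measure α) (f : α → F) : ℝ≥0∞ :=
  ENNReal.ofReal p ^ (1 / q) *
    (∫⁻ t in Set.Ioi (0 : ℝ),
      (ENNReal.ofReal t * (μ {x | t < ‖f x‖}) ^ (1 / p)) ^ q * (ENNReal.ofReal t)⁻¹) ^ (1 / q)

/-- `f` is `L^{p,q}`-differentiable of order `j` at `x`:
`‖f - P‖_{L^{p,q}(B_r(x))} = o(r^{j + n/p})` for a polynomial `P` of degree at most `j`. -/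
def MemTLorentz (n : ℕ) (j : ℕ) (p q : ℝ) (f : Euc n → F) (x : Euc n) : Prop :=
  ∃ P : Euc n → F, IsPolyDeg n j P ∧
    SmallO (fun r => lorentzNorm p q (volume.restrict (ball x r)) (fun y => f y - P y))
      ((j : ℝ) + n / p)

/-- `f ∈ L^p_loc`. -/
def LocLp (n : ℕ) (p : ℝ) (f : Euc n → F) : Prop :=
  ∀ K : Set (Euc n), IsCompact K → ∫⁻ x in K, (‖f x‖₊ : ℝ≥0∞) ^ p < ⊤

end Spaces

end

open scoped SchwartzMap

section TaylorLp

variable {F G : Type*} [NormedAddCommGroup F] [NormedSpace ℝ F]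
  [NormedAddCommGroup G] [NormedSpace ℝ G] {n j : ℕ} {p : ℝ}

lemma iteratedFDeriv_diagonal_eq_zero {m i : ℕ} (T : ContinuousMultilinearMap ℝ (fun _ : Fin m => Euc n) F)
    (x : Euc n) (hi : m < i) (y : Euc n) :
    iteratedFDeriv ℝ i (fun z => T (fun _ => z - x)) y = 0 := by
  have h0 : iteratedFDeriv ℝ (m + 1) (fun z => T (fun _ => z - x)) = 0 := by
    have h1 : iteratedFDeriv ℝ m (fun z => T (fun _ => z - x)) =
        fun _ => iteratedFDeriv ℝ m (fun z => T (fun _ => z)) 0 := by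
      ext y v
      rw [iteratedFDeriv_comp_sub m x y (f := fun z => T (fun _ => z)),
        ContinuousMultilinearMap.iteratedFDeriv_comp_diagonal,
        ContinuousMultilinearMap.iteratedFDeriv_comp_diagonal]
    ext y v
    rw [iteratedFDeriv_succ_apply_left, h1]
    simp
  obtain ⟨q, rfl⟩ := Nat.exists_eq_add_of_lt hi
  have h2 : ∀ q, iteratedFDeriv ℝ (m + q + 1) (fun z => T (fun _ => z - x)) = 0 := by
    intro q
    induction q with
    | zero => exact h0
    | succ q ih =>
      ext y v
      rw [iteratedFDeriv_succ_apply_left]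
      change (fderiv ℝ (iteratedFDeriv ℝ (m + q + 1) fun z => T fun _ => z - x) y (v 0))
        (Fin.tail v) = 0
      rw [ih]
      simp
  rw [h2 q]; rfl

lemma isPolyDeg_diagonal {m : ℕ} (T : ContinuousMultilinearMap ℝ (fun _ : Fin m => Euc n) F)
    (x : Euc n) (hm : m ≤ j) : IsPolyDeg n j (fun z => T (fun _ => z - x)) :=
  ⟨T.contDiff.comp (contDiff_pi.2 fun _ => contDiff_id.sub contDiff_const),
    iteratedFDeriv_diagonal_eq_zero T x (by omega)⟩

lemma IsPolyDeg.add {P Q : Euc n → F} (hP : IsPolyDeg n j P) (hQ : IsPolyDeg n j Q) :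
    IsPolyDeg n j (fun y => P y + Q y) :=
  ⟨hP.1.add hQ.1, fun x => by
    rw [fun_iteratedFDeriv_add_apply
      (hP.1.contDiffAt.of_le (by exact_mod_cast le_top))
      (hQ.1.contDiffAt.of_le (by exact_mod_cast le_top)), hP.2, hQ.2, add_zero]⟩

lemma isPolyDeg_zero : IsPolyDeg n j (fun _ => (0 : F)) :=
  ⟨contDiff_const, fun x => by rw [iteratedFDeriv_fun_zero]; rfl⟩

lemma IsPolyDeg.sum {ι : Type*} (s : Finset ι) {P : ι → Euc n → F}
    (hP : ∀ i ∈ s, IsPolyDeg n j (P i)) : IsPolyDeg n j (fun y => ∑ i ∈ s, P i y) := by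
  classical
  induction s using Finset.induction_on with
  | empty => simpa using isPolyDeg_zero
  | insert a s ha ih =>
    simp only [Finset.sum_insert ha]
    exact (hP a (by simp)).add (ih fun i hi => hP i (by simp [hi]))

lemma IsPolyDeg.clm_comp (L : F →L[ℝ] G) {P : Euc n → F} (hP : IsPolyDeg n j P) :
    IsPolyDeg n j (fun y => L (P y)) :=
  ⟨L.contDiff.comp hP.1, fun x => by
    have := L.iteratedFDeriv_comp_left (hP.1.contDiffAt (x := x)) (i := j + 1) (by exact_mod_cast le_top)
    change iteratedFDeriv ℝ (j + 1) (L ∘ P) x = 0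
    rw [this, hP.2]
    ext v; simp⟩

/-- A reformulation of `MemT` in terms of integrals instead of averages. -/
def TaylorLp (n j : ℕ) (p : ℝ) (f : Euc n → F) (x : Euc n) : Prop :=
  ∃ P : Euc n → F, IsPolyDeg n j P ∧ ∀ ε : ℝ, 0 < ε → ∀ᶠ r in 𝓝[>] (0 : ℝ),
    ∫⁻ y in ball x r, ‖f y - P y‖ₑ ^ p ≤ ENNReal.ofReal (ε * r ^ ((n : ℝ) + j * p))

lemma volume_ball_euc (x : Euc n) {r : ℝ} (hr : 0 < r) :
    volume (ball x r) = ENNReal.ofReal (r ^ n) * volume (ball (0 : Euc n) 1) := by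
  rw [Measure.addHaar_ball_of_pos _ _ hr]; simp

lemma volume_unit_ball_pos : 0 < volume (ball (0 : Euc n) 1) := measure_ball_pos _ _ one_pos
lemma volume_unit_ball_lt_top : volume (ball (0 : Euc n) 1) < ∞ := measure_ball_lt_top

lemma TaylorLp.memT (hp : 1 ≤ p) {f : Euc n → F} {x : Euc n} (h : TaylorLp n j p f x) :
    MemT n j p f x := by
  obtain ⟨P, hP, h⟩ := h
  refine ⟨P, hP, ?_⟩
  have hp0 : 0 < p := by linarith
  unfold SmallO
  rw [ENNReal.tendsto_nhds_zero]
  intro ε hε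
  set c := volume (ball (0 : Euc n) 1) with hc
  have hc0 : c ≠ 0 := volume_unit_ball_pos.ne'
  have hct : c ≠ ∞ := volume_unit_ball_lt_top.ne
  obtain ⟨δ, hδ0, hδ⟩ : ∃ δ : ℝ, 0 < δ ∧ ENNReal.ofReal δ ≤ ε := by
    rcases eq_or_ne ε ∞ with rfl | hε'
    · exact ⟨1, one_pos, le_top⟩
    · exact ⟨ε.toReal, ENNReal.toReal_pos hε.ne' hε', (ENNReal.ofReal_toReal hε').le⟩
  filter_upwards [h (c.toReal * δ ^ p) (by have := ENNReal.toReal_pos hc0 hct; positivity),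
    self_mem_nhdsWithin] with r hr hr0
  have hr0 : 0 < r := hr0
  refine le_trans ?_ hδ
  rw [volume_ball_euc x hr0, ← hc]
  have h1 : (ENNReal.ofReal (r ^ n) * c)⁻¹ * ∫⁻ y in ball x r, (‖f y - P y‖₊ : ℝ≥0∞) ^ p
      ≤ ENNReal.ofReal ((δ * r ^ (j : ℝ)) ^ p) := by
    calc _ ≤ (ENNReal.ofReal (r ^ n) * c)⁻¹ *
        ENNReal.ofReal (c.toReal * δ ^ p * r ^ ((n : ℝ) + j * p)) := by gcongr; exact hr
      _ = _ := by
        conv_lhs => rw [← ENNReal.ofReal_toReal hct]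
        have := ENNReal.toReal_pos hc0 hct
        rw [← ENNReal.ofReal_mul (by positivity), ← ENNReal.ofReal_inv_of_pos (by positivity),
          ← ENNReal.ofReal_mul (by positivity)]
        congr 1
        rw [ENNReal.toReal_ofReal (by positivity)]
        rw [Real.rpow_add hr0, Real.mul_rpow hδ0.le (by positivity), Real.rpow_mul hr0.le,
          Real.rpow_natCast r n]
        field_simp
  calc _ ≤ ENNReal.ofReal ((δ * r ^ (j : ℝ)) ^ p) ^ (1 / p) / ENNReal.ofReal (r ^ (j : ℝ)) := by
        gcongr
    _ = ENNReal.ofReal δ := by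
        have : 0 < r ^ (j : ℝ) := by positivity
        rw [ENNReal.ofReal_rpow_of_nonneg (by positivity) (by positivity),
          ← Real.rpow_mul (by positivity), mul_one_div_cancel hp0.ne', Real.rpow_one,
          ← ENNReal.ofReal_div_of_pos this]
        congr 1; field_simp
    _ ≤ ENNReal.ofReal δ := le_rfl

lemma TaylorLp.congr {f g : Euc n → F} {x : Euc n} {s : Set (Euc n)} (hs : s ∈ 𝓝 x)
    (hfg : ∀ᵐ y ∂(volume : Measure (Euc n)), y ∈ s → f y = g y) (h : TaylorLp n j p f x) :
    TaylorLp n j p g x := by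
  obtain ⟨P, hP, h⟩ := h
  refine ⟨P, hP, fun ε hε => ?_⟩
  obtain ⟨ρ, hρ, hρs⟩ := Metric.mem_nhds_iff.1 hs
  filter_upwards [h ε hε, Ioo_mem_nhdsGT hρ] with r hr hr0
  rw [setLIntegral_congr_fun_ae measurableSet_ball
    (g := fun y => ‖f y - P y‖ₑ ^ p) ?_]
  · exact hr
  · filter_upwards [hfg] with y hy hyr
    rw [hy (hρs (ball_subset_ball hr0.2.le hyr))]

lemma TaylorLp.clm_comp (hp : 0 ≤ p) (L : F →L[ℝ] G) {f : Euc n → F} {x : Euc n}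
    (h : TaylorLp n j p f x) : TaylorLp n j p (fun y => L (f y)) x := by
  obtain ⟨P, hP, h⟩ := h
  refine ⟨_, hP.clm_comp L, fun ε hε => ?_⟩
  have hL : 0 < ‖L‖ + 1 := by positivity
  filter_upwards [h (ε / (‖L‖ + 1) ^ p) (by positivity)] with r hr
  calc _ ≤ ∫⁻ y in ball x r, ENNReal.ofReal ((‖L‖ + 1) ^ p) * ‖f y - P y‖ₑ ^ p := by
        gcongr with y
        rw [← ENNReal.ofReal_rpow_of_nonneg hL.le hp, ← ENNReal.mul_rpow_of_nonneg _ _ hp,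
          ← map_sub]
        gcongr
        rw [← ofReal_norm, ← ofReal_norm, ← ENNReal.ofReal_mul hL.le]
        gcongr
        exact (L.le_opNorm _).trans (by gcongr; linarith)
    _ = ENNReal.ofReal ((‖L‖ + 1) ^ p) * ∫⁻ y in ball x r, ‖f y - P y‖ₑ ^ p := by
        rw [lintegral_const_mul' _ _ ENNReal.ofReal_ne_top]
    _ ≤ ENNReal.ofReal ((‖L‖ + 1) ^ p) *
        ENNReal.ofReal (ε / (‖L‖ + 1) ^ p * r ^ ((n : ℝ) + j * p)) := by gcongr
    _ = _ := by
        rw [← ENNReal.ofReal_mul (by positivity)]; congr 1; field_simp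

lemma TaylorLp.add (hp : 1 ≤ p) {f g : Euc n → F} {x : Euc n}
    (hfm : AEStronglyMeasurable f volume) (h : TaylorLp n j p f x) (h' : TaylorLp n j p g x) :
    TaylorLp n j p (fun y => f y + g y) x := by
  obtain ⟨P, hP, h⟩ := h
  obtain ⟨Q, hQ, h'⟩ := h'
  refine ⟨_, hP.add hQ, fun ε hε => ?_⟩
  set K : ℝ≥0∞ := 2 ^ (p - 1) with hK
  have hKt : K ≠ ∞ := ENNReal.rpow_ne_top_of_nonneg (by linarith) (by simp)
  have hK0 : K ≠ 0 := by simp [hK]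
  have hK' : 0 < K.toReal := ENNReal.toReal_pos hK0 hKt
  filter_upwards [h (ε / (2 * K.toReal)) (by positivity), h' (ε / (2 * K.toReal)) (by positivity),
    self_mem_nhdsWithin] with r hr hr' hr0
  have hr0 : 0 < r := hr0
  calc _ ≤ ∫⁻ y in ball x r, K * (‖f y - P y‖ₑ ^ p + ‖g y - Q y‖ₑ ^ p) := by
        gcongr with y
        refine le_trans ?_ (ENNReal.rpow_add_le_mul_rpow_add_rpow _ _ hp)
        gcongr
        rw [add_sub_add_comm]
        exact enorm_add_le _ _
    _ = K * ((∫⁻ y in ball x r, ‖f y - P y‖ₑ ^ p) + ∫⁻ y in ball x r, ‖g y - Q y‖ₑ ^ p) := by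
        rw [lintegral_const_mul' _ _ hKt, lintegral_add_left']
        exact ((hfm.sub hP.1.continuous.aestronglyMeasurable).enorm.pow_const p).restrict
    _ ≤ ENNReal.ofReal K.toReal * (ENNReal.ofReal (ε / (2 * K.toReal) * r ^ ((n : ℝ) + j * p)) +
          ENNReal.ofReal (ε / (2 * K.toReal) * r ^ ((n : ℝ) + j * p))) := by
        rw [ENNReal.ofReal_toReal hKt]; gcongr
    _ = _ := by
        rw [← ENNReal.ofReal_add (by positivity) (by positivity),
          ← ENNReal.ofReal_mul (by positivity)]
        congr 1; field_simp; ring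

lemma TaylorLp.zero {x : Euc n} (hp : 0 < p) : TaylorLp n j p (fun _ => (0 : F)) x :=
  ⟨_, isPolyDeg_zero, fun ε hε => by simp [ENNReal.zero_rpow_of_pos hp]⟩

lemma TaylorLp.sum {ι : Type*} (hp : 1 ≤ p) (s : Finset ι) {f : ι → Euc n → F} {x : Euc n}
    (hfm : ∀ i ∈ s, AEStronglyMeasurable (f i) volume) (h : ∀ i ∈ s, TaylorLp n j p (f i) x) :
    TaylorLp n j p (fun y => ∑ i ∈ s, f i y) x := by
  classical
  induction s using Finset.induction_on with
  | empty => simpa using TaylorLp.zero (by linarith)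
  | insert a s ha ih =>
    simp only [Finset.sum_insert ha]
    exact TaylorLp.add hp (hfm a (by simp)) (h a (by simp))
      (ih (fun i hi => hfm i (by simp [hi])) (fun i hi => h i (by simp [hi])))

lemma taylorLp_of_pointwise {E : Type*} [NormedAddCommGroup E] (hp : 0 < p) {f P : Euc n → E}
    {x : Euc n}
    (h : ∀ ε : ℝ, 0 < ε → ∀ᶠ r in 𝓝[>] (0 : ℝ), ∀ y ∈ ball x r, ‖f y - P y‖ ≤ ε * r ^ j) :
    ∀ ε : ℝ, 0 < ε → ∀ᶠ r in 𝓝[>] (0 : ℝ),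
    ∫⁻ y in ball x r, ‖f y - P y‖ₑ ^ p ≤ ENNReal.ofReal (ε * r ^ ((n : ℝ) + j * p)) := by
  intro ε hε
  set c := volume (ball (0 : Euc n) 1) with hc
  have hc0 : c ≠ 0 := volume_unit_ball_pos.ne'
  have hct : c ≠ ∞ := volume_unit_ball_lt_top.ne
  have hc' := ENNReal.toReal_pos hc0 hct
  filter_upwards [h ((ε / c.toReal) ^ p⁻¹) (by positivity), self_mem_nhdsWithin] with r hr hr0
  have hr0 : 0 < r := hr0
  calc _ ≤ ∫⁻ y in ball x r, ENNReal.ofReal ((ε / c.toReal) ^ p⁻¹ * r ^ j) ^ p := by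
        refine setLIntegral_mono measurable_const fun y hy => ?_
        gcongr
        rw [← ofReal_norm]
        exact ENNReal.ofReal_le_ofReal (hr y hy)
    _ = ENNReal.ofReal (((ε / c.toReal) ^ p⁻¹ * r ^ j) ^ p) *
          (ENNReal.ofReal (r ^ n) * ENNReal.ofReal c.toReal) := by
        rw [setLIntegral_const, volume_ball_euc x hr0, ENNReal.ofReal_toReal hct,
          ENNReal.ofReal_rpow_of_nonneg (by positivity) hp.le]
    _ ≤ _ := by
        rw [← ENNReal.ofReal_mul (by positivity), ← ENNReal.ofReal_mul (by positivity)]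
        apply le_of_eq
        congr 1
        rw [Real.mul_rpow (by positivity) (by positivity), ← Real.rpow_mul (by positivity),
          inv_mul_cancel₀ hp.ne', Real.rpow_one, Real.rpow_add hr0, Real.rpow_mul hr0.le,
          Real.rpow_natCast, Real.rpow_natCast]
        field_simp

/-- Taylor's theorem with a bound for the remainder. -/
lemma norm_taylor_remainder_le [CompleteSpace F] {f : Euc n → F} (hf : ContDiff ℝ (⊤ : ℕ∞) f)
    (x v : Euc n) {C : ℝ} (hC : ∀ t ∈ Set.Icc (0 : ℝ) 1, ‖iteratedFDeriv ℝ (j + 1) f (x + t • v)‖ ≤ C) :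
    ‖f (x + v) - ∑ m ∈ Finset.range (j + 1),
      (m.factorial : ℝ)⁻¹ • iteratedFDeriv ℝ m f x (fun _ => v)‖ ≤ C * ‖v‖ ^ (j + 1) := by
  have hC0 : 0 ≤ C := (norm_nonneg _).trans (hC 0 (by simp))
  rw [map_add_eq_sum_add_integral_iteratedFDeriv (n := j) (f := f) (x := x) (y := v)
    (fun t _ => hf.contDiffAt.of_le (by exact_mod_cast le_top)), add_sub_cancel_left, norm_smul]
  have h1 : ‖∫ t in (0:ℝ)..1, (1 - t)^j • iteratedFDeriv ℝ (j + 1) f (x + t • v) (fun _ ↦ v)‖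
      ≤ C * ‖v‖ ^ (j + 1) * |1 - 0| := by
    apply intervalIntegral.norm_integral_le_of_norm_le_const
    intro t ht
    rw [Set.uIoc_of_le zero_le_one] at ht
    rw [norm_smul]
    have h2 : ‖(1 - t) ^ j‖ ≤ 1 := by
      rw [norm_pow, Real.norm_eq_abs, abs_of_nonneg (by linarith [ht.2])]
      exact pow_le_one₀ (by linarith [ht.2]) (by linarith [ht.1])
    have h3 := (iteratedFDeriv ℝ (j + 1) f (x + t • v)).le_opNorm (fun _ => v)
    simp only [Finset.prod_const, Finset.card_univ, Fintype.card_fin] at h3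
    calc _ ≤ 1 * (C * ‖v‖ ^ (j + 1)) := by
          gcongr
          exact h3.trans (by gcongr; exact hC t ⟨ht.1.le, ht.2⟩)
      _ = _ := one_mul _
  have h4 : ‖((j.factorial : ℝ))⁻¹‖ ≤ 1 := by
    rw [norm_inv, Real.norm_natCast]
    exact inv_le_one_of_one_le₀ (by exact_mod_cast Nat.one_le_iff_ne_zero.2 (Nat.factorial_ne_zero _))
  calc _ ≤ 1 * (C * ‖v‖ ^ (j + 1) * |1 - 0|) := by gcongr
    _ = _ := by simp

lemma ContDiff.taylorLp [CompleteSpace F] (hp : 0 < p) {f : Euc n → F} (hf : ContDiff ℝ (⊤ : ℕ∞) f) (x : Euc n) :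
    TaylorLp n j p f x := by
  have hP : IsPolyDeg n j (fun y => ∑ m ∈ Finset.range (j + 1),
      ((m.factorial : ℝ)⁻¹ • iteratedFDeriv ℝ m f x) (fun _ => y - x)) :=
    IsPolyDeg.sum _ fun m hm => isPolyDeg_diagonal _ x (by simp at hm; omega)
  refine ⟨_, hP, taylorLp_of_pointwise hp fun ε hε => ?_⟩
  have hcont : Continuous (iteratedFDeriv ℝ (j + 1) f) :=
    hf.continuous_iteratedFDeriv (by exact_mod_cast le_top)
  obtain ⟨C, hC⟩ := (isCompact_closedBall x 1).exists_bound_of_continuousOn hcont.continuousOn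
  have hC0 : 0 ≤ C := (norm_nonneg _).trans (hC x (by simp))
  have hr1 : ∀ᶠ r in 𝓝[>] (0 : ℝ), r < min 1 (ε / (C + 1)) :=
    Filter.Eventually.filter_mono nhdsWithin_le_nhds (Iio_mem_nhds (by positivity))
  filter_upwards [hr1, self_mem_nhdsWithin] with r hr hr0 y hy
  have hr0 : 0 < r := hr0
  have hyr : ‖y - x‖ < r := by simpa [dist_eq_norm] using hy
  have h := norm_taylor_remainder_le hf x (y - x) (j := j) (C := C) (fun t ht => hC _ (by
    rw [mem_closedBall, dist_eq_norm, add_sub_cancel_left, norm_smul, Real.norm_eq_abs,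
      abs_of_nonneg ht.1]
    calc t * ‖y - x‖ ≤ 1 * 1 := by
          gcongr
          · exact ht.2
          · exact (hyr.trans (hr.trans_le (min_le_left _ _))).le
      _ = 1 := one_mul 1))
  rw [add_sub_cancel] at h
  refine h.trans ?_
  calc C * ‖y - x‖ ^ (j + 1) ≤ (C + 1) * r ^ (j + 1) := by gcongr; linarith
    _ = ((C + 1) * r) * r ^ j := by ring
    _ ≤ ε * r ^ j := by
        gcongr
        have := hr.trans_le (min_le_right _ _)
        rw [lt_div_iff₀ (by positivity)] at this
        linarith

end TaylorLp

section DirDeriv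

variable {F G : Type*} [NormedAddCommGroup F] [NormedSpace ℝ F]
  [NormedAddCommGroup G] [NormedSpace ℝ G] {n m : ℕ}

lemma inner_stdVec (x : Euc n) (i : Fin n) : ⟪stdVec n i, x⟫ = x i := by
  simp [stdVec, EuclideanSpace.inner_single_left]

@[simp] lemma dirDeriv_zero (I : Fin 0 → Fin n) (φ : Euc n → F) : dirDeriv n 0 I φ = φ := by
  ext x; simp [dirDeriv]

lemma ContDiff.fderiv_apply_const {φ : Euc n → F} (hφ : ContDiff ℝ (⊤ : ℕ∞) φ) (e : Euc n) :
    ContDiff ℝ (⊤ : ℕ∞) (fun y => fderiv ℝ φ y e) :=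
  (hφ.fderiv_right (by simp)).clm_apply contDiff_const

lemma dirDeriv_succ_right {φ : Euc n → F} (hφ : ContDiff ℝ (⊤ : ℕ∞) φ)
    (I : Fin (m + 1) → Fin n) :
    dirDeriv n (m + 1) I φ =
      dirDeriv n m (Fin.init I) (fun y => fderiv ℝ φ y (stdVec n (I (Fin.last m)))) := by
  ext x
  unfold dirDeriv
  rw [iteratedFDeriv_succ_apply_right, iteratedFDeriv_clm_apply_const_apply]
  · rfl
  · exact (hφ.fderiv_right (m := (⊤ : ℕ∞)) (by simp))
  · exact_mod_cast le_top

lemma ContDiff.dirDeriv {φ : Euc n → F} (hφ : ContDiff ℝ (⊤ : ℕ∞) φ) (I : Fin m → Fin n) :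
    ContDiff ℝ (⊤ : ℕ∞) (dirDeriv n m I φ) := by
  induction m generalizing φ with
  | zero => simpa using hφ
  | succ m ih => rw [dirDeriv_succ_right hφ]; exact ih (hφ.fderiv_apply_const _) _

lemma HasCompactSupport.dirDeriv {φ : Euc n → F} (hφ : HasCompactSupport φ) (I : Fin m → Fin n) :
    HasCompactSupport (dirDeriv n m I φ) :=
  (hφ.iteratedFDeriv (𝕜 := ℝ) m).comp_left
    (g := fun T : ContinuousMultilinearMap ℝ (fun _ : Fin m => Euc n) F =>
      T (fun i => stdVec n (I i))) (by simp)

lemma IsTestFun.dirDeriv {φ : Euc n → F} (hφ : IsTestFun n φ) (I : Fin m → Fin n) :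
    IsTestFun n (dirDeriv n m I φ) :=
  ⟨hφ.1.dirDeriv I, hφ.2.dirDeriv I⟩

lemma dirDeriv_clm_comp (L : F →L[ℝ] G) {φ : Euc n → F} (hφ : ContDiff ℝ (⊤ : ℕ∞) φ)
    (I : Fin m → Fin n) (x : Euc n) :
    dirDeriv n m I (fun y => L (φ y)) x = L (dirDeriv n m I φ x) := by
  have := L.iteratedFDeriv_comp_left (hφ.contDiffAt (x := x)) (i := m) (by exact_mod_cast le_top)
  unfold dirDeriv
  change iteratedFDeriv ℝ m (L ∘ φ) x _ = _
  rw [this]; rfl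

lemma dirDeriv_add {φ ψ : Euc n → F} (hφ : ContDiff ℝ (⊤ : ℕ∞) φ) (hψ : ContDiff ℝ (⊤ : ℕ∞) ψ)
    (I : Fin m → Fin n) (x : Euc n) :
    dirDeriv n m I (fun y => φ y + ψ y) x = dirDeriv n m I φ x + dirDeriv n m I ψ x := by
  unfold dirDeriv
  rw [fun_iteratedFDeriv_add_apply
      (hφ.contDiffAt.of_le (by exact_mod_cast le_top))
      (hψ.contDiffAt.of_le (by exact_mod_cast le_top))]
  rfl

lemma dirDeriv_const_smul (c : ℝ) {φ : Euc n → F} (hφ : ContDiff ℝ (⊤ : ℕ∞) φ)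
    (I : Fin m → Fin n) (x : Euc n) :
    dirDeriv n m I (fun y => c • φ y) x = c • dirDeriv n m I φ x :=
  dirDeriv_clm_comp (c • ContinuousLinearMap.id ℝ F) hφ I x

lemma dirDeriv_const_mul (c : ℝ) {φ : Euc n → ℝ} (hφ : ContDiff ℝ (⊤ : ℕ∞) φ)
    (I : Fin m → Fin n) (x : Euc n) :
    dirDeriv n m I (fun y => c * φ y) x = c * dirDeriv n m I φ x :=
  dirDeriv_const_smul c hφ I x

lemma dirDeriv_neg {φ : Euc n → F} (hφ : ContDiff ℝ (⊤ : ℕ∞) φ)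
    (I : Fin m → Fin n) (x : Euc n) :
    dirDeriv n m I (fun y => - φ y) x = - dirDeriv n m I φ x := by
  simpa using dirDeriv_const_smul (-1) hφ I x

lemma dirDeriv_sub {φ ψ : Euc n → F} (hφ : ContDiff ℝ (⊤ : ℕ∞) φ) (hψ : ContDiff ℝ (⊤ : ℕ∞) ψ)
    (I : Fin m → Fin n) (x : Euc n) :
    dirDeriv n m I (fun y => φ y - ψ y) x = dirDeriv n m I φ x - dirDeriv n m I ψ x := by
  simp only [sub_eq_add_neg]
  rw [dirDeriv_add hφ hψ.neg, dirDeriv_neg hψ]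

lemma dirDeriv_comp_sub_const (φ : Euc n → F) (I : Fin m → Fin n) (a x : Euc n) :
    dirDeriv n m I (fun y => φ (y - a)) x = dirDeriv n m I φ (x - a) := by
  unfold dirDeriv; rw [iteratedFDeriv_comp_sub]

lemma dirDeriv_comp_smul {φ : Euc n → F} (hφ : ContDiff ℝ (⊤ : ℕ∞) φ) (c : ℝ)
    (I : Fin m → Fin n) (x : Euc n) :
    dirDeriv n m I (fun y => φ (c • y)) x = c ^ m • dirDeriv n m I φ (c • x) := by
  have := (c • ContinuousLinearMap.id ℝ (Euc n)).iteratedFDeriv_comp_right hφ x (i := m)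
    (by exact_mod_cast le_top)
  unfold dirDeriv
  change iteratedFDeriv ℝ m (φ ∘ (c • ContinuousLinearMap.id ℝ (Euc n))) x _ = _
  rw [this]
  simp only [ContinuousMultilinearMap.compContinuousLinearMap_apply, FunLike.coe_smul, Pi.smul_apply,
    ContinuousLinearMap.coe_id', id]
  rw [ContinuousMultilinearMap.map_smul_univ]
  simp

lemma dirDeriv_comp_const_sub {φ : Euc n → F} (hφ : ContDiff ℝ (⊤ : ℕ∞) φ)
    (I : Fin m → Fin n) (a x : Euc n) :
    dirDeriv n m I (fun y => φ (a - y)) x = (-1 : ℝ) ^ m • dirDeriv n m I φ (a - x) := by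
  have h : (fun y => φ (a - y)) = fun y => (fun z => φ ((-1 : ℝ) • z)) (y - a) := by
    ext y; simp
  rw [h, dirDeriv_comp_sub_const (fun z => φ ((-1 : ℝ) • z)), dirDeriv_comp_smul hφ]
  simp

lemma fderiv_dirDeriv_comm {φ : Euc n → F} (hφ : ContDiff ℝ (⊤ : ℕ∞) φ)
    (I : Fin m → Fin n) (e : Euc n) :
    (fun x => fderiv ℝ (dirDeriv n m I φ) x e) = dirDeriv n m I (fun y => fderiv ℝ φ y e) := by
  induction m generalizing φ with
  | zero => simp
  | succ m ih =>
    rw [dirDeriv_succ_right hφ, dirDeriv_succ_right (hφ.fderiv_apply_const e),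
      ih (hφ.fderiv_apply_const _)]
    congr 1
    ext y
    have hd : DifferentiableAt ℝ (fderiv ℝ φ) y :=
      ((hφ.fderiv_right (m := (⊤ : ℕ∞)) (by simp)).differentiable (by simp)) y
    have h1 : ∀ u w : Euc n, fderiv ℝ (fun y => fderiv ℝ φ y u) y w = fderiv ℝ (fderiv ℝ φ) y w u := by
      intro u w
      rw [fderiv_clm_apply hd (by fun_prop)]
      simp
    rw [h1, h1]
    exact (hφ.contDiffAt.isSymmSndFDerivAt (by
      simp only [minSmoothness_of_isRCLikeNormedField]
      exact WithTop.coe_le_coe.2 (le_top (a := (2 : ℕ∞))))).eq _ _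

lemma IsTestFun.fderiv_apply_const {φ : Euc n → F} (hφ : IsTestFun n φ) (e : Euc n) :
    IsTestFun n (fun y => fderiv ℝ φ y e) :=
  ⟨hφ.1.fderiv_apply_const e, hφ.2.fderiv_apply ℝ e⟩

lemma integral_mul_dirDeriv {f g : Euc n → ℝ} (hf : ContDiff ℝ (⊤ : ℕ∞) f) (hg : IsTestFun n g)
    (I : Fin m → Fin n) :
    ∫ x, f x * dirDeriv n m I g x = (-1) ^ m * ∫ x, dirDeriv n m I f x * g x := by
  induction m generalizing g with
  | zero => simp
  | succ m ih =>
    rw [dirDeriv_succ_right hg.1, ih (hg.fderiv_apply_const _) (Fin.init I),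
      dirDeriv_succ_right hf, ← fderiv_dirDeriv_comm hf]
    have hD := hf.dirDeriv (Fin.init I)
    rw [integral_mul_fderiv_eq_neg_fderiv_mul_of_integrable]
    · ring
    · exact ((hD.fderiv_apply_const _).continuous.mul hg.1.continuous).integrable_of_hasCompactSupport
        hg.2.mul_left
    · exact (hD.continuous.mul (hg.fderiv_apply_const _).1.continuous).integrable_of_hasCompactSupport
        (hg.fderiv_apply_const _).2.mul_left
    · exact (hD.continuous.mul hg.1.continuous).integrable_of_hasCompactSupport hg.2.mul_left
    · exact fun x _ => hD.differentiable (by simp) x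
    · exact fun x _ => hg.1.differentiable (by simp) x

lemma dirDeriv_comp_inner {φ : ℝ → ℝ} (hφ : ContDiff ℝ (⊤ : ℕ∞) φ) (ξ : Euc n)
    (I : Fin m → Fin n) (x : Euc n) :
    dirDeriv n m I (fun y => φ ⟪ξ, y⟫) x = (∏ i, ξ (I i)) * iteratedDeriv m φ ⟪ξ, x⟫ := by
  have := (innerSL ℝ ξ).iteratedFDeriv_comp_right hφ x (i := m) (by exact_mod_cast le_top)
  unfold dirDeriv
  change iteratedFDeriv ℝ m (φ ∘ (innerSL ℝ ξ)) x _ = _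
  rw [this]
  simp only [ContinuousMultilinearMap.compContinuousLinearMap_apply]
  rw [iteratedFDeriv_apply_eq_iteratedDeriv_mul_prod]
  simp [real_inner_comm _ ξ, inner_stdVec]

end DirDeriv

section Lacunary

/-- A lacunary series that is nowhere differentiable. -/
noncomputable def lacunary (t : ℝ) : ℝ := ∑' j : ℕ, (1 / 2) ^ j * Real.cos (16 ^ j * t)

lemma summable_lacunary (t : ℝ) : Summable fun j : ℕ => (1 / 2 : ℝ) ^ j * Real.cos (16 ^ j * t) :=
  Summable.of_norm_bounded (summable_geometric_of_lt_one (by norm_num) (by norm_num : (1 / 2 : ℝ) < 1))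
    fun j => by
      rw [norm_mul, norm_pow, Real.norm_eq_abs, Real.norm_eq_abs, abs_of_pos (by norm_num : (0:ℝ) < 1/2)]
      exact mul_le_of_le_one_right (by positivity) (Real.abs_cos_le_one _)

lemma continuous_lacunary : Continuous lacunary := by
  refine continuous_tsum (fun j => by fun_prop)
    (summable_geometric_of_lt_one (by norm_num) (by norm_num : (1 / 2 : ℝ) < 1)) fun j t => ?_
  rw [norm_mul, norm_pow, Real.norm_eq_abs, Real.norm_eq_abs, abs_of_pos (by norm_num : (0:ℝ) < 1/2)]
  exact mul_le_of_le_one_right (by positivity) (Real.abs_cos_le_one _)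

lemma abs_lacunary_sub_ge (i : ℕ) (t : ℝ) :
    (1 / 2) ^ i * (2 * |Real.cos (16 ^ i * t)| - 1 / 2) ≤
      |lacunary (t + Real.pi / 16 ^ i) - lacunary t| := by
  set s := Real.pi / 16 ^ i with hs
  have hs0 : 0 < s := by positivity
  set a : ℕ → ℝ := fun j => (1 / 2) ^ j * Real.cos (16 ^ j * (t + s)) -
    (1 / 2) ^ j * Real.cos (16 ^ j * t) with ha
  have hsum : Summable a := (summable_lacunary (t + s)).sub (summable_lacunary t)
  have h1 : lacunary (t + s) - lacunary t = ∑' j, a j :=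
    ((summable_lacunary (t + s)).tsum_sub (summable_lacunary t)).symm
  have htail : ∑' j, a (j + (i + 1)) = 0 := by
    have : ∀ j, a (j + (i + 1)) = 0 := by
      intro j
      have h2 : (16 : ℝ) ^ (j + (i + 1)) * (t + s) =
          16 ^ (j + (i + 1)) * t + ((8 * 16 ^ j : ℕ) : ℝ) * (2 * Real.pi) := by
        rw [hs]; push_cast; field_simp; ring
      simp only [ha]
      rw [h2, Real.cos_add_nat_mul_two_pi, sub_self]
    simp [this]
  have hmid : a i = - 2 * (1 / 2) ^ i * Real.cos (16 ^ i * t) := by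
    have h2 : (16 : ℝ) ^ i * (t + s) = 16 ^ i * t + Real.pi := by rw [hs]; field_simp
    simp only [ha]
    rw [h2, Real.cos_add_pi]; ring
  have hhead : |∑ j ∈ Finset.range i, a j| ≤ (1 / 2) ^ i * (1 / 2) := by
    have hterm : ∀ j ∈ Finset.range i, |a j| ≤ 8 ^ j * s := by
      intro j _
      simp only [ha]
      rw [← mul_sub, abs_mul, abs_of_pos (by positivity : (0:ℝ) < (1 / 2) ^ j)]
      have h3 := Real.abs_cos_sub_cos_le (16 ^ j * (t + s)) (16 ^ j * t)
      rw [← mul_sub, add_sub_cancel_left, abs_of_pos (mul_pos (by positivity) hs0)] at h3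
      calc (1 / 2 : ℝ) ^ j * _ ≤ (1 / 2) ^ j * (16 ^ j * s) := by gcongr
        _ = 8 ^ j * s := by rw [← mul_assoc, ← mul_pow]; norm_num
    have hgeom : ∑ j ∈ Finset.range i, (8 : ℝ) ^ j ≤ 8 ^ i / 7 := by
      rw [geom_sum_eq (by norm_num)]
      have : (8 : ℝ) - 1 = 7 := by norm_num
      rw [this]; gcongr; linarith
    calc |∑ j ∈ Finset.range i, a j| ≤ ∑ j ∈ Finset.range i, |a j| := Finset.abs_sum_le_sum_abs _ _
      _ ≤ ∑ j ∈ Finset.range i, 8 ^ j * s := Finset.sum_le_sum hterm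
      _ = (∑ j ∈ Finset.range i, 8 ^ j) * s := by rw [Finset.sum_mul]
      _ ≤ 8 ^ i / 7 * s := by gcongr
      _ = (1 / 2) ^ i * (Real.pi / 7) := by
        rw [hs, show (16 : ℝ) ^ i = 8 ^ i * 2 ^ i by rw [← mul_pow]; norm_num, one_div, inv_pow]
        field_simp
      _ ≤ (1 / 2) ^ i * (1 / 2) :=
        mul_le_mul_of_nonneg_left (by linarith [Real.pi_lt_d2]) (by positivity)
  rw [h1, ← hsum.sum_add_tsum_nat_add (i + 1), htail, add_zero, Finset.sum_range_succ, hmid]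
  have h4 : |(-2 : ℝ) * (1 / 2) ^ i * Real.cos (16 ^ i * t)| =
      (1 / 2) ^ i * (2 * |Real.cos (16 ^ i * t)|) := by
    rw [abs_mul, abs_mul, abs_of_pos (by positivity : (0:ℝ) < (1 / 2) ^ i)]; norm_num; ring
  have h5 := abs_sub_abs_le_abs_sub (-2 * (1 / 2) ^ i * Real.cos (16 ^ i * t))
    (-(∑ j ∈ Finset.range i, a j))
  rw [sub_neg_eq_add, abs_neg, add_comm _ (∑ j ∈ Finset.range i, a j)] at h5
  linarith

lemma lacunary_oscillation (i : ℕ) (t : ℝ) :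
    (1 / 2) ^ i ≤ |lacunary (t + Real.pi / 16 ^ i) - lacunary t| +
      |lacunary (t + 3 / 2 * (Real.pi / 16 ^ i)) - lacunary (t + 1 / 2 * (Real.pi / 16 ^ i))| := by
  have h1 := abs_lacunary_sub_ge i t
  have h2 := abs_lacunary_sub_ge i (t + 1 / 2 * (Real.pi / 16 ^ i))
  have h3 : (16 : ℝ) ^ i * (t + 1 / 2 * (Real.pi / 16 ^ i)) = 16 ^ i * t + Real.pi / 2 := by
    field_simp
  rw [h3, Real.cos_add_pi_div_two, abs_neg,
    show t + 1 / 2 * (Real.pi / 16 ^ i) + Real.pi / 16 ^ i =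
      t + 3 / 2 * (Real.pi / 16 ^ i) by ring] at h2
  have h4 : 1 ≤ |Real.cos (16 ^ i * t)| + |Real.sin (16 ^ i * t)| := by
    have := Real.sin_sq_add_cos_sq (16 ^ i * t)
    have ha := abs_nonneg (Real.cos (16 ^ i * t))
    have hb := abs_nonneg (Real.sin (16 ^ i * t))
    rw [← sq_abs, ← sq_abs (Real.cos _)] at this
    nlinarith
  have h5 : (0 : ℝ) < (1 / 2) ^ i := by positivity
  nlinarith

lemma setLIntegral_comp_add_le {n : ℕ} {f : Euc n → ℝ≥0∞} {x v : Euc n} {ρ R : ℝ}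
    (h : ρ + ‖v‖ ≤ R) : ∫⁻ y in ball x ρ, f (y + v) ≤ ∫⁻ y in ball x R, f y := by
  rw [← lintegral_indicator measurableSet_ball, ← lintegral_indicator measurableSet_ball,
    ← lintegral_add_right_eq_self ((ball x R).indicator f) v]
  refine lintegral_mono fun y => ?_
  by_cases hy : y ∈ ball x ρ
  · have : y + v ∈ ball x R := by
      rw [mem_ball, dist_eq_norm] at hy ⊢
      calc ‖y + v - x‖ = ‖(y - x) + v‖ := by congr 1; abel
        _ ≤ ‖y - x‖ + ‖v‖ := norm_add_le _ _
        _ < R := by linarith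
    simp only [Set.indicator_of_mem, hy, this, le_refl]
  · simp [hy]

lemma not_approx_lacunary {n : ℕ} {ξ : Euc n} (hξ : ξ ≠ 0) {c : ℝ} (hc : c ≠ 0) {P : Euc n → ℝ}
    (hP : ContDiff ℝ (⊤ : ℕ∞) P) (x : Euc n) (K : ℝ) :
    ¬ ∀ᶠ r in 𝓝[>] (0 : ℝ), ∫⁻ y in ball x r, ‖c * lacunary ⟪ξ, y⟫ - P y‖ₑ ≤
      ENNReal.ofReal (K * r ^ (n + 1)) := by
  intro hev
  obtain ⟨L, t, ht, hL⟩ := (hP.contDiffAt (x := x)).of_le (m := 1) (by exact_mod_cast le_top)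
    |>.exists_lipschitzOnWith
  obtain ⟨ρ0, hρ0, hρt⟩ := Metric.mem_nhds_iff.1 ht
  have hξn : 0 < ‖ξ‖ := norm_pos_iff.2 hξ
  set M : ℝ := 1 + 2 * Real.pi / ‖ξ‖ with hM
  have hM0 : 0 < M := by positivity
  have ht16 : Tendsto (fun i : ℕ => M * (1 / 16 : ℝ) ^ i) atTop (𝓝[>] 0) := by
    refine tendsto_nhdsWithin_iff.2 ⟨?_, Eventually.of_forall fun i => by simp; positivity⟩
    simpa using (tendsto_pow_atTop_nhds_zero_of_lt_one (by norm_num)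
      (by norm_num : (1 / 16 : ℝ) < 1)).const_mul M
  have ht8 : Tendsto (fun i : ℕ => (1 / 8 : ℝ) ^ i) atTop (𝓝 0) :=
    tendsto_pow_atTop_nhds_zero_of_lt_one (by norm_num) (by norm_num)
  set ω := (volume (ball (0 : Euc n) 1)).toReal with hω
  have hω0 : 0 < ω := ENNReal.toReal_pos volume_unit_ball_pos.ne' volume_unit_ball_lt_top.ne
  have hc0 : 0 < |c| := abs_pos.2 hc
  have e1 := ht16.eventually hev
  have e2 : ∀ᶠ i : ℕ in atTop, M * (1 / 16 : ℝ) ^ i < ρ0 :=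
    (tendsto_nhdsWithin_iff.1 ht16).1.eventually (Iio_mem_nhds hρ0)
  have e3 : ∀ᶠ i : ℕ in atTop, (1 / 8 : ℝ) ^ i < |c| / 2 / (2 * L * (Real.pi / ‖ξ‖) + 1) :=
    ht8.eventually (Iio_mem_nhds (by positivity))
  have e4 : ∀ᶠ i : ℕ in atTop, (1 / 8 : ℝ) ^ i < |c| / 2 * ω / (4 * |K| * M ^ (n + 1) + 1) :=
    ht8.eventually (Iio_mem_nhds (by positivity))
  obtain ⟨i, h1, h2, h3, h4⟩ := (e1.and (e2.and (e3.and e4))).exists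
  set ρ : ℝ := (1 / 16) ^ i with hρ
  have hρ0 : 0 < ρ := by positivity
  have h28 : (1 / 16 : ℝ) ^ i = (1 / 2) ^ i * (1 / 8) ^ i := by rw [← mul_pow]; norm_num
  set S : Euc n := ((Real.pi / 16 ^ i) / ‖ξ‖ ^ 2) • ξ with hS
  have hSn : ‖S‖ = Real.pi / ‖ξ‖ * ρ := by
    rw [hS, norm_smul, Real.norm_eq_abs, abs_of_pos (by positivity), hρ, one_div, inv_pow]
    field_simp
  have hSi : ∀ (a : ℝ) y, ⟪ξ, y + a • S⟫ = ⟪ξ, y⟫ + a * (Real.pi / 16 ^ i) := by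
    intro a y
    rw [inner_add_right, hS, smul_smul, inner_smul_right, real_inner_self_eq_norm_sq]
    field_simp
  set e : Euc n → ℝ := fun y => c * lacunary ⟪ξ, y⟫ - P y with he
  have hec : Continuous e := by
    have := continuous_lacunary
    have := hP.continuous
    fun_prop
  have hin : ∀ a : ℝ, 0 ≤ a → a ≤ 3 / 2 → ∀ y ∈ ball x ρ, y + a • S ∈ t := by
    intro a ha ha' y hy
    apply hρt
    rw [mem_ball, dist_eq_norm] at hy ⊢
    calc ‖y + a • S - x‖ = ‖(y - x) + a • S‖ := by congr 1; abel
      _ ≤ ‖y - x‖ + a * ‖S‖ := by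
        refine (norm_add_le _ _).trans ?_
        rw [norm_smul, Real.norm_eq_abs, abs_of_nonneg ha]
      _ ≤ ρ + 2 * ‖S‖ := by gcongr; linarith
      _ = M * ρ := by rw [hSn, hM]; ring
      _ < _ := h2
  have hLip : ∀ a b : ℝ, 0 ≤ a → a ≤ 3 / 2 → 0 ≤ b → b ≤ 3 / 2 → |a - b| = 1 → ∀ y ∈ ball x ρ,
      |P (y + a • S) - P (y + b • S)| ≤ L * ‖S‖ := by
    intro a b ha ha' hb hb' hab y hy
    have := hL.dist_le_mul _ (hin a ha ha' y hy) _ (hin b hb hb' y hy)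
    rw [Real.dist_eq, dist_eq_norm, add_sub_add_left_eq_sub, ← sub_smul, norm_smul,
      Real.norm_eq_abs, hab, one_mul] at this
    exact this
  have hpt : ∀ y ∈ ball x ρ, |c| / 2 * (1 / 2) ^ i ≤ |e (y + (0 : ℝ) • S)| + |e (y + (1 : ℝ) • S)| +
      |e (y + (1 / 2 : ℝ) • S)| + |e (y + (3 / 2 : ℝ) • S)| := by
    intro y hy
    have ho := lacunary_oscillation i ⟪ξ, y⟫
    have hl1 := hLip 1 0 (by norm_num) (by norm_num) (by norm_num) (by norm_num) (by norm_num) y hy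
    have hl2 := hLip (3 / 2) (1 / 2) (by norm_num) (by norm_num) (by norm_num) (by norm_num)
      (by norm_num) y hy
    have hkey : ∀ a b : ℝ, |c| * |lacunary ⟪ξ, y + a • S⟫ - lacunary ⟪ξ, y + b • S⟫| ≤
        |e (y + a • S)| + |e (y + b • S)| + |P (y + a • S) - P (y + b • S)| := by
      intro a b
      rw [← abs_mul]
      have : c * (lacunary ⟪ξ, y + a • S⟫ - lacunary ⟪ξ, y + b • S⟫) =
          e (y + a • S) - e (y + b • S) + (P (y + a • S) - P (y + b • S)) := by
        simp only [he]; ring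
      rw [this]
      exact (abs_add_le _ _).trans (by gcongr; exact abs_sub _ _)
    have hk1 := hkey 1 0
    have hk2 := hkey (3 / 2) (1 / 2)
    rw [hSi, hSi, one_mul, zero_mul, add_zero] at hk1
    rw [hSi, hSi] at hk2
    have hL2 : 2 * (L * ‖S‖) ≤ |c| / 2 * (1 / 2) ^ i := by
      rw [lt_div_iff₀ (by positivity)] at h3
      rw [hSn, hρ, h28]
      have : (1 / 2 : ℝ) ^ i * ((1 / 8) ^ i * (2 * L * (Real.pi / ‖ξ‖) + 1)) ≤
        (1 / 2 : ℝ) ^ i * (|c| / 2) := by gcongr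
      have h0 : (0 : ℝ) ≤ (1 / 2 : ℝ) ^ i * (1 / 8) ^ i := by positivity
      nlinarith
    have := mul_le_mul_of_nonneg_left ho hc0.le
    nlinarith
  have hint : ENNReal.ofReal (|c| / 2 * (1 / 2) ^ i) * volume (ball x ρ) ≤
      4 * ENNReal.ofReal (K * (M * ρ) ^ (n + 1)) := by
    have hb : ∀ a : ℝ, 0 ≤ a → a ≤ 3 / 2 → ∫⁻ y in ball x ρ, ‖e (y + a • S)‖ₑ ≤
        ENNReal.ofReal (K * (M * ρ) ^ (n + 1)) := by
      intro a ha ha'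
      refine (setLIntegral_comp_add_le (f := fun y => ‖e y‖ₑ) (R := M * ρ) ?_).trans h1
      rw [norm_smul, Real.norm_eq_abs, abs_of_nonneg ha]
      calc ρ + a * ‖S‖ ≤ ρ + 2 * ‖S‖ := by gcongr; linarith
        _ = M * ρ := by rw [hSn, hM]; ring
    have hm : ∀ a : ℝ, Measurable fun y => ‖e (y + a • S)‖ₑ := fun a =>
      (hec.comp (by fun_prop)).enorm.measurable
    calc _ = ∫⁻ y in ball x ρ, ENNReal.ofReal (|c| / 2 * (1 / 2) ^ i) := by rw [setLIntegral_const]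
      _ ≤ ∫⁻ y in ball x ρ, (‖e (y + (0 : ℝ) • S)‖ₑ + ‖e (y + (1 : ℝ) • S)‖ₑ +
            ‖e (y + (1 / 2 : ℝ) • S)‖ₑ + ‖e (y + (3 / 2 : ℝ) • S)‖ₑ) := by
          refine setLIntegral_mono' measurableSet_ball fun y hy => ?_
          simp only [← ofReal_norm, Real.norm_eq_abs]
          rw [← ENNReal.ofReal_add (by positivity) (by positivity),
            ← ENNReal.ofReal_add (by positivity) (by positivity),
            ← ENNReal.ofReal_add (by positivity) (by positivity)]
          exact ENNReal.ofReal_le_ofReal (hpt y hy)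
      _ ≤ ENNReal.ofReal (K * (M * ρ) ^ (n + 1)) + ENNReal.ofReal (K * (M * ρ) ^ (n + 1)) +
          ENNReal.ofReal (K * (M * ρ) ^ (n + 1)) + ENNReal.ofReal (K * (M * ρ) ^ (n + 1)) := by
          rw [lintegral_add_right _ (hm _), lintegral_add_right _ (hm _),
            lintegral_add_right _ (hm _)]
          gcongr <;> exact hb _ (by norm_num) (by norm_num)
      _ = _ := by ring
  rw [volume_ball_euc x hρ0, ← ENNReal.ofReal_toReal volume_unit_ball_lt_top.ne, ← hω,
    ← ENNReal.ofReal_mul (by positivity), ← ENNReal.ofReal_mul (by positivity),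
    show (4 : ℝ≥0∞) = ENNReal.ofReal 4 by simp, ← ENNReal.ofReal_mul (by positivity)] at hint
  have hpos : 0 < |c| / 2 * (1 / 2) ^ i * (ρ ^ n * ω) := by positivity
  have hfin := (ENNReal.ofReal_le_ofReal_iff'.1 hint).resolve_right (by linarith)
  rw [lt_div_iff₀ (by positivity)] at h4
  have h5 : |c| / 2 * (1 / 2) ^ i * (ρ ^ n * ω) = (|c| / 2 * ω) * ((1 / 2) ^ i * ρ ^ n) := by ring
  have h6 : 4 * (K * (M * ρ) ^ (n + 1)) ≤
      ((1 / 8) ^ i * (4 * |K| * M ^ (n + 1))) * ((1 / 2) ^ i * ρ ^ n) := by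
    have : 4 * (K * (M * ρ) ^ (n + 1)) ≤ 4 * (|K| * (M * ρ) ^ (n + 1)) := by
      gcongr; exact le_abs_self K
    refine this.trans (le_of_eq ?_)
    have : ρ = (1 / 2) ^ i * (1 / 8) ^ i := h28
    rw [mul_pow, pow_succ ρ n]
    nth_rewrite 2 [this]
    ring
  have h7 : 0 < (1 / 2 : ℝ) ^ i * ρ ^ n := by positivity
  have h8 : 0 < (1 / 8 : ℝ) ^ i := by positivity
  nlinarith

end Lacunary

section Converse

lemma iteratedDeriv_cos_affine (i : ℕ) (a b c : ℝ) :
    iteratedDeriv i (fun t => a * Real.cos (b * t + c)) =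
      fun t => a * b ^ i * Real.cos (b * t + (c + i * (Real.pi / 2))) := by
  induction i with
  | zero => ext t; simp
  | succ i ih =>
    rw [iteratedDeriv_succ, ih]
    ext t
    have h : HasDerivAt (fun t => a * b ^ i * Real.cos (b * t + (c + i * (Real.pi / 2))))
        (a * b ^ i * (-Real.sin (b * t + (c + i * (Real.pi / 2))) * (b * 1))) t :=
      ((((hasDerivAt_id t).const_mul b).add_const _).cos).const_mul _
    rw [h.deriv, show b * t + (c + ((i + 1 : ℕ) : ℝ) * (Real.pi / 2)) =
      b * t + (c + i * (Real.pi / 2)) + Real.pi / 2 by push_cast; ring, Real.cos_add_pi_div_two]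
    ring

lemma hasSum_integral_mul {α : Type*} [MeasurableSpace α] {μ : Measure α} {g : α → ℝ}
    (hg : Integrable g μ) {h : ℕ → α → ℝ} (hh : ∀ j, AEStronglyMeasurable (h j) μ) {b : ℕ → ℝ}
    (hb : Summable b) (hhb : ∀ j x, |h j x| ≤ b j) :
    HasSum (fun j => ∫ x, g x * h j x ∂μ) (∫ x, g x * ∑' j, h j x ∂μ) := by
  have hint : ∀ j, Integrable (fun x => g x * h j x) μ := fun j =>
    hg.mul_bdd (c := b j) (hh j) (Eventually.of_forall fun x => hhb j x)
  have h1 := hasSum_integral_of_summable_integral_norm hint (by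
    refine Summable.of_nonneg_of_le (fun j => integral_nonneg fun x => norm_nonneg _) (fun j => ?_)
      (hb.mul_left (∫ x, ‖g x‖ ∂μ))
    rw [← integral_mul_const]
    refine integral_mono (hint j).norm (hg.norm.mul_const _) fun x => ?_
    simp only [norm_mul]
    gcongr
    exact hhb j x)
  simpa [tsum_mul_left] using h1

/-- The terms of an `m`-fold antiderivative of the lacunary series. -/
noncomputable def lacunaryTerm (m j : ℕ) (t : ℝ) : ℝ :=
  (1 / 2) ^ j * ((16 ^ j) ^ m)⁻¹ * Real.cos (16 ^ j * t + -(m * (Real.pi / 2)))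

lemma contDiff_lacunaryTerm (m j : ℕ) : ContDiff ℝ (⊤ : ℕ∞) (lacunaryTerm m j) := by
  unfold lacunaryTerm; fun_prop

lemma abs_half_mul_cos_le (j : ℕ) (t : ℝ) : |(1 / 2) ^ j * Real.cos t| ≤ (1 / 2) ^ j := by
  rw [abs_mul, abs_of_pos (by positivity : (0:ℝ) < (1 / 2) ^ j)]
  exact mul_le_of_le_one_right (by positivity) (Real.abs_cos_le_one _)

lemma abs_lacunaryTerm_le (m j : ℕ) (t : ℝ) : |lacunaryTerm m j t| ≤ (1 / 2) ^ j := by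
  have h : lacunaryTerm m j t =
      ((16 ^ j) ^ m)⁻¹ * ((1 / 2) ^ j * Real.cos (16 ^ j * t + -(m * (Real.pi / 2)))) := by
    rw [lacunaryTerm]; ring
  rw [h, abs_mul, abs_of_pos (by positivity)]
  have h1 : (((16 : ℝ) ^ j) ^ m)⁻¹ ≤ 1 :=
    inv_le_one_of_one_le₀ (one_le_pow₀ (one_le_pow₀ (by norm_num)))
  exact (mul_le_of_le_one_left (abs_nonneg _) h1).trans (abs_half_mul_cos_le _ _)

lemma iteratedDeriv_lacunaryTerm (m j : ℕ) :
    iteratedDeriv m (lacunaryTerm m j) = fun t => (1 / 2) ^ j * Real.cos (16 ^ j * t) := by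
  unfold lacunaryTerm
  rw [iteratedDeriv_cos_affine]
  ext t
  rw [neg_add_cancel, add_zero]
  field_simp

lemma summable_half_pow : Summable fun j : ℕ => (1 / 2 : ℝ) ^ j :=
  summable_geometric_of_lt_one (by norm_num) (by norm_num)

variable {n : ℕ}

lemma hasSum_integral_dirDeriv_lacunary (m l : ℕ) (ξ : Euc n) {φ : Euc n → ℝ}
    (hφ : IsTestFun n φ) (I : Fin l → Fin n) :
    HasSum (fun j => (-1) ^ l * ∫ x, φ x * ((∏ i, ξ (I i)) * iteratedDeriv l (lacunaryTerm m j) ⟪ξ, x⟫))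
      (∫ x, dirDeriv n l I φ x * ∑' j, lacunaryTerm m j ⟪ξ, x⟫) := by
  have hφ' := hφ.dirDeriv I
  have hs : ∀ j, ContDiff ℝ (⊤ : ℕ∞) fun y : Euc n => lacunaryTerm m j ⟪ξ, y⟫ := fun j =>
    (contDiff_lacunaryTerm m j).comp (contDiff_const.inner ℝ contDiff_id)
  have h := hasSum_integral_mul (μ := volume) (hφ'.1.continuous.integrable_of_hasCompactSupport hφ'.2)
    (h := fun j x => lacunaryTerm m j ⟪ξ, x⟫) (fun j => (hs j).continuous.aestronglyMeasurable)
    summable_half_pow (fun j x => abs_lacunaryTerm_le _ _ _)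
  convert h using 1
  funext j
  have h1 := integral_mul_dirDeriv (hs j) hφ I
  simp only [mul_comm _ (dirDeriv n l I φ _)] at h1
  have h2 : ∀ x : Euc n, dirDeriv n l I (fun y => lacunaryTerm m j ⟪ξ, y⟫) x =
      (∏ i, ξ (I i)) * iteratedDeriv l (lacunaryTerm m j) ⟪ξ, x⟫ := fun x =>
    dirDeriv_comp_inner (contDiff_lacunaryTerm m j) ξ I x
  rw [h1]
  simp only [h2, mul_comm (φ _)]

lemma exists_L1_bound_of_memT {F : Type*} [NormedAddCommGroup F] [NormedSpace ℝ F] {p : ℝ}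
    (hn : 1 ≤ n) (hp : 1 < p) {f : Euc n → F} (hf : AEStronglyMeasurable f volume) {x : Euc n}
    (h : MemT n n p f x) : ∃ (P : Euc n → F) (K : ℝ), ContDiff ℝ (⊤ : ℕ∞) P ∧ 0 ≤ K ∧
      ∀ᶠ r in 𝓝[>] (0 : ℝ), ∫⁻ y in ball x r, ‖f y - P y‖ₑ ≤ ENNReal.ofReal (K * r ^ (n + 1)) := by
  obtain ⟨P, hP, h⟩ := h
  refine ⟨P, (volume (ball (0 : Euc n) 1)).toReal, hP.1, ENNReal.toReal_nonneg, ?_⟩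
  have h1 : ∀ᶠ q in 𝓝 (0 : ℝ≥0∞), q < 1 := Iio_mem_nhds one_pos
  filter_upwards [h.eventually h1, Ioo_mem_nhdsGT one_pos] with r hr hr0
  have hr1 := hr0.2.le
  have hr0 : 0 < r := hr0.1
  have hp0 : 0 < p := by linarith
  have hrn : ENNReal.ofReal (r ^ (n : ℝ)) ≠ 0 := by
    simpa using by positivity
  set B := volume (ball x r) with hB
  have hB0 : B ≠ 0 := (measure_ball_pos _ _ hr0).ne'
  have hBt : B ≠ ∞ := measure_ball_lt_top.ne
  set X := ∫⁻ y in ball x r, (‖f y - P y‖₊ : ℝ≥0∞) ^ p with hX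
  have h2 : (B⁻¹ * X) ^ (1 / p) ≤ ENNReal.ofReal (r ^ (n : ℝ)) := by
    have := (ENNReal.div_le_iff hrn ENNReal.ofReal_ne_top).1 hr.le
    simpa using this
  have hpq : p.HolderConjugate p.conjExponent := Real.HolderConjugate.conjExponent hp
  have h3 := ENNReal.lintegral_mul_le_Lp_mul_Lq (volume.restrict (ball x r)) hpq
    (f := fun y => ‖f y - P y‖ₑ) (g := fun _ => 1)
    ((hf.sub hP.1.continuous.aestronglyMeasurable).enorm.restrict) aemeasurable_const
  simp only [Pi.mul_apply, mul_one, ENNReal.one_rpow, lintegral_const, Measure.restrict_apply_univ,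
    one_mul] at h3
  have h4 : X ^ (1 / p) = B ^ (1 / p) * (B⁻¹ * X) ^ (1 / p) := by
    rw [← ENNReal.mul_rpow_of_nonneg _ _ (by positivity), ← mul_assoc, ENNReal.mul_inv_cancel hB0 hBt,
      one_mul]
  calc ∫⁻ y in ball x r, ‖f y - P y‖ₑ ≤ X ^ (1 / p) * B ^ (1 / p.conjExponent) := h3
    _ = B ^ (1 / p + 1 / p.conjExponent) * (B⁻¹ * X) ^ (1 / p) := by
        rw [h4, ENNReal.rpow_add _ _ hB0 hBt]; ring
    _ ≤ B * ENNReal.ofReal (r ^ (n : ℝ)) := by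
        have : 1 / p + 1 / p.conjExponent = 1 := by
          have := hpq.inv_add_inv_eq_one; simpa using this
        rw [this, ENNReal.rpow_one]; gcongr
    _ ≤ B * ENNReal.ofReal r := by
        gcongr
        rw [Real.rpow_natCast]
        exact pow_le_of_le_one hr0.le hr1 (by omega)
    _ = _ := by
        rw [hB, volume_ball_euc x hr0]
        nth_rewrite 1 [← ENNReal.ofReal_toReal (volume_unit_ball_lt_top (n := n)).ne]
        rw [← ENNReal.ofReal_mul (by positivity), ← ENNReal.ofReal_mul (by positivity)]
        congr 1; ring

theorem isElliptic_of_forall_memT (n k : ℕ) (p : ℝ) {V W : Type*}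
    [NormedAddCommGroup V] [InnerProductSpace ℝ V] [FiniteDimensional ℝ V]
    [NormedAddCommGroup W] [InnerProductSpace ℝ W] [FiniteDimensional ℝ W]
    (A : CoeffOp n k V W) (hn : 1 ≤ n) (hp1 : 1 < p)
    (H : ∀ u : Euc n → V, MemBVAloc n k A u →
        ∃ v : (Fin (k - n) → Fin n) → Euc n → V, IsWeakDerivFamily n (k - n) u v ∧
          ∀ᵐ x ∂(volume : Measure (Euc n)), ∀ I, MemT n n p (v I) x) :
    IsElliptic n k A := by
  intro ξ hξ
  refine (injective_iff_map_eq_zero _).2 fun v hv => ?_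
  by_contra hv0
  set m := k - n with hm
  set U : Euc n → ℝ := fun x => ∑' j, lacunaryTerm m j ⟪ξ, x⟫ with hU
  have hUc : Continuous U := continuous_tsum
    (fun j => ((contDiff_lacunaryTerm m j).continuous).comp (by fun_prop)) summable_half_pow
    (fun j x => abs_lacunaryTerm_le _ _ _)
  have hu : MemBVAloc n k A (fun x => U x • v) := by
    refine ⟨(hUc.smul continuous_const).locallyIntegrable, 0, 0, inferInstance,
      locallyIntegrable_zero, by simp, fun φ hφ => ?_⟩
    have hφI : ∀ I, IsTestFun n (fun y => ⟪A I v, φ y⟫) := fun I =>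
      ⟨contDiff_const.inner ℝ hφ.1, hφ.2.comp_left (g := fun w => ⟪A I v, w⟫) (by simp)⟩
    have h1 : ∀ I, ∫ x, ⟪U x • v, LinearMap.adjoint (A I) (dirDeriv n k I φ x)⟫ =
        ∫ x, dirDeriv n k I (fun y => ⟪A I v, φ y⟫) x * U x := by
      intro I
      congr 1; ext x
      have h2 := dirDeriv_clm_comp (innerSL ℝ (A I v)) hφ.1 I x
      simp only [innerSL_apply_apply] at h2
      rw [h2, inner_smul_left, LinearMap.adjoint_inner_right]
      simp [mul_comm]
    simp only [h1]
    have h3 := hasSum_sum (s := Finset.univ) fun I _ =>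
      hasSum_integral_dirDeriv_lacunary m k ξ (hφI I) I
    have h4 : ∀ j, ∑ I : Fin k → Fin n, (-1) ^ k * ∫ x, ⟪A I v, φ x⟫ *
        ((∏ i, ξ (I i)) * iteratedDeriv k (lacunaryTerm m j) ⟪ξ, x⟫) = 0 := by
      intro j
      rw [← Finset.mul_sum, ← integral_finsetSum]
      · have : ∀ x, ∑ I : Fin k → Fin n, ⟪A I v, φ x⟫ *
            ((∏ i, ξ (I i)) * iteratedDeriv k (lacunaryTerm m j) ⟪ξ, x⟫) = 0 := by
          intro x
          have h5 : ⟪symbolMap n k A ξ v, φ x⟫ = 0 := by rw [hv, inner_zero_left]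
          rw [symbolMap, LinearMap.sum_apply, sum_inner] at h5
          simp only [LinearMap.smul_apply, inner_smul_left] at h5
          calc _ = (∑ I : Fin k → Fin n, (∏ i, ξ (I i)) * ⟪A I v, φ x⟫) *
                iteratedDeriv k (lacunaryTerm m j) ⟪ξ, x⟫ := by
                rw [Finset.sum_mul]; congr 1; ext I; ring
            _ = 0 := by
              simp only [conj_trivial] at h5
              rw [h5, zero_mul]
        simp [this]
      · intro I _
        have hc : Continuous (iteratedDeriv k (lacunaryTerm m j)) :=
          (contDiff_lacunaryTerm m j).continuous_iteratedDeriv k (by exact_mod_cast le_top)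
        refine Continuous.integrable_of_hasCompactSupport ?_ (hφI I).2.mul_right
        exact (hφI I).1.continuous.mul (continuous_const.mul (hc.comp (by fun_prop)))
    simp only [h4] at h3
    have h0 := h3.unique hasSum_zero
    simp [hU, h0]
  obtain ⟨w, ⟨hwi, hw⟩, hT⟩ := H _ hu
  obtain ⟨i0, hi0⟩ : ∃ i, ξ i ≠ 0 := by
    by_contra hcon
    push Not at hcon
    exact hξ (by ext i; simpa using hcon i)
  set I0 : Fin m → Fin n := fun _ => i0 with hI0
  set c : ℝ := ∏ i, ξ (I0 i) with hc
  have hc0 : c ≠ 0 := Finset.prod_ne_zero_iff.2 fun _ _ => hi0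
  have hlc : Continuous fun x : Euc n => lacunary ⟪ξ, x⟫ := continuous_lacunary.comp (by fun_prop)
  have hwc : ∀ᵐ x ∂volume, w I0 x = (c * lacunary ⟪ξ, x⟫) • v := by
    refine ae_eq_of_integral_contDiff_smul_eq (hwi I0)
      (((continuous_const.mul hlc).smul continuous_const).locallyIntegrable) fun φ hφ hφc => ?_
    have h1 := hw I0 φ ⟨hφ, hφc⟩
    have h2 : ∫ x, dirDeriv n m I0 φ x • U x • v = (∫ x, dirDeriv n m I0 φ x * U x) • v := by
      rw [← integral_smul_const]; congr 1; ext x; rw [smul_smul]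
    have h3 := hasSum_integral_dirDeriv_lacunary m m ξ ⟨hφ, hφc⟩ I0
    simp only [iteratedDeriv_lacunaryTerm] at h3
    have h4 := (hasSum_integral_mul (μ := volume) (hφ.continuous.integrable_of_hasCompactSupport hφc)
      (h := fun j x => (1 / 2) ^ j * Real.cos (16 ^ j * ⟪ξ, x⟫))
      (fun j => (Continuous.aestronglyMeasurable (by fun_prop)))
      summable_half_pow (fun j x => abs_half_mul_cos_le _ _)).mul_left ((-1) ^ m * c)
    have h5 : ∫ x, dirDeriv n m I0 φ x * U x = (-1) ^ m * c * ∫ x, φ x * lacunary ⟪ξ, x⟫ := by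
      refine HasSum.unique h3 ?_
      have h5 : (fun j : ℕ => (-1) ^ m * ∫ x : Euc n, φ x * ((∏ x, ξ.ofLp (I0 x)) *
          ((1 / 2) ^ j * Real.cos (16 ^ j * ⟪ξ, x⟫)))) = fun j => (-1) ^ m * c *
          ∫ x : Euc n, φ x * ((1 / 2) ^ j * Real.cos (16 ^ j * ⟪ξ, x⟫)) := by
        funext j
        rw [mul_assoc, ← integral_const_mul c]
        congr 2; ext x; ring
      rw [h5]
      exact h4
    rw [h2, h5] at h1
    have h6 : ∫ x, φ x • (c * lacunary ⟪ξ, x⟫) • v = (c * ∫ x, φ x * lacunary ⟪ξ, x⟫) • v := by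
      rw [← integral_const_mul, ← integral_smul_const]
      congr 1; ext x; rw [smul_smul]; congr 1; ring
    rw [h6]
    have h7 := congrArg (fun z => (-1 : ℝ) ^ m • z) h1
    simp only [smul_smul, ← mul_assoc, ← mul_pow] at h7
    simpa using h7.symm
  obtain ⟨x, hx⟩ := hT.exists
  obtain ⟨P, K, hP, hK, hb⟩ := exists_L1_bound_of_memT hn hp1 (hwi I0).aestronglyMeasurable (hx I0)
  have hvn : 0 < ‖v‖ := norm_pos_iff.2 hv0
  refine not_approx_lacunary hξ (c := c * ‖v‖ ^ 2) (by positivity) (P := fun y => ⟪v, P y⟫)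
    (contDiff_const.inner ℝ hP) x (‖v‖ * K) ?_
  filter_upwards [hb] with r hr
  calc ∫⁻ y in ball x r, ‖c * ‖v‖ ^ 2 * lacunary ⟪ξ, y⟫ - ⟪v, P y⟫‖ₑ
      ≤ ∫⁻ y in ball x r, ENNReal.ofReal ‖v‖ * ‖w I0 y - P y‖ₑ := by
        refine lintegral_mono_ae (ae_restrict_of_ae ?_)
        filter_upwards [hwc] with y hy
        have : c * ‖v‖ ^ 2 * lacunary ⟪ξ, y⟫ - ⟪v, P y⟫ = ⟪v, w I0 y - P y⟫ := by
          rw [inner_sub_right, hy, inner_smul_right, real_inner_self_eq_norm_sq]; ring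
        rw [this, ← ofReal_norm, ← ofReal_norm, ← ENNReal.ofReal_mul (norm_nonneg _)]
        exact ENNReal.ofReal_le_ofReal (norm_inner_le_norm _ _)
    _ = ENNReal.ofReal ‖v‖ * ∫⁻ y in ball x r, ‖w I0 y - P y‖ₑ :=
        lintegral_const_mul' _ _ ENNReal.ofReal_ne_top
    _ ≤ ENNReal.ofReal ‖v‖ * ENNReal.ofReal (K * r ^ (n + 1)) := by gcongr
    _ = _ := by rw [← ENNReal.ofReal_mul (norm_nonneg _), mul_assoc]

end Converse

section Decay

variable {n : ℕ} {F : Type*} [NormedAddCommGroup F] [NormedSpace ℝ F]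

lemma SchwartzMap.exists_iteratedFDeriv_decay (l : 𝓢(Euc n, F)) (N m : ℕ) :
    ∃ C, 0 < C ∧ ∀ x, ‖iteratedFDeriv ℝ m l x‖ ≤ C * ((1 + ‖x‖) ^ N)⁻¹ := by
  set C := 2 ^ N * ((Finset.Iic (N, m)).sup fun m => SchwartzMap.seminorm ℝ m.1 m.2) l
  refine ⟨max C 1, by positivity, fun x => ?_⟩
  have h := SchwartzMap.one_add_le_sup_seminorm_apply (𝕜 := ℝ) (m := (N, m)) (k := N) (n := m)
    le_rfl le_rfl l x
  rw [← div_eq_mul_inv, le_div_iff₀ (by positivity), mul_comm]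
  exact h.trans (le_max_left _ _)

lemma SchwartzMap.exists_decay (l : 𝓢(Euc n, F)) (N : ℕ) :
    ∃ C, 0 < C ∧ ∀ x, ‖l x‖ ≤ C * ((1 + ‖x‖) ^ N)⁻¹ := by
  simpa using l.exists_iteratedFDeriv_decay N 0

lemma inv_one_add_norm_pow_le (N : ℕ) {E : Type*} [SeminormedAddCommGroup E] {a b : E} (h : ‖a - b‖ ≤ 1) :
    ((1 + ‖b‖) ^ N)⁻¹ ≤ 2 ^ N * ((1 + ‖a‖) ^ N)⁻¹ := by
  have h1 : 1 + ‖a‖ ≤ 2 * (1 + ‖b‖) := by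
    have := norm_le_insert' a b
    nlinarith [norm_nonneg b]
  rw [← div_eq_mul_inv, le_div_iff₀ (by positivity), ← div_eq_inv_mul, div_le_iff₀ (by positivity),
    ← mul_pow]
  gcongr

lemma SchwartzMap.exists_taylor_bound [CompleteSpace F] (l : 𝓢(Euc n, F)) (N j : ℕ) :
    ∃ C, 0 < C ∧ ∀ a b, ‖b‖ ≤ 1 →
      ‖l (a + b) - ∑ m ∈ Finset.range (j + 1),
        (m.factorial : ℝ)⁻¹ • iteratedFDeriv ℝ m l a (fun _ => b)‖ ≤
      C * ‖b‖ ^ (j + 1) * ((1 + ‖a‖) ^ N)⁻¹ := by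
  obtain ⟨C, hC, h⟩ := l.exists_iteratedFDeriv_decay N (j + 1)
  refine ⟨C * 2 ^ N, by positivity, fun a b hb => ?_⟩
  refine (norm_taylor_remainder_le (l.smooth ⊤) a b (C := C * (2 ^ N * ((1 + ‖a‖) ^ N)⁻¹))
    fun t ht => (h _).trans ?_).trans (le_of_eq (by ring))
  gcongr
  refine inv_one_add_norm_pow_le N ?_
  rw [sub_add_cancel_left, norm_neg, norm_smul, Real.norm_of_nonneg ht.1]
  exact mul_le_one₀ ht.2 (norm_nonneg _) hb

/-- `τ` has bounded upper density at `x` at all scales, and vanishing density at `x`. -/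
def VanishingDensity (n : ℕ) (τ : Measure (Euc n)) (x : Euc n) : Prop :=
  (∃ M : ℝ, ∀ r : ℝ, 0 < r → τ (ball x r) ≤ ENNReal.ofReal (M * r ^ n)) ∧
    ∀ ε : ℝ, 0 < ε → ∀ᶠ r in 𝓝[>] (0 : ℝ), τ (ball x r) ≤ ENNReal.ofReal (ε * r ^ n)

lemma inv_one_add_pow_le_tsum_indicator (N : ℕ) {s : ℝ} (hs : 0 < s) (x z : Euc n) :
    ENNReal.ofReal ((1 + s * ‖x - z‖) ^ N)⁻¹ ≤
      ∑' i : ℕ, (ball x (2 ^ (i + 1) / s)).indicator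
        (fun _ => ENNReal.ofReal ((2 ^ i) ^ N)⁻¹) z := by
  set t := s * ‖x - z‖ with ht
  have ht0 : 0 ≤ t := by positivity
  obtain ⟨i, hi1, hi2⟩ : ∃ i : ℕ, (2 : ℝ) ^ i ≤ 1 + t ∧ t < 2 ^ (i + 1) := by
    obtain ⟨i, h1, h2⟩ := exists_nat_pow_near (le_add_of_nonneg_right ht0 : 1 ≤ 1 + t)
      (one_lt_two)
    exact ⟨i, h1, by linarith⟩
  refine le_trans ?_ (ENNReal.le_tsum i)
  rw [Set.indicator_of_mem]
  · exact ENNReal.ofReal_le_ofReal (inv_anti₀ (by positivity) (by gcongr))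
  · rw [mem_ball', lt_div_iff₀ hs, dist_eq_norm, mul_comm]; exact hi2

lemma VanishingDensity.exists_seq {τ : Measure (Euc n)} {x : Euc n} (h : VanishingDensity n τ x) :
    ∃ a : ℕ → ℝ, (∀ j, 0 ≤ a j) ∧ Tendsto a atTop (𝓝 0) ∧ ∀ j,
      ∫⁻ z, ENNReal.ofReal ((1 + 2 ^ j * ‖x - z‖) ^ (n + 1))⁻¹ ∂τ ≤
        ENNReal.ofReal (((2 ^ j) ^ n)⁻¹ * a j) := by
  obtain ⟨⟨M, hM⟩, h0⟩ := h
  set D : ℝ → ℝ := fun r => (τ (ball x r)).toReal / r ^ n with hD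
  have hfin : ∀ r, 0 < r → τ (ball x r) ≠ ∞ := fun r hr => (hM r hr).trans_lt ENNReal.ofReal_lt_top |>.ne
  have hDn : ∀ r, 0 < r → 0 ≤ D r := fun r hr => by positivity
  have hDM : ∀ r, 0 < r → D r ≤ max M 0 := fun r hr => by
    rw [hD, div_le_iff₀ (by positivity)]
    refine ENNReal.toReal_le_of_le_ofReal (by positivity) ((hM r hr).trans ?_)
    gcongr; exact le_max_left _ _
  have hD0 : Tendsto D (𝓝[>] 0) (𝓝 0) := by
    rw [Metric.tendsto_nhds]
    intro ε hε
    filter_upwards [h0 (ε / 2) (by positivity), self_mem_nhdsWithin] with r hr hr0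
    have hr0 : 0 < r := hr0
    rw [Real.dist_eq, sub_zero, abs_of_nonneg (hDn r hr0)]
    refine lt_of_le_of_lt ?_ (half_lt_self hε)
    rw [hD, div_le_iff₀ (by positivity)]
    exact ENNReal.toReal_le_of_le_ofReal (by positivity) hr
  have hτD : ∀ r, 0 < r → τ (ball x r) = ENNReal.ofReal (r ^ n * D r) := fun r hr => by
    rw [hD, mul_div_cancel₀ _ (by positivity), ENNReal.ofReal_toReal (hfin r hr)]
  have hpos : ∀ i j : ℕ, (0 : ℝ) < 2 ^ (i + 1) / 2 ^ j := fun i j => by positivity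
  have hb : Summable fun i : ℕ => 2 ^ n * (1 / 2 : ℝ) ^ i * max M 0 :=
    (summable_half_pow.mul_left _).mul_right _
  have hle : ∀ i j : ℕ, 2 ^ n * (1 / 2 : ℝ) ^ i * D (2 ^ (i + 1) / 2 ^ j) ≤
      2 ^ n * (1 / 2 : ℝ) ^ i * max M 0 := fun i j => by
    gcongr; exact hDM _ (hpos i j)
  have hnn : ∀ i j : ℕ, 0 ≤ 2 ^ n * (1 / 2 : ℝ) ^ i * D (2 ^ (i + 1) / 2 ^ j) := fun i j =>
    mul_nonneg (by positivity) (hDn _ (hpos i j))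
  refine ⟨fun j => ∑' i : ℕ, 2 ^ n * (1 / 2 : ℝ) ^ i * D (2 ^ (i + 1) / 2 ^ j),
    fun j => tsum_nonneg fun i => hnn i j, ?_, fun j => ?_⟩
  · have := tendsto_tsum_of_dominated_convergence (𝓕 := atTop) (G := ℝ)
      (f := fun j i : ℕ => 2 ^ n * (1 / 2 : ℝ) ^ i * D (2 ^ (i + 1) / 2 ^ j)) (g := fun _ => 0) hb
      (fun i => by
        have h1 : Tendsto (fun j : ℕ => (2 : ℝ) ^ (i + 1) / 2 ^ j) atTop (𝓝[>] 0) := by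
          refine tendsto_nhdsWithin_iff.2 ⟨?_, Eventually.of_forall fun j => hpos i j⟩
          exact tendsto_const_nhds.div_atTop (tendsto_pow_atTop_atTop_of_one_lt one_lt_two)
        simpa using (hD0.comp h1).const_mul (2 ^ n * (1 / 2 : ℝ) ^ i))
      (Eventually.of_forall fun j i => by
        rw [Real.norm_of_nonneg (hnn i j)]; exact hle i j)
    simpa using this
  · calc ∫⁻ z, ENNReal.ofReal ((1 + 2 ^ j * ‖x - z‖) ^ (n + 1))⁻¹ ∂τ
        ≤ ∫⁻ z, ∑' i : ℕ, (ball x (2 ^ (i + 1) / 2 ^ j)).indicator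
          (fun _ => ENNReal.ofReal ((2 ^ i) ^ (n + 1))⁻¹) z ∂τ :=
          lintegral_mono fun z => inv_one_add_pow_le_tsum_indicator _ (by positivity) x z
      _ = ∑' i : ℕ, ENNReal.ofReal ((2 ^ i) ^ (n + 1))⁻¹ * τ (ball x (2 ^ (i + 1) / 2 ^ j)) := by
          rw [lintegral_tsum fun i => (measurable_const.indicator measurableSet_ball).aemeasurable]
          congr 1; ext i
          rw [lintegral_indicator_const measurableSet_ball]
      _ = ∑' i : ℕ, ENNReal.ofReal (((2 ^ j) ^ n)⁻¹ *
            (2 ^ n * (1 / 2 : ℝ) ^ i * D (2 ^ (i + 1) / 2 ^ j))) := by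
          congr 1; ext i
          rw [hτD _ (hpos i j), ← ENNReal.ofReal_mul (by positivity)]
          congr 1
          have : ((1 : ℝ) / 2) ^ i = (2 ^ i)⁻¹ := by rw [one_div, inv_pow]
          generalize D (2 ^ (i + 1) / 2 ^ j) = d
          rw [this, div_pow, pow_succ, pow_succ (2 : ℝ) i, mul_pow]
          field_simp
      _ = _ := by
          rw [← tsum_mul_left, ENNReal.ofReal_tsum_of_nonneg]
          · exact fun i => mul_nonneg (by positivity) (hnn i j)
          · exact (Summable.of_nonneg_of_le (fun i => hnn i j) (fun i => hle i j) hb).mul_left _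

end Decay

section LebesguePoints

variable {n : ℕ}

lemma volume_closedBall_euc (x : Euc n) {r : ℝ} (hr : 0 ≤ r) :
    volume (closedBall x r) = ENNReal.ofReal (r ^ n) * volume (ball (0 : Euc n) 1) := by
  rw [Measure.addHaar_closedBall _ _ hr]; simp

lemma vanishingDensity_of_tendsto {τ : Measure (Euc n)} {x : Euc n} {A : ℝ} (hA : 0 ≤ A)
    (h : ∀ r : ℝ, 0 < r → τ (ball x r) ≤ ENNReal.ofReal (A + A * r ^ n))
    (h0 : Tendsto (fun r => τ (closedBall x r) / volume (closedBall x r)) (𝓝[>] 0) (𝓝 0)) :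
    VanishingDensity n τ x := by
  have h1 : ∀ ε : ℝ, 0 < ε → ∀ᶠ r in 𝓝[>] (0 : ℝ), τ (ball x r) ≤ ENNReal.ofReal (ε * r ^ n) := by
    intro ε hε
    set c := (volume (ball (0 : Euc n) 1)).toReal with hc
    have hc0 : 0 < c := ENNReal.toReal_pos volume_unit_ball_pos.ne' volume_unit_ball_lt_top.ne
    have h2 : ∀ᶠ q in 𝓝 (0 : ℝ≥0∞), q < ENNReal.ofReal (ε / c) :=
      Iio_mem_nhds (by rw [ENNReal.ofReal_pos]; positivity)
    filter_upwards [h0.eventually h2, self_mem_nhdsWithin] with r hr hr0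
    have hr0 : 0 < r := hr0
    rw [ENNReal.div_lt_iff (Or.inl (measure_closedBall_pos _ _ hr0).ne')
      (Or.inl measure_closedBall_lt_top.ne), volume_closedBall_euc x hr0.le] at hr
    refine (measure_mono ball_subset_closedBall).trans (hr.le.trans (le_of_eq ?_))
    rw [← ENNReal.ofReal_toReal volume_unit_ball_lt_top.ne, ← hc,
      ← ENNReal.ofReal_mul (by positivity), ← ENNReal.ofReal_mul (by positivity)]
    congr 1; field_simp
  refine ⟨?_, h1⟩
  obtain ⟨δ, hδ, hd⟩ := (mem_nhdsGT_iff_exists_Ioo_subset (a := (0:ℝ))).1 (h1 1 one_pos)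
  have hδ : 0 < δ := hδ
  refine ⟨1 + A / δ ^ n + A, fun r hr => ?_⟩
  rcases lt_or_ge r δ with hrd | hrd
  · refine (hd ⟨hr, hrd⟩ : τ (ball x r) ≤ _).trans (ENNReal.ofReal_le_ofReal ?_)
    have : 0 ≤ A / δ ^ n := by positivity
    gcongr; linarith
  · refine (h r hr).trans (ENNReal.ofReal_le_ofReal ?_)
    have : A ≤ A / δ ^ n * r ^ n := by
      rw [div_mul_eq_mul_div, le_div_iff₀ (by positivity)]
      gcongr
    nlinarith [pow_pos hr n]

lemma VanishingDensity.add {τ τ' : Measure (Euc n)} {x : Euc n} (h : VanishingDensity n τ x)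
    (h' : VanishingDensity n τ' x) : VanishingDensity n (τ + τ') x := by
  obtain ⟨⟨M, hM⟩, h⟩ := h
  obtain ⟨⟨M', hM'⟩, h'⟩ := h'
  refine ⟨⟨max M 0 + max M' 0, fun r hr => ?_⟩, fun ε hε => ?_⟩
  · rw [Measure.add_apply, add_mul, ENNReal.ofReal_add (by positivity) (by positivity)]
    gcongr
    · exact (hM r hr).trans (by gcongr; exact le_max_left _ _)
    · exact (hM' r hr).trans (by gcongr; exact le_max_left _ _)
  · filter_upwards [h (ε / 2) (by positivity), h' (ε / 2) (by positivity), self_mem_nhdsWithin]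
      with r hr hr' hr0
    have hr0 : 0 < r := hr0
    rw [Measure.add_apply]
    refine (add_le_add hr hr').trans (le_of_eq ?_)
    rw [← ENNReal.ofReal_add (by positivity) (by positivity)]
    congr 1; ring

lemma ae_vanishingDensity_sub {E : Type*} [NormedAddCommGroup E] {H : Euc n → E}
    (hH : LocallyIntegrable H volume) {A : ℝ} (hA : 0 ≤ A)
    (hb : ∀ x r, 0 < r → ∫⁻ z in ball x r, ‖H z‖ₑ ≤ ENNReal.ofReal (A + A * r ^ n)) :
    ∀ᵐ x ∂(volume : Measure (Euc n)),
      VanishingDensity n (volume.withDensity fun z => ‖H z - H x‖ₑ) x := by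
  filter_upwards [(Besicovitch.vitaliFamily (volume : Measure (Euc n))).ae_tendsto_lintegral_enorm_sub_div hH]
    with x hx
  set c := (volume (ball (0 : Euc n) 1)).toReal with hc
  refine vanishingDensity_of_tendsto (A := A + ‖H x‖ * c) (by positivity) (fun r hr => ?_) ?_
  · rw [withDensity_apply _ measurableSet_ball]
    calc ∫⁻ z in ball x r, ‖H z - H x‖ₑ ≤ ∫⁻ z in ball x r, (‖H z‖ₑ + ‖H x‖ₑ) :=
          lintegral_mono fun z => enorm_sub_le
      _ = (∫⁻ z in ball x r, ‖H z‖ₑ) + ‖H x‖ₑ * volume (ball x r) := by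
          rw [lintegral_add_right _ measurable_const]; simp
      _ ≤ ENNReal.ofReal (A + A * r ^ n) + ENNReal.ofReal (‖H x‖ * (r ^ n * c)) := by
          gcongr
          · exact hb x r hr
          · rw [volume_ball_euc x hr, ← ofReal_norm, ENNReal.ofReal_mul (norm_nonneg _),
              ENNReal.ofReal_mul (by positivity), hc, ENNReal.ofReal_toReal volume_unit_ball_lt_top.ne]
      _ ≤ _ := by
          rw [← ENNReal.ofReal_add (by positivity) (by positivity)]
          refine ENNReal.ofReal_le_ofReal ?_
          have : 0 ≤ ‖H x‖ * c := by positivity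
          nlinarith
  · have := hx.comp (Besicovitch.tendsto_filterAt volume x)
    refine this.congr fun r => ?_
    simp only [Function.comp]
    rw [withDensity_apply _ measurableSet_closedBall]

lemma ae_vanishingDensity_of_mutuallySingular {τ : Measure (Euc n)} [IsFiniteMeasure τ]
    (h : τ ⟂ₘ volume) : ∀ᵐ x ∂(volume : Measure (Euc n)), VanishingDensity n τ x := by
  filter_upwards [(Besicovitch.vitaliFamily (volume : Measure (Euc n))).ae_eventually_measure_zero_of_singular h]
    with x hx
  refine vanishingDensity_of_tendsto (A := (τ Set.univ).toReal) ENNReal.toReal_nonneg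
    (fun r hr => ?_) (hx.comp (Besicovitch.tendsto_filterAt volume x))
  refine (measure_mono (Set.subset_univ _)).trans ?_
  rw [← ENNReal.ofReal_toReal (measure_ne_top τ Set.univ)]
  refine ENNReal.ofReal_le_ofReal ?_
  rw [ENNReal.ofReal_toReal (measure_ne_top τ Set.univ)]
  have : 0 ≤ (τ Set.univ).toReal * r ^ n := by positivity
  linarith

/-- A generalized Lebesgue point of the signed measure `f σ`. -/
def LebPoint (n : ℕ) (σ : Measure (Euc n)) (f : Euc n → ℝ) (x : Euc n) : Prop :=
  ∃ τ : Measure (Euc n), SFinite τ ∧ VanishingDensity n τ x ∧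
    ∀ (G : Type) [NormedAddCommGroup G] [NormedSpace ℝ G] (φ : Euc n → G), Continuous φ →
      (∃ C, ∀ z, ‖φ z‖ ≤ C) → Integrable φ volume → ∫ z, φ z = 0 →
      ‖∫ z, f z • φ z ∂σ‖ₑ ≤ ∫⁻ z, ‖φ z‖ₑ ∂τ

theorem ae_lebPoint {σ : Measure (Euc n)} [IsFiniteMeasure σ] {f : Euc n → ℝ} (hf : Measurable f)
    (hf1 : ∀ z, |f z| ≤ 1) : ∀ᵐ x ∂(volume : Measure (Euc n)), LebPoint n σ f x := by
  set ρ : Euc n → ℝ≥0∞ := σ.rnDeriv volume with hρ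
  have hρm : Measurable ρ := Measure.measurable_rnDeriv _ _
  set g : Euc n → ℝ := fun z => (ρ z).toReal * f z with hg
  have hρi : Integrable (fun z => (ρ z).toReal) volume := Measure.integrable_toReal_rnDeriv
  have hgi : Integrable g volume :=
    hρi.mul_bdd (c := 1) hf.aestronglyMeasurable (Eventually.of_forall hf1)
  have hρt : ∀ᵐ z ∂(volume : Measure (Euc n)), ρ z < ∞ := Measure.rnDeriv_lt_top _ _
  have hA := ae_vanishingDensity_sub hgi.locallyIntegrable (A := (∫⁻ z, ‖g z‖ₑ).toReal)
    ENNReal.toReal_nonneg (fun x r hr => by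
      refine (setLIntegral_le_lintegral _ _).trans ?_
      rw [← ENNReal.ofReal_toReal hgi.hasFiniteIntegral.ne]
      refine ENNReal.ofReal_le_ofReal ?_
      rw [ENNReal.ofReal_toReal hgi.hasFiniteIntegral.ne]
      have : 0 ≤ (∫⁻ z, ‖g z‖ₑ).toReal * r ^ n := by positivity
      linarith)
  filter_upwards [hA, ae_vanishingDensity_of_mutuallySingular (Measure.mutuallySingular_singularPart σ volume)]
    with x hx hx'
  refine ⟨σ.singularPart volume + volume.withDensity fun z => ‖g z - g x‖ₑ, ?_, hx'.add hx, ?_⟩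
  · infer_instance
  intro G _ _ φ hφ ⟨C, hC⟩ hφi hφ0
  have hdec : σ = σ.singularPart volume + volume.withDensity ρ :=
    Measure.haveLebesgueDecomposition_add _ _
  have hint : ∀ (μ : Measure (Euc n)) [IsFiniteMeasure μ], Integrable (fun z => f z • φ z) μ := by
    intro μ _
    have hm : AEStronglyMeasurable (fun z => f z • φ z) μ :=
      hf.aestronglyMeasurable.smul hφ.aestronglyMeasurable
    refine Integrable.of_bound hm C (Eventually.of_forall fun z => ?_)
    rw [norm_smul]
    exact (mul_le_of_le_one_left (norm_nonneg _) (hf1 z)).trans (hC z)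
  have : IsFiniteMeasure (volume.withDensity ρ) := by
    refine ⟨lt_of_le_of_lt ?_ (measure_lt_top σ Set.univ)⟩
    exact Measure.withDensity_rnDeriv_le _ _ _
  have h1 : ∫ z, f z • φ z ∂(volume.withDensity ρ) = ∫ z, (g z - g x) • φ z := by
    rw [integral_withDensity_eq_integral_toReal_smul hρm hρt]
    have : ∀ z, (g z - g x) • φ z = (ρ z).toReal • f z • φ z - g x • φ z := fun z => by
      rw [sub_smul, hg, smul_smul]
    simp only [this]
    have h2 : Integrable (fun z => (ρ z).toReal • f z • φ z) volume := by
      simp only [smul_smul]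
      exact hgi.smul_bdd C hφ.aestronglyMeasurable (Eventually.of_forall hC)
    rw [integral_sub (g := fun z => g x • φ z) h2 (hφi.smul (g x)), integral_smul, hφ0, smul_zero, sub_zero]
  conv_lhs => rw [hdec]
  rw [integral_add_measure (hint _) (hint _), h1, lintegral_add_measure]
  refine (enorm_add_le _ _).trans (add_le_add ?_ ?_)
  · refine (enorm_integral_le_lintegral_enorm _).trans (lintegral_mono fun z => ?_)
    rw [enorm_smul]
    refine mul_le_of_le_one_left' ?_
    rw [← ofReal_norm]
    exact ENNReal.ofReal_le_one.2 (hf1 z)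
  · refine (enorm_integral_le_lintegral_enorm _).trans (le_of_eq ?_)
    rw [lintegral_withDensity_eq_lintegral_mul₀ (by fun_prop) (by fun_prop)]
    simp [enorm_smul]

end LebesguePoints

section TailLp

lemma lintegral_rpow_le_weighted {α : Type*} [MeasurableSpace α] {μ : Measure α} {p : ℝ} (hp : 1 < p)
    {F w : α → ℝ≥0∞} (hF : AEMeasurable F μ) (hw : AEMeasurable w μ) (hw0 : ∀ z, w z ≠ 0)
    (hwt : ∀ z, w z ≠ ∞) :
    (∫⁻ z, F z ∂μ) ^ p ≤ (∫⁻ z, w z ∂μ) ^ (p - 1) * ∫⁻ z, F z ^ p * w z ^ (1 - p) ∂μ := by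
  have hp0 : 0 < p := by linarith
  have hpq : p.HolderConjugate p.conjExponent := Real.HolderConjugate.conjExponent hp
  set q := p.conjExponent with hq
  have hq0 : 0 < q := hpq.symm.pos
  have hpq' : p / q = p - 1 := by
    rw [hq, Real.conjExponent]; field_simp
  have h := ENNReal.lintegral_mul_le_Lp_mul_Lq μ hpq (f := fun z => F z * w z ^ (-(1 / q)))
    (g := fun z => w z ^ (1 / q)) (hF.mul (hw.pow_const _)) (hw.pow_const _)
  have h1 : ∀ z, ((fun z => F z * w z ^ (-(1 / q))) * fun z => w z ^ (1 / q)) z = F z := fun z => by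
    simp only [Pi.mul_apply]
    rw [mul_assoc, ← ENNReal.rpow_add _ _ (hw0 z) (hwt z), neg_add_cancel, ENNReal.rpow_zero, mul_one]
  have h2 : ∀ z, (F z * w z ^ (-(1 / q))) ^ p = F z ^ p * w z ^ (1 - p) := fun z => by
    rw [ENNReal.mul_rpow_of_nonneg _ _ hp0.le, ← ENNReal.rpow_mul]
    congr 2
    have : p / q = 1 / q * p := by ring
    linarith
  have h3 : ∀ z, (w z ^ (1 / q)) ^ q = w z := fun z => by
    rw [← ENNReal.rpow_mul, one_div_mul_cancel hq0.ne', ENNReal.rpow_one]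
  simp only [h1, h2, h3] at h
  refine (ENNReal.rpow_le_rpow h hp0.le).trans (le_of_eq ?_)
  rw [ENNReal.mul_rpow_of_nonneg _ _ hp0.le, ← ENNReal.rpow_mul, ← ENNReal.rpow_mul,
    one_div_mul_cancel hp0.ne', ENNReal.rpow_one, mul_comm, ← hpq']
  congr 2; ring

variable {n : ℕ}

lemma lintegral_one_add_norm_lt_top (n : ℕ) :
    ∫⁻ y : Euc n, ENNReal.ofReal ((1 + ‖y‖) ^ (n + 1))⁻¹ < ∞ := by
  have := finite_integral_one_add_norm (E := Euc n) (μ := volume) (r := n + 1) (by simp)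
  refine lt_of_le_of_lt (lintegral_mono fun y => le_of_eq ?_) this
  congr 1
  rw [Real.rpow_neg (by positivity), ← Nat.cast_one, ← Nat.cast_add, Real.rpow_natCast]

lemma lintegral_comp_smul_euc (F : Euc n → ℝ≥0∞) {s : ℝ} (hs : 0 < s) :
    ∫⁻ y, F (s • y) = ENNReal.ofReal (s ^ n)⁻¹ * ∫⁻ y, F y := by
  have h := lintegral_map_equiv (μ := (volume : Measure (Euc n))) F
    (Homeomorph.smulOfNeZero s hs.ne').toMeasurableEquiv
  have h2 : Measure.map (Homeomorph.smulOfNeZero (α := Euc n) s hs.ne').toMeasurableEquiv volume =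
      ENNReal.ofReal (s ^ n)⁻¹ • (volume : Measure (Euc n)) := by
    have := Measure.map_addHaar_smul (volume : Measure (Euc n)) hs.ne'
    simp only [finrank_euclideanSpace, Fintype.card_fin] at this
    rw [abs_of_pos (by positivity)] at this
    exact this
  rw [h2, lintegral_smul_measure] at h
  exact h.symm

lemma lintegral_scaled_decay (z : Euc n) {s : ℝ} (hs : 0 < s) :
    ∫⁻ y : Euc n, ENNReal.ofReal ((1 + s * ‖y - z‖) ^ (n + 1))⁻¹ =
      ENNReal.ofReal (s ^ n)⁻¹ * ∫⁻ y : Euc n, ENNReal.ofReal ((1 + ‖y‖) ^ (n + 1))⁻¹ := by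
  rw [lintegral_sub_right_eq_self (fun y : Euc n => ENNReal.ofReal ((1 + s * ‖y‖) ^ (n + 1))⁻¹),
    ← lintegral_comp_smul_euc _ hs]
  simp only [norm_smul, Real.norm_of_nonneg hs.le]

lemma lintegral_tsum_rpow_le_of_weighted {X Y : Type*} [MeasurableSpace X] [MeasurableSpace Y]
    {p : ℝ} (hp : 1 < p) {Q D : ℝ≥0∞} (hQ0 : Q ≠ 0) (hQt : Q ≠ ∞)
    {τ : Measure Y} [SFinite τ] {ν : Measure X} [SFinite ν] {G : ℕ → X → Y → ℝ≥0∞}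
    (hG : ∀ i, Measurable fun u : X × Y => G i u.1 u.2) {ω : Y → ℝ≥0∞} (hωm : Measurable ω)
    (hω0 : ∀ z, ω z ≠ 0) (hωt : ∀ z, ω z ≠ ∞)
    (h : ∀ i z, ∫⁻ y, G i y z ^ p * (Q ^ i * ω z) ^ (1 - p) ∂ν ≤ D * (Q ^ i * ω z)) :
    ∫⁻ y, (∑' i : ℕ, ∫⁻ z, G i y z ∂τ) ^ p ∂ν ≤ D * ((1 - Q)⁻¹ * ∫⁻ z, ω z ∂τ) ^ p := by
  obtain ⟨w, hw⟩ : ∃ w : ℕ × Y → ℝ≥0∞, ∀ u, w u = Q ^ u.1 * ω u.2 := ⟨_, fun _ => rfl⟩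
  have hwm : Measurable w := by
    rw [funext hw]
    refine Measurable.mul ?_ (hωm.comp measurable_snd)
    exact (measurable_of_countable (fun i : ℕ => Q ^ i)).comp measurable_fst
  have hw0 : ∀ u, w u ≠ 0 := fun u => hw u ▸ mul_ne_zero (pow_ne_zero _ hQ0) (hω0 _)
  have hwt : ∀ u, w u ≠ ∞ := fun u => hw u ▸ ENNReal.mul_ne_top (ENNReal.pow_ne_top hQt) (hωt _)
  have hGm : Measurable fun v : X × (ℕ × Y) => G v.2.1 v.1 v.2.2 := by
    have : Measurable fun v : (X × Y) × ℕ => G v.2 v.1.1 v.1.2 :=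
      measurable_from_prod_countable_left (f := fun v : (X × Y) × ℕ => G v.2 v.1.1 v.1.2) hG
    exact this.comp (f := fun v : X × (ℕ × Y) => ((v.1, v.2.2), v.2.1)) (by fun_prop)
  have hint_w : ∫⁻ u, w u ∂(Measure.count.prod τ) = (1 - Q)⁻¹ * ∫⁻ z, ω z ∂τ := by
    rw [lintegral_prod _ hwm.aemeasurable, lintegral_count]
    simp only [hw]
    simp_rw [lintegral_const_mul _ hωm]
    rw [ENNReal.tsum_mul_right, ENNReal.tsum_geometric]
  have hm : Measurable fun v : X × (ℕ × Y) => G v.2.1 v.1 v.2.2 ^ p * w v.2 ^ (1 - p) :=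
    (hGm.pow_const p).mul ((hwm.comp measurable_snd).pow_const _)
  have hpt : ∀ y, (∑' i : ℕ, ∫⁻ z, G i y z ∂τ) ^ p ≤
      ((1 - Q)⁻¹ * ∫⁻ z, ω z ∂τ) ^ (p - 1) *
        ∫⁻ u, G u.1 y u.2 ^ p * w u ^ (1 - p) ∂(Measure.count.prod τ) := by
    intro y
    have hy : Measurable fun u : ℕ × Y => G u.1 y u.2 := hGm.comp measurable_prodMk_left
    have h1 := lintegral_rpow_le_weighted (μ := Measure.count.prod τ) hp hy.aemeasurable
      hwm.aemeasurable hw0 hwt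
    rwa [lintegral_prod _ hy.aemeasurable, lintegral_count, hint_w] at h1
  have hm' : Measurable fun v : (ℕ × Y) × X => G v.1.1 v.2 v.1.2 ^ p * w v.1 ^ (1 - p) :=
    hm.comp measurable_swap
  calc ∫⁻ y, (∑' i : ℕ, ∫⁻ z, G i y z ∂τ) ^ p ∂ν
      ≤ ∫⁻ y, ((1 - Q)⁻¹ * ∫⁻ z, ω z ∂τ) ^ (p - 1) *
          ∫⁻ u, G u.1 y u.2 ^ p * w u ^ (1 - p) ∂(Measure.count.prod τ) ∂ν :=
        lintegral_mono fun y => hpt y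
    _ = ((1 - Q)⁻¹ * ∫⁻ z, ω z ∂τ) ^ (p - 1) * ∫⁻ y,
          ∫⁻ u, G u.1 y u.2 ^ p * w u ^ (1 - p) ∂(Measure.count.prod τ) ∂ν :=
        lintegral_const_mul _ (hm.lintegral_prod_right' (ν := Measure.count.prod τ))
    _ = ((1 - Q)⁻¹ * ∫⁻ z, ω z ∂τ) ^ (p - 1) *
          ∫⁻ u, ∫⁻ y, G u.1 y u.2 ^ p * w u ^ (1 - p) ∂ν ∂(Measure.count.prod τ) := by
        rw [lintegral_lintegral_swap
          (f := fun y (u : ℕ × Y) => G u.1 y u.2 ^ p * w u ^ (1 - p)) hm.aemeasurable]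
    _ ≤ ((1 - Q)⁻¹ * ∫⁻ z, ω z ∂τ) ^ (p - 1) * ∫⁻ u, D * w u ∂(Measure.count.prod τ) := by
        gcongr with u
        rw [hw u]
        exact h u.1 u.2
    _ = D * ((1 - Q)⁻¹ * ∫⁻ z, ω z ∂τ) ^ p := by
        rw [lintegral_const_mul _ hwm, hint_w]
        generalize (1 - Q)⁻¹ * ∫⁻ z, ω z ∂τ = b
        have : b ^ (p - 1) * b = b ^ p := by
          nth_rewrite 2 [← ENNReal.rpow_one b]
          rw [← ENNReal.rpow_add_of_nonneg _ _ (by linarith) zero_le_one, sub_add_cancel]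
        rw [mul_left_comm, this]

lemma tail_Lp_bound {p : ℝ} (hn : 1 ≤ n) (hp : 1 < p) : ∃ C : ℝ, 0 < C ∧
    ∀ (τ : Measure (Euc n)) [SFinite τ] (x : Euc n) (J : ℕ) (r a : ℝ), r ≤ (2 ^ J)⁻¹ → 0 ≤ a →
      ∫⁻ z, ENNReal.ofReal ((1 + 2 ^ J * ‖x - z‖) ^ (n + 1))⁻¹ ∂τ ≤
        ENNReal.ofReal (((2 ^ J) ^ n)⁻¹ * a) →
      ∫⁻ y in ball x r, (∑' i : ℕ, ∫⁻ z,
          ENNReal.ofReal ((1 + 2 ^ (J + i) * ‖y - z‖) ^ (2 * (n + 1)))⁻¹ ∂τ) ^ p ≤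
        ENNReal.ofReal (C * ((2 ^ J) ^ n)⁻¹ * (((2 ^ J) ^ n)⁻¹ * a) ^ p) := by
  have hp0 : 0 < p := by linarith
  set q : ℝ := 2 ^ (-(n : ℝ) / p) with hq
  have hq0 : 0 < q := by positivity
  have hq1 : q < 1 := Real.rpow_lt_one_of_one_lt_of_neg one_lt_two
    (div_neg_of_neg_of_pos (by simp; omega) hp0)
  set Q := ENNReal.ofReal q with hQ
  have hQ0 : Q ≠ 0 := by simpa [hQ] using hq0
  have hQt : Q ≠ ∞ := ENNReal.ofReal_ne_top
  have hQ1 : Q < 1 := by rw [hQ]; simpa using hq1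
  have hQp : Q ^ p = ENNReal.ofReal (2 ^ n)⁻¹ := by
    rw [hQ, ENNReal.ofReal_rpow_of_pos hq0, hq, ← Real.rpow_mul (by norm_num), div_mul_cancel₀ _ hp0.ne',
      Real.rpow_neg (by norm_num), Real.rpow_natCast]
  set S := (1 - Q)⁻¹ with hS
  have hSt : S ≠ ∞ := by simpa [hS, tsub_eq_zero_iff_le] using hQ1
  set c0 := ∫⁻ y : Euc n, ENNReal.ofReal ((1 + ‖y‖) ^ (n + 1))⁻¹ with hc0
  have hc0t : c0 ≠ ∞ := (lintegral_one_add_norm_lt_top n).ne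
  set K := ENNReal.ofReal (2 ^ (n + 1)) with hK
  set C := K ^ p * c0 * S ^ p with hC
  have hCt : C ≠ ∞ := ENNReal.mul_ne_top (ENNReal.mul_ne_top
    (ENNReal.rpow_ne_top_of_nonneg hp0.le ENNReal.ofReal_ne_top) hc0t)
    (ENNReal.rpow_ne_top_of_nonneg hp0.le hSt)
  refine ⟨C.toReal + 1, by positivity, fun τ _ x J r a hr ha hW => ?_⟩
  set W := ENNReal.ofReal (((2 ^ J) ^ n)⁻¹ * a) with hWdef
  set ω : Euc n → ℝ≥0∞ := fun z => ENNReal.ofReal ((1 + 2 ^ J * ‖x - z‖) ^ (n + 1))⁻¹ with hω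
  have hω0 : ∀ z, ω z ≠ 0 := fun z => by
    simp only [hω, ne_eq, ENNReal.ofReal_eq_zero, not_le]; positivity
  have hωt : ∀ z, ω z ≠ ∞ := fun z => ENNReal.ofReal_ne_top
  have hωm : Measurable ω := by fun_prop
  set B : ℕ → Euc n → Euc n → ℝ≥0∞ := fun i y z =>
    ENNReal.ofReal ((1 + 2 ^ (J + i) * ‖y - z‖) ^ (n + 1))⁻¹ with hB
  set Fn : ℕ → Euc n → Euc n → ℝ≥0∞ := fun i y z =>
    ENNReal.ofReal ((1 + 2 ^ (J + i) * ‖y - z‖) ^ (2 * (n + 1)))⁻¹ with hFn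
  have hFm : ∀ i, Measurable fun u : Euc n × Euc n => Fn i u.1 u.2 := fun i => by
    simp only [hFn]; fun_prop
  have hBm : ∀ i z, Measurable fun y => B i y z := fun i z => by simp only [hB]; fun_prop
  have hB1 : ∀ i y z, B i y z ≤ 1 := fun i y z => by
    simp only [hB]
    rw [ENNReal.ofReal_le_one]
    exact inv_le_one_of_one_le₀ (one_le_pow₀ (le_add_of_nonneg_right (by positivity)))
  have hFle : ∀ i, ∀ y ∈ ball x r, ∀ z, Fn i y z ≤ K * B i y z * ω z := by
    intro i y hy z
    simp only [hFn, hK, hB, hω]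
    rw [← ENNReal.ofReal_mul (by positivity), ← ENNReal.ofReal_mul (by positivity)]
    refine ENNReal.ofReal_le_ofReal ?_
    have h1 : 1 + 2 ^ J * ‖x - z‖ ≤ 2 * (1 + 2 ^ (J + i) * ‖y - z‖) := by
      have h2 : ‖x - z‖ ≤ ‖y - x‖ + ‖y - z‖ := by
        rw [norm_sub_rev y x]; exact norm_sub_le_norm_sub_add_norm_sub x y z
      have h3 : 2 ^ J * ‖y - x‖ ≤ 1 := by
        have : ‖y - x‖ ≤ (2 ^ J)⁻¹ := (mem_ball_iff_norm.1 hy).le.trans hr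
        calc _ ≤ (2 : ℝ) ^ J * (2 ^ J)⁻¹ := by gcongr
          _ = 1 := mul_inv_cancel₀ (by positivity)
      have h4 : (2 : ℝ) ^ J * ‖y - z‖ ≤ 2 ^ (J + i) * ‖y - z‖ := by
        gcongr
        · norm_num
        · omega
      have h5 : (2 : ℝ) ^ J * ‖x - z‖ ≤ 2 ^ J * ‖y - x‖ + 2 ^ J * ‖y - z‖ := by
        rw [← mul_add]; gcongr
      have : 0 ≤ (2 : ℝ) ^ (J + i) * ‖y - z‖ := by positivity
      linarith
    have h6 := pow_le_pow_left₀ (by positivity) h1 (n + 1)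
    rw [mul_pow] at h6
    rw [two_mul, pow_add, mul_inv, mul_right_comm, mul_comm]
    gcongr
    rw [← div_eq_mul_inv, le_div_iff₀ (by positivity), ← div_eq_inv_mul, div_le_iff₀ (by positivity)]
    exact h6
  have hmain : ∀ i z, ∫⁻ y in ball x r, Fn i y z ^ p * (Q ^ i * ω z) ^ (1 - p) ≤
      K ^ p * c0 * ENNReal.ofReal ((2 ^ J) ^ n)⁻¹ * (Q ^ i * ω z) := by
    intro i z
    have h1 : ∀ y ∈ ball x r, Fn i y z ^ p * (Q ^ i * ω z) ^ (1 - p) ≤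
        (K ^ p * (Q ^ i) ^ (1 - p) * ω z) * B i y z := by
      intro y hy
      calc Fn i y z ^ p * (Q ^ i * ω z) ^ (1 - p) ≤ (K * B i y z * ω z) ^ p * (Q ^ i * ω z) ^ (1 - p) := by
            gcongr; exact hFle i y hy z
        _ = (K ^ p * (Q ^ i) ^ (1 - p) * (ω z ^ p * ω z ^ (1 - p))) * B i y z ^ p := by
            rw [ENNReal.mul_rpow_of_nonneg _ _ hp0.le, ENNReal.mul_rpow_of_nonneg _ _ hp0.le,
              ENNReal.mul_rpow_of_ne_top (ENNReal.pow_ne_top hQt) (hωt z)]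
            ring
        _ = (K ^ p * (Q ^ i) ^ (1 - p) * ω z) * B i y z ^ p := by
            rw [← ENNReal.rpow_add _ _ (hω0 z) (hωt z), add_sub_cancel, ENNReal.rpow_one]
        _ ≤ _ := by
            gcongr
            calc B i y z ^ p ≤ B i y z ^ (1 : ℝ) := ENNReal.rpow_le_rpow_of_exponent_ge (hB1 i y z) hp.le
              _ = _ := ENNReal.rpow_one _
    calc _ ≤ ∫⁻ y in ball x r, (K ^ p * (Q ^ i) ^ (1 - p) * ω z) * B i y z :=
          setLIntegral_mono ((hBm i z).const_mul _) h1
      _ ≤ ∫⁻ y, (K ^ p * (Q ^ i) ^ (1 - p) * ω z) * B i y z := setLIntegral_le_lintegral _ _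
      _ = (K ^ p * (Q ^ i) ^ (1 - p) * ω z) * (ENNReal.ofReal ((2 ^ (J + i)) ^ n)⁻¹ * c0) := by
          rw [lintegral_const_mul _ (hBm i z)]
          simp only [hB]
          rw [lintegral_scaled_decay z (by positivity)]
      _ = _ := by
          have h2 : (Q ^ i) ^ (1 - p) * ENNReal.ofReal ((2 ^ (J + i)) ^ n)⁻¹ =
              Q ^ i * ENNReal.ofReal ((2 ^ J) ^ n)⁻¹ := by
            have h3 : ENNReal.ofReal ((2 ^ (J + i)) ^ n)⁻¹ =
                ENNReal.ofReal ((2 ^ J) ^ n)⁻¹ * (Q ^ i) ^ p := by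
              rw [← ENNReal.rpow_natCast Q i, ← ENNReal.rpow_mul, mul_comm (i : ℝ) p, ENNReal.rpow_mul,
                hQp, ENNReal.rpow_natCast, ← ENNReal.ofReal_pow (by positivity),
                ← ENNReal.ofReal_mul (by positivity)]
              congr 1
              rw [pow_add, mul_pow, mul_inv, inv_pow, ← pow_mul, ← pow_mul 2 i n, mul_comm i n, pow_mul 2 n i]
            rw [h3, mul_left_comm, ← ENNReal.rpow_add _ _ (pow_ne_zero _ hQ0) (ENNReal.pow_ne_top hQt),
              sub_add_cancel, ENNReal.rpow_one, mul_comm]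
          calc _ = K ^ p * ω z * c0 * ((Q ^ i) ^ (1 - p) * ENNReal.ofReal ((2 ^ (J + i)) ^ n)⁻¹) := by
                ring
            _ = _ := by rw [h2]; ring
  refine (lintegral_tsum_rpow_le_of_weighted hp hQ0 hQt hFm hωm hω0 hωt hmain).trans ?_
  calc _ ≤ K ^ p * c0 * ENNReal.ofReal ((2 ^ J) ^ n)⁻¹ * (S * W) ^ p := by gcongr
    _ = C * ENNReal.ofReal ((2 ^ J) ^ n)⁻¹ * W ^ p := by
        rw [ENNReal.mul_rpow_of_nonneg _ _ hp0.le, hC]; ring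
    _ ≤ _ := by
        rw [hWdef, ENNReal.ofReal_rpow_of_nonneg (by positivity) hp0.le,
          ENNReal.ofReal_mul (by positivity), ENNReal.ofReal_mul (by positivity)]
        gcongr
        exact ENNReal.le_ofReal_iff_toReal_le hCt (by positivity) |>.2 (by linarith)

end TailLp

section CorePieces

variable {n : ℕ} {F : Type*} [NormedAddCommGroup F] [NormedSpace ℝ F]

lemma TaylorLp.of_dyadic {j : ℕ} {p : ℝ} {h P : Euc n → F} {x : Euc n} (hP : IsPolyDeg n j P)
    {b : ℕ → ℝ} (hb : Tendsto b atTop (𝓝 0))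
    (H : ∀ J : ℕ, ∀ r : ℝ, 0 < r → r ≤ (2 ^ J)⁻¹ → (2 ^ J)⁻¹ ≤ 2 * r →
      ∫⁻ y in ball x r, ‖h y - P y‖ₑ ^ p ≤ ENNReal.ofReal (b J * r ^ ((n : ℝ) + j * p))) :
    TaylorLp n j p h x := by
  refine ⟨P, hP, fun ε hε => ?_⟩
  obtain ⟨J₀, hJ₀⟩ := eventually_atTop.1 (hb.eventually (eventually_le_nhds hε))
  filter_upwards [Ioo_mem_nhdsGT (show (0 : ℝ) < (2 ^ (J₀ + 1))⁻¹ by positivity)] with r hr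
  have hr0 : 0 < r := hr.1
  have hr1 : 1 ≤ r⁻¹ := (one_le_inv₀ hr0).2 (hr.2.le.trans (inv_le_one_of_one_le₀ (one_le_pow₀ one_le_two)))
  obtain ⟨J, hJ1, hJ2⟩ := exists_nat_pow_near hr1 one_lt_two
  have hJJ : J₀ ≤ J := by
    have : (2 : ℝ) ^ (J₀ + 1) < 2 ^ (J + 1) := ((lt_inv_comm₀ hr0 (by positivity)).1 hr.2).trans hJ2
    have := (pow_lt_pow_iff_right₀ (one_lt_two (α := ℝ))).1 this
    omega
  refine (H J r hr0 ((le_inv_comm₀ (by positivity) hr0).1 hJ1) ?_).trans ?_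
  · rw [pow_succ] at hJ2
    rw [inv_le_iff_one_le_mul₀ (by positivity)]
    rw [inv_lt_iff_one_lt_mul₀ hr0] at hJ2
    linarith
  · gcongr
    exact hJ₀ J hJJ

open scoped LineDeriv in
lemma SchwartzMap.integral_lineDerivOp_eq_zero (l : 𝓢(Euc n, F)) (v : Euc n) :
    ∫ x, (∂_{v} l) x = 0 := by
  have h := integral_bilinear_hasLineDerivAt_right_eq_neg_left_of_integrable (μ := (volume : Measure (Euc n)))
    (f := fun _ : Euc n => (1 : ℝ)) (f' := fun _ => (0 : ℝ)) (g := l) (g' := fun x => (∂_{v} l : 𝓢(Euc n, F)) x) (v := v)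
    (B := ContinuousLinearMap.lsmul ℝ ℝ) (by simp) (by simpa using (∂_{v} l : 𝓢(Euc n, F)).integrable)
    (by simpa using l.integrable) (fun x _ => ?_) (fun x _ => ?_)
  · simpa using h
  · exact (hasFDerivAt_const (1 : ℝ) x).hasLineDerivAt v
  · rw [SchwartzMap.lineDerivOp_apply_eq_fderiv]
    exact (l.differentiableAt.hasFDerivAt).hasLineDerivAt v

lemma SchwartzMap.integrable_iteratedFDeriv (l : 𝓢(Euc n, F)) (m : ℕ) :
    Integrable (iteratedFDeriv ℝ m l) volume := by
  have h := l.integrable_pow_mul_iteratedFDeriv volume 0 m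
  simp only [pow_zero, one_mul] at h
  have hc : Continuous (iteratedFDeriv ℝ m l) :=
    (l.smooth ⊤).continuous_iteratedFDeriv (by exact_mod_cast le_top)
  have : SecondCountableTopologyEither (Euc n) (Euc n [×m]→L[ℝ] F) :=
    secondCountableTopologyEither_of_left _ _
  exact (integrable_norm_iff hc.aestronglyMeasurable).1 h

lemma SchwartzMap.integral_iteratedFDeriv_succ (l : 𝓢(Euc n, ℝ)) (m : ℕ) :
    ∫ x, iteratedFDeriv ℝ (m + 1) l x = 0 := by
  ext v
  have h := (ContinuousMultilinearMap.apply ℝ (fun _ : Fin (m + 1) => Euc n) ℝ v).integral_comp_comm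
    (l.integrable_iteratedFDeriv (m + 1))
  simp only [ContinuousMultilinearMap.apply_apply] at h
  rw [← h, zero_apply]
  have h2 : ∀ x, iteratedFDeriv ℝ (m + 1) l x v =
      (LineDeriv.iteratedLineDerivOp v l) x := fun x => by
    rw [SchwartzMap.iteratedLineDerivOp_eq_iteratedFDeriv]
  simp only [h2, LineDeriv.iteratedLineDerivOp_succ_left]
  exact SchwartzMap.integral_lineDerivOp_eq_zero _ _

lemma LebPoint.enorm_integral_le {σ : Measure (Euc n)} {f : Euc n → ℝ} {x : Euc n}
    (h : LebPoint n σ f x) : ∃ τ : Measure (Euc n), SFinite τ ∧ VanishingDensity n τ x ∧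
      ∀ (G : Type) [NormedAddCommGroup G] [NormedSpace ℝ G] (g : Euc n → G), Continuous g →
        (∃ C, ∀ z, ‖g z‖ ≤ C) → Integrable g volume → ∫ z, g z = 0 → ∀ (s : ℝ) (_ : 0 < s) (y : Euc n),
        ‖∫ z, f z • g (s • (y - z)) ∂σ‖ₑ ≤ ∫⁻ z, ‖g (s • (y - z))‖ₑ ∂τ := by
  obtain ⟨τ, h1, h2, h3⟩ := h
  refine ⟨τ, h1, h2, fun G _ _ g hg hgb hgi hg0 s hs y => h3 G _ (by fun_prop) ?_ ?_ ?_⟩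
  · obtain ⟨C, hC⟩ := hgb
    exact ⟨C, fun z => hC _⟩
  · exact (hgi.comp_smul hs.ne').comp_sub_left y
  · rw [integral_sub_left_eq_self (fun z => g (s • z)) volume y, Measure.integral_comp_smul, hg0, smul_zero]

end CorePieces

section CoreBounds

variable {n : ℕ}

lemma integrable_bdd_smul {G : Type*} [NormedAddCommGroup G] [NormedSpace ℝ G] {σ : Measure (Euc n)}
    [IsFiniteMeasure σ] {f : Euc n → ℝ} (hf : Measurable f) (hf1 : ∀ z, |f z| ≤ 1)
    {φ : Euc n → G} (hφ : Continuous φ) {C : ℝ} (hb : ∀ z, ‖φ z‖ ≤ C) :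
    Integrable (fun z => f z • φ z) σ := by
  have : SecondCountableTopologyEither (Euc n) G := secondCountableTopologyEither_of_left _ _
  refine Integrable.of_bound (hf.aestronglyMeasurable.smul hφ.aestronglyMeasurable) C
    (ae_of_all _ fun z => ?_)
  rw [norm_smul, Real.norm_eq_abs]
  calc _ ≤ 1 * ‖φ z‖ := by gcongr; exact hf1 z
    _ ≤ C := by simpa using hb z

lemma enorm_le_ofReal_mul_ofReal {G : Type*} [SeminormedAddCommGroup G] {g : G} {C b : ℝ} (hC : 0 ≤ C)
    (h : ‖g‖ ≤ C * b) : ‖g‖ₑ ≤ ENNReal.ofReal C * ENNReal.ofReal b := by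
  rw [← ENNReal.ofReal_mul hC, ← ofReal_norm]
  exact ENNReal.ofReal_le_ofReal h

lemma lintegral_enorm_scaled_le {G : Type*} [SeminormedAddCommGroup G] {g : Euc n → G} {C : ℝ} {N : ℕ}
    (hC : 0 ≤ C) (hg : ∀ w, ‖g w‖ ≤ C * ((1 + ‖w‖) ^ N)⁻¹) (τ : Measure (Euc n)) (j : ℕ) (y : Euc n) :
    ∫⁻ z, ‖g ((2 : ℝ) ^ j • (y - z))‖ₑ ∂τ ≤
      ENNReal.ofReal C * ∫⁻ z, ENNReal.ofReal ((1 + 2 ^ j * ‖y - z‖) ^ N)⁻¹ ∂τ := by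
  rw [← lintegral_const_mul' _ _ ENNReal.ofReal_ne_top]
  refine lintegral_mono fun z => ?_
  have := hg ((2 : ℝ) ^ j • (y - z))
  rw [norm_smul, Real.norm_of_nonneg (by positivity)] at this
  exact enorm_le_ofReal_mul_ofReal hC this

lemma norm_le_of_decay {G : Type*} [SeminormedAddCommGroup G] {g : Euc n → G} {C : ℝ} {N : ℕ}
    (hC : 0 ≤ C) (hg : ∀ w, ‖g w‖ ≤ C * ((1 + ‖w‖) ^ N)⁻¹) (w : Euc n) : ‖g w‖ ≤ C :=
  (hg w).trans (mul_le_of_le_one_right hC (inv_le_one_of_one_le₀ (one_le_pow₀ (by simp))))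

lemma norm_le_of_enorm_le_lintegral {G : Type*} [SeminormedAddCommGroup G] {g : G} {C a : ℝ} {I I' : ℝ≥0∞}
    (hC : 0 ≤ C) (ha : 0 ≤ a) (h : ‖g‖ₑ ≤ I) (h2 : I ≤ ENNReal.ofReal C * I')
    (h3 : I' ≤ ENNReal.ofReal a) : ‖g‖ ≤ C * a := by
  have : ‖g‖ₑ ≤ ENNReal.ofReal (C * a) := by
    rw [ENNReal.ofReal_mul hC]
    exact h.trans (h2.trans (by gcongr))
  rwa [← ofReal_norm, ENNReal.ofReal_le_ofReal_iff (by positivity)] at this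

theorem LebPoint.exists_bounds {p : ℝ} (hn : 1 ≤ n) (hp : 1 < p) {σ : Measure (Euc n)} [IsFiniteMeasure σ]
    {f : Euc n → ℝ} (hf : Measurable f) (hf1 : ∀ z, |f z| ≤ 1) {x : Euc n} (h : LebPoint n σ f x)
    (l : 𝓢(Euc n, ℝ)) (hl : ∫ w, l w = 0) :
    ∃ A : ℕ → ℝ, (∀ j, 0 ≤ A j) ∧ Tendsto A atTop (𝓝 0) ∧ ∃ C, 0 < C ∧
      (∀ m ≤ n, ∀ j : ℕ, ‖∫ z, f z • iteratedFDeriv ℝ m l ((2 : ℝ) ^ j • (x - z)) ∂σ‖ ≤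
        C * (((2 ^ j) ^ n)⁻¹ * A j)) ∧
      (∀ (j : ℕ) (y : Euc n), 2 ^ j * ‖y - x‖ ≤ 1 →
        ‖∫ z, f z • l ((2 : ℝ) ^ j • (y - z)) ∂σ - ∑ m ∈ Finset.range (n + 1), (m.factorial : ℝ)⁻¹ •
          (∫ z, f z • iteratedFDeriv ℝ m l ((2 : ℝ) ^ j • (x - z)) ∂σ) (fun _ => (2 : ℝ) ^ j • (y - x))‖ ≤
        C * (2 ^ j * ‖y - x‖) ^ (n + 1) * (((2 ^ j) ^ n)⁻¹ * A j)) ∧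
      (∀ (J : ℕ) (r : ℝ), r ≤ (2 ^ J)⁻¹ →
        ∫⁻ y in ball x r, (∑' i : ℕ, ‖∫ z, f z • l ((2 : ℝ) ^ (J + i) • (y - z)) ∂σ‖ₑ) ^ p ≤
          ENNReal.ofReal (C * ((2 ^ J) ^ n)⁻¹ * (((2 ^ J) ^ n)⁻¹ * A J) ^ p)) := by
  obtain ⟨τ, hτ, hV, hle⟩ := h.enorm_integral_le
  obtain ⟨A, hA0, hA, hAτ⟩ := hV.exists_seq
  have hA0' : ∀ j : ℕ, 0 ≤ (((2 : ℝ) ^ j) ^ n)⁻¹ * A j := fun j => mul_nonneg (by positivity) (hA0 j)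
  choose Cm hCm hdec using fun m => l.exists_iteratedFDeriv_decay (n + 1) m
  obtain ⟨Ct, hCt, htay⟩ := l.exists_taylor_bound (n + 1) n
  obtain ⟨Cd, hCd, hdec2⟩ := l.exists_decay (2 * (n + 1))
  obtain ⟨Ck, hCk, htail⟩ := tail_Lp_bound hn hp
  have hp0 : 0 < p := by linarith
  have hcont : ∀ m, Continuous (iteratedFDeriv ℝ m l) := fun m =>
    (l.smooth ⊤).continuous_iteratedFDeriv (by exact_mod_cast le_top)
  have hint0 : ∀ m, ∫ w, iteratedFDeriv ℝ m l w = 0 := by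
    intro m
    cases m with
    | zero =>
      ext v
      have h := (ContinuousMultilinearMap.apply ℝ (fun _ : Fin 0 => Euc n) ℝ v).integral_comp_comm
        (l.integrable_iteratedFDeriv 0)
      simp only [ContinuousMultilinearMap.apply_apply, iteratedFDeriv_zero_apply, hl] at h
      rw [← h, zero_apply]
    | succ m => exact l.integral_iteratedFDeriv_succ m
  refine ⟨A, hA0, hA, ∑ m ∈ Finset.range (n + 1), Cm m + Ct + Cd ^ p * Ck, ?_, ?_, ?_, ?_⟩
  · have : 0 ≤ ∑ m ∈ Finset.range (n + 1), Cm m := Finset.sum_nonneg fun m _ => (hCm m).le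
    positivity
  · intro m hm j
    have h1 := norm_le_of_enorm_le_lintegral (hCm m).le (hA0' j)
      (hle _ (iteratedFDeriv ℝ m l) (hcont m) ⟨_, norm_le_of_decay (hCm m).le (hdec m)⟩
        (l.integrable_iteratedFDeriv m) (hint0 m) (2 ^ j) (by positivity) x)
      (lintegral_enorm_scaled_le (hCm m).le (hdec m) τ j x) (hAτ j)
    refine h1.trans ?_
    have h2 : Cm m ≤ ∑ m ∈ Finset.range (n + 1), Cm m :=
      Finset.single_le_sum (fun m _ => (hCm m).le) (Finset.mem_range.2 (by omega))
    have h3 : 0 < Cd ^ p * Ck := by positivity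
    gcongr
    · exact hA0' j
    · linarith
  · intro j y hy
    obtain ⟨b, hb⟩ : ∃ b, b = (2 : ℝ) ^ j • (y - x) := ⟨_, rfl⟩
    have hbn : ‖b‖ = 2 ^ j * ‖y - x‖ := by rw [hb, norm_smul, Real.norm_of_nonneg (by positivity)]
    obtain ⟨g, hg⟩ : ∃ g : Euc n → ℝ, ∀ w, g w = l (w + b) - ∑ m ∈ Finset.range (n + 1),
        (m.factorial : ℝ)⁻¹ • iteratedFDeriv ℝ m l w (fun _ => b) := ⟨_, fun _ => rfl⟩
    have hgd : ∀ w, ‖g w‖ ≤ Ct * ‖b‖ ^ (n + 1) * ((1 + ‖w‖) ^ (n + 1))⁻¹ := fun w => by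
      rw [hg]; exact htay w b (by rw [hbn]; exact hy)
    have hcl : Continuous l := l.continuous
    have hcm : ∀ m, Continuous fun w => iteratedFDeriv ℝ m l w (fun _ => b) := fun m =>
      ((ContinuousMultilinearMap.apply ℝ (fun _ : Fin m => Euc n) ℝ (fun _ => b)).continuous).comp (hcont m)
    have him : ∀ m, Integrable (fun w => iteratedFDeriv ℝ m l w (fun _ => b)) volume := fun m =>
      (ContinuousMultilinearMap.apply ℝ (fun _ : Fin m => Euc n) ℝ (fun _ => b)).integrable_comp
        (l.integrable_iteratedFDeriv m)
    have him0 : ∀ m, ∫ w, iteratedFDeriv ℝ m l w (fun _ => b) = 0 := fun m => by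
      have := (ContinuousMultilinearMap.apply ℝ (fun _ : Fin m => Euc n) ℝ (fun _ => b)).integral_comp_comm
        (l.integrable_iteratedFDeriv m)
      simpa only [hint0, ContinuousMultilinearMap.apply_apply, zero_apply] using this
    have hims : ∀ m, Integrable (fun w => (m.factorial : ℝ)⁻¹ • iteratedFDeriv ℝ m l w (fun _ => b)) volume :=
      fun m => (him m).const_mul (m.factorial : ℝ)⁻¹
    have hcs : ∀ m, Continuous fun w => (m.factorial : ℝ)⁻¹ • iteratedFDeriv ℝ m l w (fun _ => b) :=
      fun m => continuous_const.mul (hcm m)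
    have hC0 : 0 ≤ Ct * ‖b‖ ^ (n + 1) := by positivity
    have hgc : Continuous g := by
      rw [funext hg]
      exact (hcl.comp (by fun_prop)).sub (continuous_finsetSum _ fun m _ => hcs m)
    have his : Integrable (fun w => ∑ m ∈ Finset.range (n + 1),
        (m.factorial : ℝ)⁻¹ • iteratedFDeriv ℝ m l w (fun _ => b)) volume :=
      integrable_finsetSum _ fun m _ => hims m
    have h1 := norm_le_of_enorm_le_lintegral hC0 (hA0' j)
      (hle _ g hgc ⟨_, norm_le_of_decay hC0 hgd⟩ (by
          rw [funext hg]
          exact (l.integrable.comp_add_right b).sub his) (by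
          simp only [hg]
          rw [integral_sub (l.integrable.comp_add_right b) his, integral_add_right_eq_self, hl,
            integral_finsetSum _ fun m _ => hims m]
          simp only [integral_smul, him0, smul_zero, Finset.sum_const_zero, sub_zero])
        (2 ^ j) (by positivity) x)
      (lintegral_enorm_scaled_le hC0 hgd τ j x) (hAτ j)
    have hI1 : Integrable (fun z => f z • l ((2 : ℝ) ^ j • (y - z))) σ :=
      integrable_bdd_smul hf hf1 (φ := fun z => l ((2 : ℝ) ^ j • (y - z))) (by fun_prop)
        fun z => norm_le_of_decay hCd.le hdec2 _
    have hI2 : ∀ m, Integrable (fun z => f z • iteratedFDeriv ℝ m l ((2 : ℝ) ^ j • (x - z))) σ := fun m =>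
      integrable_bdd_smul hf hf1 (φ := fun z => iteratedFDeriv ℝ m l ((2 : ℝ) ^ j • (x - z)))
        ((hcont m).comp (by fun_prop)) fun z => norm_le_of_decay (hCm m).le (hdec m) _
    have hI3 : ∀ m, Integrable (fun z => (f z • iteratedFDeriv ℝ m l ((2 : ℝ) ^ j • (x - z))) (fun _ => b)) σ :=
      fun m => (ContinuousMultilinearMap.apply ℝ (fun _ : Fin m => Euc n) ℝ (fun _ => b)).integrable_comp
        (hI2 m)
    have hI3s : ∀ m, Integrable (fun z => (m.factorial : ℝ)⁻¹ •
        (f z • iteratedFDeriv ℝ m l ((2 : ℝ) ^ j • (x - z))) (fun _ => b)) σ :=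
      fun m => (hI3 m).const_mul (m.factorial : ℝ)⁻¹
    have h4 : ∫ z, f z • g ((2 : ℝ) ^ j • (x - z)) ∂σ = ∫ z, f z • l ((2 : ℝ) ^ j • (y - z)) ∂σ -
        ∑ m ∈ Finset.range (n + 1), (m.factorial : ℝ)⁻¹ •
          (∫ z, f z • iteratedFDeriv ℝ m l ((2 : ℝ) ^ j • (x - z)) ∂σ) (fun _ => b) := by
      have h5 : ∀ m, (∫ z, f z • iteratedFDeriv ℝ m l ((2 : ℝ) ^ j • (x - z)) ∂σ) (fun _ => b) =
          ∫ z, (f z • iteratedFDeriv ℝ m l ((2 : ℝ) ^ j • (x - z))) (fun _ => b) ∂σ := fun m =>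
        ((ContinuousMultilinearMap.apply ℝ (fun _ : Fin m => Euc n) ℝ (fun _ => b)).integral_comp_comm
          (hI2 m)).symm
      simp only [h5, ← integral_smul]
      rw [← integral_finsetSum _ fun m _ => hI3s m, ← integral_sub hI1
        (integrable_finsetSum _ fun m _ => hI3s m)]
      congr 1 with z
      have h6 : (2 : ℝ) ^ j • (x - z) + b = (2 : ℝ) ^ j • (y - z) := by
        rw [hb, ← smul_add]; congr 1; abel
      rw [hg, h6, smul_sub, Finset.smul_sum]
      congr 1
      refine Finset.sum_congr rfl fun m _ => ?_
      simp only [smul_apply, smul_eq_mul]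
      ring
    rw [h4] at h1
    rw [← hbn, ← hb]
    refine h1.trans ?_
    have h2 : 0 ≤ ∑ m ∈ Finset.range (n + 1), Cm m := Finset.sum_nonneg fun m _ => (hCm m).le
    have h3 : 0 < Cd ^ p * Ck := by positivity
    gcongr
    · exact hA0' j
    · linarith
  · intro J r hr
    have h1 : ∀ y, ∑' i : ℕ, ‖∫ z, f z • l ((2 : ℝ) ^ (J + i) • (y - z)) ∂σ‖ₑ ≤
        ENNReal.ofReal Cd * ∑' i : ℕ, ∫⁻ z,
          ENNReal.ofReal ((1 + 2 ^ (J + i) * ‖y - z‖) ^ (2 * (n + 1)))⁻¹ ∂τ := fun y => by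
      rw [← ENNReal.tsum_mul_left]
      refine ENNReal.tsum_le_tsum fun i => ?_
      exact (hle _ l l.continuous ⟨_, norm_le_of_decay hCd.le hdec2⟩ l.integrable hl (2 ^ (J + i))
        (by positivity) y).trans (lintegral_enorm_scaled_le hCd.le hdec2 τ (J + i) y)
    calc _ ≤ ∫⁻ y in ball x r, ENNReal.ofReal Cd ^ p * (∑' i : ℕ, ∫⁻ z,
          ENNReal.ofReal ((1 + 2 ^ (J + i) * ‖y - z‖) ^ (2 * (n + 1)))⁻¹ ∂τ) ^ p := by
          refine lintegral_mono fun y => ?_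
          rw [← ENNReal.mul_rpow_of_nonneg _ _ hp0.le]
          exact ENNReal.rpow_le_rpow (h1 y) hp0.le
      _ = ENNReal.ofReal Cd ^ p * ∫⁻ y in ball x r, (∑' i : ℕ, ∫⁻ z,
          ENNReal.ofReal ((1 + 2 ^ (J + i) * ‖y - z‖) ^ (2 * (n + 1)))⁻¹ ∂τ) ^ p :=
          lintegral_const_mul' _ _ (ENNReal.rpow_ne_top_of_nonneg hp0.le ENNReal.ofReal_ne_top)
      _ ≤ ENNReal.ofReal Cd ^ p * ENNReal.ofReal (Ck * ((2 ^ J) ^ n)⁻¹ * (((2 ^ J) ^ n)⁻¹ * A J) ^ p) := by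
          gcongr
          exact htail τ x J r (A J) hr (hA0 J) (hAτ J)
      _ ≤ _ := by
          rw [ENNReal.ofReal_rpow_of_nonneg hCd.le hp0.le, ← ENNReal.ofReal_mul (by positivity)]
          refine ENNReal.ofReal_le_ofReal ?_
          have h2 : 0 ≤ ∑ m ∈ Finset.range (n + 1), Cm m := Finset.sum_nonneg fun m _ => (hCm m).le
          rw [← mul_assoc, ← mul_assoc]
          have := Real.rpow_nonneg (hA0' J) p
          gcongr
          linarith

end CoreBounds

section DyadicSums

lemma tendsto_two_pow_inv_mul_sum {A : ℕ → ℝ} (hA : Tendsto A atTop (𝓝 0)) :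
    Tendsto (fun J : ℕ => ((2 : ℝ) ^ J)⁻¹ * ∑ j ∈ Finset.range J, 2 ^ j * A j) atTop (𝓝 0) := by
  have h1 : (fun j : ℕ => (2 : ℝ) ^ j * A j) =o[atTop] fun j : ℕ => (2 : ℝ) ^ j := by
    have := (Asymptotics.isLittleO_one_iff ℝ).2 hA
    simpa using (Asymptotics.isBigO_refl (fun j : ℕ => (2 : ℝ) ^ j) atTop).mul_isLittleO this
  have hs : ∀ J : ℕ, ∑ j ∈ Finset.range J, (2 : ℝ) ^ j = 2 ^ J - 1 := fun J => by
    rw [geom_sum_eq (by norm_num)]; norm_num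
  have h2 := h1.sum_range (fun j => by positivity) (by
    simp only [hs]
    exact tendsto_atTop_add_const_right _ _ (tendsto_pow_atTop_atTop_of_one_lt one_lt_two))
  simp only [hs] at h2
  have h3 : (fun J : ℕ => (2 : ℝ) ^ J - 1) =O[atTop] fun J : ℕ => (2 : ℝ) ^ J := by
    refine Asymptotics.IsBigO.of_bound 1 (Eventually.of_forall fun J => ?_)
    have : (1 : ℝ) ≤ 2 ^ J := one_le_pow₀ one_le_two
    rw [one_mul, Real.norm_of_nonneg (by linarith), Real.norm_of_nonneg (by positivity)]
    linarith
  have := (h2.trans_isBigO h3).tendsto_div_nhds_zero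
  simpa only [div_eq_inv_mul] using this

lemma tendsto_tsum_half_pow_mul_shift {A : ℕ → ℝ} (hA : Tendsto A atTop (𝓝 0)) :
    Tendsto (fun J : ℕ => ∑' i : ℕ, (1 / 2 : ℝ) ^ i * A (J + i)) atTop (𝓝 0) := by
  obtain ⟨M, hM⟩ := hA.norm.bddAbove_range
  have hM' : ∀ j, ‖A j‖ ≤ M := fun j => hM ⟨j, rfl⟩
  have := tendsto_tsum_of_dominated_convergence (f := fun J i : ℕ => (1 / 2 : ℝ) ^ i * A (J + i))
    (g := fun _ => 0) (𝓕 := atTop) (summable_half_pow.mul_right M) (fun i => by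
      simpa using (hA.comp (tendsto_add_atTop_nat i)).const_mul ((1 / 2 : ℝ) ^ i))
    (Eventually.of_forall fun J i => by
      rw [norm_mul, norm_pow, Real.norm_of_nonneg (by norm_num : (0 : ℝ) ≤ 1 / 2)]
      gcongr
      exact hM' _)
  simpa using this

lemma exists_tendsto_two_pow_mul_norm_sum_sub {E : Type*} [NormedAddCommGroup E] [CompleteSpace E]
    {d : ℕ} (hd : 1 ≤ d) {A : ℕ → ℝ} (hA0 : ∀ j, 0 ≤ A j) (hA : Tendsto A atTop (𝓝 0)) {C : ℝ}
    (hC : 0 ≤ C) {T : ℕ → E} (hT : ∀ j, ‖T j‖ ≤ C * (((2 ^ j) ^ d)⁻¹ * A j)) :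
    ∃ L, Tendsto (fun J : ℕ => ((2 : ℝ) ^ J) ^ d * ‖∑ j ∈ Finset.range J, T j - L‖) atTop (𝓝 0) := by
  obtain ⟨M, hM⟩ := hA.norm.bddAbove_range
  have hM' : ∀ j, A j ≤ M := fun j => (Real.le_norm_self _).trans (hM ⟨j, rfl⟩)
  have hsum : ∀ J, Summable fun i : ℕ => (1 / 2 : ℝ) ^ i * A (J + i) := fun J =>
    Summable.of_nonneg_of_le (fun i => mul_nonneg (by positivity) (hA0 _))
      (fun i => by gcongr; exact hM' _) (summable_half_pow.mul_right M)
  have hT' : ∀ J i, ‖T (J + i)‖ ≤ C * ((2 ^ J) ^ d)⁻¹ * ((1 / 2 : ℝ) ^ i * A (J + i)) := fun J i => by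
    refine (hT _).trans ?_
    rw [mul_assoc, ← mul_assoc (((2 : ℝ) ^ J) ^ d)⁻¹, pow_add, mul_pow, mul_inv]
    have := hA0 (J + i)
    have h1 : (((2 : ℝ) ^ i) ^ d)⁻¹ ≤ (1 / 2) ^ i := by
      rw [one_div, inv_pow]
      exact inv_anti₀ (by positivity) (le_self_pow₀ (one_le_pow₀ one_le_two) (by omega))
    gcongr
  have hTs : Summable T := by
    refine Summable.of_norm_bounded ((hsum 0).mul_left (C * ((2 ^ 0) ^ d)⁻¹)) fun i => ?_
    simpa using hT' 0 i
  refine ⟨∑' j, T j, ?_⟩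
  have h0 := (tendsto_tsum_half_pow_mul_shift hA).const_mul C
  rw [mul_zero] at h0
  refine squeeze_zero (fun J => by positivity) (fun J => ?_) h0
  rw [← hTs.sum_add_tsum_nat_add J, sub_add_cancel_left, norm_neg]
  have h1 : ‖∑' i, T (i + J)‖ ≤ C * ((2 ^ J) ^ d)⁻¹ * ∑' i, ((1 / 2 : ℝ) ^ i * A (J + i)) := by
    rw [← tsum_mul_left]
    exact tsum_of_norm_bounded ((hsum J).mul_left _).hasSum fun i => by rw [add_comm]; exact hT' J i
  calc _ ≤ ((2 : ℝ) ^ J) ^ d * (C * ((2 ^ J) ^ d)⁻¹ * ∑' i, ((1 / 2 : ℝ) ^ i * A (J + i))) := by gcongr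
    _ = _ := by field_simp

end DyadicSums

section CoreTheorem

variable {n : ℕ}

lemma exists_tendsto_multilinear_of_coeff {m : ℕ} {S : ℕ → (Euc n [×m]→L[ℝ] ℝ)}
    (h : ∀ I : Fin m → Fin n, ∃ L, Tendsto (fun J => S J (fun i => stdVec n (I i))) atTop (𝓝 L)) :
    ∃ L, Tendsto S atTop (𝓝 L) := by
  choose L hL using h
  let B : (Fin m → Fin n) → (Euc n [×m]→L[ℝ] ℝ) := fun I =>
    (ContinuousMultilinearMap.mkPiAlgebra ℝ (Fin m) ℝ).compContinuousLinearMap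
      fun i => EuclideanSpace.proj (I i)
  have hB : ∀ M : (Euc n [×m]→L[ℝ] ℝ), M = ∑ I, M (fun i => stdVec n (I i)) • B I := by
    intro M
    refine ContinuousMultilinearMap.toMultilinearMap_injective
      (Module.Basis.ext_multilinear (fun _ => (EuclideanSpace.basisFun (Fin n) ℝ).toBasis) fun I => ?_)
    have h1 : ∀ I' : Fin m → Fin n, B I' (fun i => stdVec n (I i)) = if I = I' then 1 else 0 := by
      intro I'
      have h2 : ∀ i, (EuclideanSpace.proj (I' i) : Euc n →L[ℝ] ℝ) (stdVec n (I i)) =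
          if I i = I' i then 1 else 0 := fun i => by
        simp [stdVec, eq_comm]
      simp only [B, ContinuousMultilinearMap.compContinuousLinearMap_apply,
        ContinuousMultilinearMap.mkPiAlgebra_apply, h2]
      rw [Finset.prod_ite_zero]
      simp [funext_iff]
    simp only [OrthonormalBasis.coe_toBasis, EuclideanSpace.basisFun_apply,
      ContinuousMultilinearMap.coe_coe]
    change M (fun i => stdVec n (I i)) = (∑ I', M (fun i => stdVec n (I' i)) • B I') fun i => stdVec n (I i)
    simp [h1]
  refine ⟨∑ I, L I • B I, ?_⟩
  rw [show S = fun J => ∑ I, S J (fun i => stdVec n (I i)) • B I from funext fun J => hB (S J)]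
  exact tendsto_finsetSum _ fun I _ => (hL I).smul_const _

lemma lintegral_ball_rpow_le_of_le_add {x : Euc n} {p r e g : ℝ} (hp : 1 < p) (hr : 0 < r) (he : 0 ≤ e)
    {h G : Euc n → ℝ≥0∞} (hh : ∀ y ∈ ball x r, h y ≤ ENNReal.ofReal (e * r ^ n) + G y)
    (hG : ∫⁻ y in ball x r, G y ^ p ≤ ENNReal.ofReal (g * r ^ ((n : ℝ) + n * p))) (hg : 0 ≤ g) :
    ∫⁻ y in ball x r, h y ^ p ≤ ENNReal.ofReal
      (2 ^ (p - 1) * (e ^ p * (volume (ball (0 : Euc n) 1)).toReal + g) * r ^ ((n : ℝ) + n * p)) := by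
  have hp0 : 0 < p := by linarith
  have hrn : (r ^ n) ^ p * r ^ n = r ^ ((n : ℝ) + n * p) := by
    rw [add_comm, Real.rpow_add hr, Real.rpow_mul hr.le, Real.rpow_natCast]
  calc ∫⁻ y in ball x r, h y ^ p
      ≤ ∫⁻ y in ball x r, ENNReal.ofReal (2 ^ (p - 1)) * (ENNReal.ofReal (e * r ^ n) ^ p + G y ^ p) := by
        refine setLIntegral_mono' measurableSet_ball fun y hy => ?_
        refine (ENNReal.rpow_le_rpow (hh y hy) hp0.le).trans ?_
        rw [← ENNReal.ofReal_rpow_of_pos two_pos, ENNReal.ofReal_ofNat]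
        exact ENNReal.rpow_add_le_mul_rpow_add_rpow _ _ hp.le
    _ = ENNReal.ofReal (2 ^ (p - 1)) * (ENNReal.ofReal (e * r ^ n) ^ p * volume (ball x r) +
          ∫⁻ y in ball x r, G y ^ p) := by
        rw [lintegral_const_mul' _ _ ENNReal.ofReal_ne_top, lintegral_add_left measurable_const,
          setLIntegral_const]
    _ ≤ ENNReal.ofReal (2 ^ (p - 1)) * (ENNReal.ofReal ((e * r ^ n) ^ p * (r ^ n *
          (volume (ball (0 : Euc n) 1)).toReal)) + ENNReal.ofReal (g * r ^ ((n : ℝ) + n * p))) := by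
        rw [volume_ball_euc x hr, ENNReal.ofReal_rpow_of_nonneg (by positivity) hp0.le,
          ENNReal.ofReal_mul (p := (e * r ^ n) ^ p) (by positivity),
          ENNReal.ofReal_mul (p := r ^ n) (by positivity),
          ENNReal.ofReal_toReal (measure_ball_lt_top.ne)]
        gcongr
    _ = _ := by
        rw [← ENNReal.ofReal_add (by positivity) (by positivity), ← ENNReal.ofReal_mul (by positivity)]
        congr 1
        rw [Real.mul_rpow he (by positivity), ← hrn]
        ring

theorem taylorLp_tsum_of_lebPoint {p : ℝ} (hn : 1 ≤ n) (hp : 1 < p) {σ : Measure (Euc n)}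
    [IsFiniteMeasure σ] {f : Euc n → ℝ} (hf : Measurable f) (hf1 : ∀ z, |f z| ≤ 1) {x : Euc n}
    (h : LebPoint n σ f x) (l : 𝓢(Euc n, ℝ)) (hl : ∫ w, l w = 0)
    (hconv : ∀ I : Fin n → Fin n, ∃ L, Tendsto (fun J : ℕ => ∑ j ∈ Finset.range J,
      ((2 : ℝ) ^ j) ^ n * ∫ z, f z * dirDeriv n n I l ((2 : ℝ) ^ j • (x - z)) ∂σ) atTop (𝓝 L)) :
    TaylorLp n n p (fun y => ∑' j : ℕ, ∫ z, f z * l ((2 : ℝ) ^ j • (y - z)) ∂σ) x := by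
  obtain ⟨A, hA0, hA, C, hC, hb1, hb2, hb3⟩ := h.exists_bounds hn hp hf hf1 l hl
  obtain ⟨c, hc⟩ : ∃ c : (m j : ℕ) → (Euc n [×m]→L[ℝ] ℝ),
      ∀ m j, c m j = ∫ z, f z • iteratedFDeriv ℝ m l ((2 : ℝ) ^ j • (x - z)) ∂σ := ⟨_, fun _ _ => rfl⟩
  obtain ⟨T, hT⟩ : ∃ T : (m j : ℕ) → (Euc n [×m]→L[ℝ] ℝ), ∀ m j, T m j = ((2 : ℝ) ^ j) ^ m • c m j :=
    ⟨_, fun _ _ => rfl⟩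
  obtain ⟨u, hu⟩ : ∃ u : ℕ → Euc n → ℝ, ∀ j y, u j y = ∫ z, f z * l ((2 : ℝ) ^ j • (y - z)) ∂σ :=
    ⟨_, fun _ _ => rfl⟩
  simp only [← hu]
  simp only [smul_eq_mul, ← hu] at hb3
  simp only [← hc] at hb1
  simp only [← hc, smul_eq_mul, ← hu] at hb2
  have hint : ∀ m j, Integrable (fun z => f z • iteratedFDeriv ℝ m l ((2 : ℝ) ^ j • (x - z))) σ := by
    intro m j
    obtain ⟨Cm, hCm, hdec⟩ := l.exists_iteratedFDeriv_decay 0 m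
    have hcont : Continuous (iteratedFDeriv ℝ m l) :=
      (l.smooth ⊤).continuous_iteratedFDeriv (by exact_mod_cast le_top)
    exact integrable_bdd_smul hf hf1 (φ := fun z => iteratedFDeriv ℝ m l ((2 : ℝ) ^ j • (x - z)))
      (hcont.comp (by fun_prop)) fun z => norm_le_of_decay hCm.le hdec _
  have hL : ∀ m, ∃ L, m ≤ n → Tendsto (fun J : ℕ =>
      ((2 : ℝ) ^ J) ^ (n - m) * ‖∑ j ∈ Finset.range J, T m j - L‖) atTop (𝓝 0) := by
    intro m
    rcases lt_trichotomy m n with hm | rfl | hm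
    · obtain ⟨L, hL⟩ := exists_tendsto_two_pow_mul_norm_sum_sub (T := T m) (d := n - m) (by omega) hA0 hA
        hC.le fun j => by
          rw [hT, norm_smul, Real.norm_of_nonneg (by positivity)]
          calc _ ≤ ((2 : ℝ) ^ j) ^ m * (C * (((2 ^ j) ^ n)⁻¹ * A j)) := by gcongr; exact hb1 m hm.le j
            _ = _ := by
              have : ((2 : ℝ) ^ j) ^ n = (2 ^ j) ^ m * (2 ^ j) ^ (n - m) := by
                rw [← pow_add]; congr 1; omega
              rw [this]; field_simp
      exact ⟨L, fun _ => hL⟩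
    · obtain ⟨L, hL⟩ := exists_tendsto_multilinear_of_coeff (S := fun J => ∑ j ∈ Finset.range J, T m j)
        fun I => by
          obtain ⟨L, hL⟩ := hconv I
          refine ⟨L, hL.congr fun J => ?_⟩
          rw [sum_apply]
          refine Finset.sum_congr rfl fun j _ => ?_
          rw [hT, smul_apply, hc, smul_eq_mul]
          congr 1
          exact (ContinuousMultilinearMap.apply ℝ (fun _ : Fin m => Euc m) ℝ
            (fun i => stdVec m (I i))).integral_comp_comm (hint m j)
      refine ⟨L, fun _ => ?_⟩
      simpa using (tendsto_iff_norm_sub_tendsto_zero.1 hL)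
    · exact ⟨0, fun h => by omega⟩
  choose L hL using hL
  obtain ⟨e, he⟩ : ∃ e : ℕ → ℝ, ∀ J, e J = C * (((2 : ℝ) ^ J)⁻¹ * ∑ j ∈ Finset.range J, 2 ^ j * A j) +
      ∑ m ∈ Finset.range (n + 1), 2 ^ n * (((2 : ℝ) ^ J) ^ (n - m) * ‖∑ j ∈ Finset.range J, T m j - L m‖) :=
    ⟨_, fun _ => rfl⟩
  have he0 : ∀ J, 0 ≤ e J := fun J => by
    rw [he]
    have : 0 ≤ ∑ j ∈ Finset.range J, 2 ^ j * A j :=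
      Finset.sum_nonneg fun j _ => mul_nonneg (by positivity) (hA0 j)
    positivity
  have hel : Tendsto e atTop (𝓝 0) := by
    rw [funext he]
    have h1 := (tendsto_two_pow_inv_mul_sum hA).const_mul C
    have h2 := tendsto_finsetSum (Finset.range (n + 1)) fun m hm =>
      (hL m (by simpa [Nat.lt_succ_iff] using hm)).const_mul ((2 : ℝ) ^ n)
    simpa using h1.add h2
  have hpoint : ∀ (J : ℕ) (r : ℝ), 0 < r → r ≤ (2 ^ J)⁻¹ → (2 ^ J)⁻¹ ≤ 2 * r → ∀ y ∈ ball x r,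
      ‖∑ j ∈ Finset.range J, u j y -
        ∑ m ∈ Finset.range (n + 1), ((m.factorial : ℝ)⁻¹ • L m) fun _ => y - x‖ ≤ e J * r ^ n := by
    intro J r hr hrJ hJr y hy
    have hyr : ‖y - x‖ ≤ r := (mem_ball_iff_norm.1 hy).le
    have hsplit : ∑ j ∈ Finset.range J, u j y -
        ∑ m ∈ Finset.range (n + 1), ((m.factorial : ℝ)⁻¹ • L m) (fun _ => y - x) =
        ∑ j ∈ Finset.range J, (u j y - ∑ m ∈ Finset.range (n + 1),
          (m.factorial : ℝ)⁻¹ * c m j (fun _ => (2 : ℝ) ^ j • (y - x))) +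
        ∑ m ∈ Finset.range (n + 1), (m.factorial : ℝ)⁻¹ *
          (∑ j ∈ Finset.range J, T m j - L m) (fun _ => y - x) := by
      have h1 : ∀ m j, c m j (fun _ => (2 : ℝ) ^ j • (y - x)) = T m j (fun _ => y - x) := fun m j => by
        rw [hT, smul_apply]
        simpa using (c m j).map_smul_univ (fun _ => (2 : ℝ) ^ j) (fun _ => y - x)
      simp only [h1, Finset.sum_sub_distrib, sub_apply, sum_apply, mul_sub, smul_apply, smul_eq_mul]
      rw [Finset.sum_comm]
      simp only [← Finset.mul_sum]
      ring
    have hfirst : ‖∑ j ∈ Finset.range J, (u j y - ∑ m ∈ Finset.range (n + 1),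
          (m.factorial : ℝ)⁻¹ * c m j (fun _ => (2 : ℝ) ^ j • (y - x)))‖ ≤
        C * (((2 : ℝ) ^ J)⁻¹ * ∑ j ∈ Finset.range J, 2 ^ j * A j) * r ^ n := by
      calc _ ≤ ∑ j ∈ Finset.range J, C * r ^ n * (2 ^ J)⁻¹ * (2 ^ j * A j) := by
            refine norm_sum_le_of_le _ fun j hj => ?_
            have hj' : j ≤ J := (Finset.mem_range.1 hj).le
            have h1 : 2 ^ j * ‖y - x‖ ≤ 1 := by
              calc (2 : ℝ) ^ j * ‖y - x‖ ≤ 2 ^ J * (2 ^ J)⁻¹ := by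
                    gcongr
                    · norm_num
                    · exact hyr.trans hrJ
                _ = 1 := mul_inv_cancel₀ (by positivity)
            refine (hb2 j y h1).trans ?_
            have := hA0 j
            calc C * (2 ^ j * ‖y - x‖) ^ (n + 1) * (((2 ^ j) ^ n)⁻¹ * A j)
                = C * (‖y - x‖ ^ n * ‖y - x‖) * (2 ^ j * A j) := by
                  rw [mul_pow, pow_succ ((2 : ℝ) ^ j), pow_succ ‖y - x‖]; field_simp
              _ ≤ C * (r ^ n * (2 ^ J)⁻¹) * (2 ^ j * A j) := by
                  gcongr
                  exact hyr.trans hrJ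
              _ = _ := by ring
        _ = _ := by rw [← Finset.mul_sum]; ring
    have hsecond : ‖∑ m ∈ Finset.range (n + 1), (m.factorial : ℝ)⁻¹ *
          (∑ j ∈ Finset.range J, T m j - L m) (fun _ => y - x)‖ ≤
        (∑ m ∈ Finset.range (n + 1),
          2 ^ n * (((2 : ℝ) ^ J) ^ (n - m) * ‖∑ j ∈ Finset.range J, T m j - L m‖)) * r ^ n := by
      rw [Finset.sum_mul]
      refine norm_sum_le_of_le _ fun m hm => ?_
      have hm' : m ≤ n := by simpa [Nat.lt_succ_iff] using hm
      have h1 : ‖(∑ j ∈ Finset.range J, T m j - L m) (fun _ => y - x)‖ ≤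
          ‖∑ j ∈ Finset.range J, T m j - L m‖ * r ^ m := by
        refine (ContinuousMultilinearMap.le_opNorm _ _).trans ?_
        rw [Finset.prod_const, Finset.card_univ, Fintype.card_fin]
        gcongr
      have h2 : r ^ m ≤ 2 ^ n * ((2 : ℝ) ^ J) ^ (n - m) * r ^ n := by
        have h3 : 1 ≤ 2 ^ J * (2 * r) := (inv_le_iff_one_le_mul₀' (by positivity)).1 hJr
        have h4 : 1 ≤ (2 ^ J * (2 * r)) ^ (n - m) := one_le_pow₀ h3
        calc r ^ m = r ^ m * 1 := (mul_one _).symm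
          _ ≤ r ^ m * (2 ^ J * (2 * r)) ^ (n - m) := by gcongr
          _ = 2 ^ (n - m) * ((2 : ℝ) ^ J) ^ (n - m) * (r ^ m * r ^ (n - m)) := by
              rw [mul_pow, mul_pow]; ring
          _ = 2 ^ (n - m) * ((2 : ℝ) ^ J) ^ (n - m) * r ^ n := by
              rw [← pow_add, Nat.add_sub_cancel' hm']
          _ ≤ _ := by
              gcongr
              · norm_num
              · omega
      rw [norm_mul, norm_inv, Real.norm_natCast]
      calc _ ≤ 1 * (‖∑ j ∈ Finset.range J, T m j - L m‖ * (2 ^ n * ((2 : ℝ) ^ J) ^ (n - m) * r ^ n)) := by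
            refine mul_le_mul (inv_le_one_of_one_le₀ ?_) (h1.trans (by gcongr)) (norm_nonneg _) zero_le_one
            exact_mod_cast Nat.one_le_iff_ne_zero.2 m.factorial_ne_zero
        _ = _ := by ring
    rw [hsplit, he, add_mul]
    exact (norm_add_le _ _).trans (add_le_add hfirst hsecond)
  have hp0 : 0 < p := by linarith
  refine TaylorLp.of_dyadic (P := fun y => ∑ m ∈ Finset.range (n + 1), ((m.factorial : ℝ)⁻¹ • L m) fun _ => y - x)
    (b := fun J => 2 ^ (p - 1) * (e J ^ p * (volume (ball (0 : Euc n) 1)).toReal +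
      C * 2 ^ n * (2 ^ n * A J) ^ p))
    (IsPolyDeg.sum _ fun m hm => isPolyDeg_diagonal _ x (by simpa [Nat.lt_succ_iff] using hm)) ?_
    fun J r hr hrJ hJr => ?_
  · have h1 := (hel.rpow_const (p := p) (Or.inr hp0.le)).mul_const (volume (ball (0 : Euc n) 1)).toReal
    have h2 := ((hA.const_mul ((2 : ℝ) ^ n)).rpow_const (p := p) (Or.inr hp0.le)).const_mul (C * 2 ^ n)
    simpa [Real.zero_rpow hp0.ne'] using (h1.add h2).const_mul ((2 : ℝ) ^ (p - 1))
  have hAJ := hA0 J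
  refine lintegral_ball_rpow_le_of_le_add (G := fun y => ∑' i : ℕ, ‖u (J + i) y‖ₑ) hp hr (he0 J)
    (fun y hy => ?_) ((hb3 J r hrJ).trans (ENNReal.ofReal_le_ofReal ?_)) (by positivity)
  · by_cases hfin : ∑' i : ℕ, ‖u (J + i) y‖ₑ = ∞
    · simp [hfin]
    have hs : Summable fun i => u (i + J) y := by
      have : Summable fun i => ‖u (J + i) y‖₊ := by
        rw [← ENNReal.tsum_coe_ne_top_iff_summable]; exact hfin
      refine Summable.of_nnnorm ?_
      simpa only [add_comm J] using this
    have hs' : Summable fun j => u j y := (summable_nat_add_iff J).1 hs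
    rw [← hs'.sum_add_tsum_nat_add J, add_sub_right_comm]
    refine (enorm_add_le _ _).trans (add_le_add ?_ ?_)
    · rw [← ofReal_norm]
      exact ENNReal.ofReal_le_ofReal (hpoint J r hr hrJ hJr y hy)
    · simp only [add_comm J]
      exact enorm_tsum_le_tsum_enorm
  · have h1 : ((2 : ℝ) ^ J) ^ n ≠ 0 := by positivity
    have h2 : (((2 : ℝ) ^ J) ^ n)⁻¹ ≤ 2 ^ n * r ^ n := by
      rw [← mul_pow, ← inv_pow]; gcongr
    have hrn : (r ^ n) ^ p * r ^ n = r ^ ((n : ℝ) + n * p) := by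
      rw [add_comm, Real.rpow_add hr, Real.rpow_mul hr.le, Real.rpow_natCast]
    calc C * ((2 ^ J) ^ n)⁻¹ * (((2 ^ J) ^ n)⁻¹ * A J) ^ p
        ≤ C * (2 ^ n * r ^ n) * ((2 ^ n * r ^ n) * A J) ^ p := by gcongr
      _ = C * (2 ^ n * r ^ n) * ((2 ^ n * A J) ^ p * (r ^ n) ^ p) := by
          rw [← Real.mul_rpow (by positivity) (by positivity)]; ring_nf
      _ = _ := by rw [← hrn]; ring

end CoreTheorem

section FourierL2

open scoped FourierTransform ContDiff

lemma fourierInv_comp_inv_smul {n : ℕ} (b : Euc n → ℂ) {c : ℝ} (hc : 0 < c) (x : Euc n) :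
    𝓕⁻ (fun ξ => b (c⁻¹ • ξ)) x = ((c ^ n : ℝ) : ℂ) * 𝓕⁻ b (c • x) := by
  rw [Real.fourierInv_eq', Real.fourierInv_eq']
  have := Measure.integral_comp_inv_smul (μ := (volume : Measure (Euc n)))
    (fun ξ => Complex.exp ((↑(2 * Real.pi * ⟪ξ, c • x⟫) * Complex.I)) • b ξ) c
  rw [finrank_euclideanSpace_fin, abs_of_pos (by positivity)] at this
  rw [← Complex.real_smul, ← this]
  congr 1 with ξ
  simp only [inner_smul_left, inner_smul_right, RCLike.conj_to_real]
  congr 5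
  field_simp

lemma integral_fourierInv_mul_Lp {n : ℕ} {b : Euc n → ℂ} (hb : ContDiff ℝ ∞ b)
    (hc : HasCompactSupport b) (g : Lp (α := Euc n) ℂ 2 volume) (x : Euc n) :
    ∫ y, 𝓕⁻ b (x - y) * g y =
      ∫ ξ, Complex.exp ((↑(2 * Real.pi * ⟪ξ, x⟫) * Complex.I)) * b ξ *
        (𝓕 g : Lp (α := Euc n) ℂ 2 volume) ξ := by
  set e : Euc n → ℂ := fun ξ => Complex.exp ((↑(2 * Real.pi * ⟪ξ, x⟫) * Complex.I)) with he
  have hed : ContDiff ℝ ∞ e := by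
    refine ContDiff.cexp ?_
    refine ContDiff.mul ?_ contDiff_const
    exact Complex.ofRealCLM.contDiff.comp (contDiff_const.mul (contDiff_id.inner ℝ contDiff_const))
  have hcd : ContDiff ℝ ∞ (fun ξ => starRingEnd ℂ (e ξ * b ξ)) :=
    Complex.conjCLE.contDiff.comp (hed.mul hb)
  have hcs : HasCompactSupport (fun ξ => starRingEnd ℂ (e ξ * b ξ)) :=
    (hc.mul_left (f := e)).comp_left (g := starRingEnd ℂ) (map_zero _)
  set c : 𝓢(Euc n, ℂ) := hcs.toSchwartzMap hcd with hcdef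
  have key := Lp.inner_fourier_eq (𝓕⁻ (c.toLp 2)) g
  rw [FourierTransform.fourier_fourierInv_eq, SchwartzMap.toLp_fourierInv_eq, L2.inner_def, L2.inner_def] at key
  have h1 : ∀ᵐ ξ, inner ℂ ((c.toLp 2 : Lp (α := Euc n) ℂ 2 volume) ξ) ((𝓕 g : Lp (α := Euc n) ℂ 2 volume) ξ) =
      e ξ * b ξ * (𝓕 g : Lp (α := Euc n) ℂ 2 volume) ξ := by
    filter_upwards [c.coeFn_toLp 2] with ξ hξ
    rw [hξ]
    simp [hcdef, mul_comm]
  have h2 : ∀ᵐ y, inner ℂ (((𝓕⁻ c).toLp 2 : Lp (α := Euc n) ℂ 2 volume) y) (g y) = 𝓕⁻ b (x - y) * g y := by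
    filter_upwards [(𝓕⁻ c).coeFn_toLp 2] with y hy
    rw [hy]
    have : (starRingEnd ℂ) ((𝓕⁻ c) y) = 𝓕⁻ b (x - y) := by
      rw [SchwartzMap.fourierInv_coe, Real.fourierInv_eq', Real.fourierInv_eq', ← integral_conj]
      congr 1 with ξ
      simp only [hcdef, HasCompactSupport.toSchwartzMap_toFun, smul_eq_mul, map_mul, Complex.conj_conj, he]
      rw [← Complex.exp_conj, ← mul_assoc, ← Complex.exp_add]
      congr 2
      simp only [map_mul, Complex.conj_ofReal, Complex.conj_I, inner_sub_right]
      push_cast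
      ring
    rw [← this]
    simp [mul_comm]
  rw [integral_congr_ae h1, integral_congr_ae h2] at key
  exact key.symm


lemma SchwartzMap.integrable_comp_smul_sub {n : ℕ} {F : Type*} [NormedAddCommGroup F] [NormedSpace ℝ F]
    (ψ : 𝓢(Euc n, F)) {s : ℝ} (hs : 0 < s) (x : Euc n) :
    Integrable (fun y => ψ (s • (x - y))) :=
  ((ψ.integrable (μ := volume)).comp_smul hs.ne').comp_sub_left x

lemma SchwartzMap.memLp_two_comp_smul_sub {n : ℕ} {F : Type*} [NormedAddCommGroup F] [NormedSpace ℝ F]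
    (ψ : 𝓢(Euc n, F)) {s : ℝ} (hs : 0 < s) (x : Euc n) :
    MemLp (fun y => ψ (s • (x - y))) 2 volume := by
  obtain ⟨C, hC0, hC⟩ := ψ.exists_decay (n + 1)
  have hcont : Continuous fun y => ψ (s • (x - y)) := ψ.continuous.comp (by fun_prop)
  refine (memLp_two_iff_integrable_sq_norm hcont.aestronglyMeasurable).2 ?_
  simp only [sq]
  exact (ψ.integrable_comp_smul_sub hs x).norm.mul_bdd (c := C) hcont.norm.aestronglyMeasurable
    (Eventually.of_forall fun y => by simpa using norm_le_of_decay hC0.le hC _)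

lemma ae_tendsto_integral_scaled {n : ℕ} {H : Euc n → ℂ} (hH : MemLp H 2 volume) (ψ : 𝓢(Euc n, ℂ)) :
    ∀ᵐ x, Tendsto (fun J : ℕ => ∫ y, (((2 ^ J : ℝ) ^ n : ℝ) : ℂ) * ψ ((2 : ℝ) ^ J • (x - y)) * H y) atTop
      (𝓝 ((∫ w, ψ w) * H x)) := by
  obtain ⟨C, hC0, hC⟩ := ψ.exists_decay (n + 1)
  have hloc : LocallyIntegrable H volume := hH.locallyIntegrable (by norm_num)
  have hsq : ∫⁻ z, ‖H z‖ₑ ^ (2 : ℝ) < ⊤ := by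
    have := lintegral_rpow_enorm_lt_top_of_eLpNorm_lt_top (p := 2) (by norm_num) (by norm_num) hH.2
    simpa using this
  have hb : ∃ A : ℝ, 0 ≤ A ∧ ∀ x r, 0 < r → ∫⁻ z in ball x r, ‖H z‖ₑ ≤ ENNReal.ofReal (A + A * r ^ n) := by
    refine ⟨(∫⁻ z, ‖H z‖ₑ ^ (2 : ℝ)).toReal + (volume (ball (0 : Euc n) 1)).toReal, by positivity, fun x r hr => ?_⟩
    calc ∫⁻ z in ball x r, ‖H z‖ₑ ≤ ∫⁻ z in ball x r, (‖H z‖ₑ ^ (2 : ℝ) + 1) := by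
          refine lintegral_mono fun z => ?_
          rcases le_total ‖H z‖ₑ 1 with h | h
          · exact h.trans le_add_self
          · exact ((ENNReal.rpow_one _).symm.le.trans
              (ENNReal.rpow_le_rpow_of_exponent_le h (by norm_num))).trans le_self_add
      _ = (∫⁻ z in ball x r, ‖H z‖ₑ ^ (2 : ℝ)) + volume (ball x r) := by
          rw [lintegral_add_right _ measurable_const, lintegral_const, one_mul,
            Measure.restrict_apply MeasurableSet.univ, Set.univ_inter]
      _ ≤ ENNReal.ofReal ((∫⁻ z, ‖H z‖ₑ ^ (2 : ℝ)).toReal) +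
            ENNReal.ofReal ((volume (ball (0 : Euc n) 1)).toReal * r ^ n) := by
          gcongr
          · rw [ENNReal.ofReal_toReal hsq.ne]
            exact setLIntegral_le_lintegral _ _
          · rw [volume_ball_euc x hr, ENNReal.ofReal_mul (by positivity),
              ENNReal.ofReal_toReal volume_unit_ball_lt_top.ne, mul_comm]
      _ ≤ _ := by
          rw [← ENNReal.ofReal_add (by positivity) (by positivity)]
          refine ENNReal.ofReal_le_ofReal ?_
          have h1 : 0 ≤ (∫⁻ z, ‖H z‖ₑ ^ (2 : ℝ)).toReal * r ^ n := by positivity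
          have h2 : 0 ≤ (volume (ball (0 : Euc n) 1)).toReal := by positivity
          nlinarith
  obtain ⟨A, hA, hb⟩ := hb
  filter_upwards [ae_vanishingDensity_sub hloc hA hb] with x hx
  obtain ⟨a, ha0, hat, ha⟩ := hx.exists_seq
  rw [tendsto_iff_norm_sub_tendsto_zero]
  refine squeeze_zero (fun _ => norm_nonneg _) (fun J => ?_) (g := fun J => C * a J)
    (by simpa using hat.const_mul C)
  obtain ⟨s, hs⟩ : ∃ s : ℝ, s = 2 ^ J := ⟨_, rfl⟩
  have hs0 : 0 < s := by rw [hs]; positivity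
  have hψi := ψ.integrable_comp_smul_sub hs0 x
  have hmass : ∫ y, ((s ^ n : ℝ) : ℂ) * ψ (s • (x - y)) = ∫ w, ψ w := by
    rw [integral_const_mul, integral_sub_left_eq_self (fun y => ψ (s • y)) volume x,
      Measure.integral_comp_smul, finrank_euclideanSpace_fin, abs_of_pos (by positivity), Complex.real_smul]
    have : s ^ n ≠ 0 := by positivity
    rw [← mul_assoc, ← Complex.ofReal_mul, mul_inv_cancel₀ this]
    simp
  have hψH : Integrable (fun y => ((s ^ n : ℝ) : ℂ) * ψ (s • (x - y)) * H y) := by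
    have h2 := ψ.memLp_two_comp_smul_sub hs0 x
    have := (h2.integrable_mul hH).const_mul (((s ^ n : ℝ) : ℂ))
    refine this.congr (Eventually.of_forall fun y => ?_)
    simp [mul_assoc]
  rw [← hs, ← hmass, ← integral_mul_const, ← integral_sub hψH ((hψi.const_mul _).mul_const _)]
  refine norm_le_of_enorm_le_lintegral hC0.le (ha0 J) (enorm_integral_le_lintegral_enorm _)
    (I' := ENNReal.ofReal (s ^ n) * ∫⁻ z, ENNReal.ofReal ((1 + 2 ^ J * ‖x - z‖) ^ (n + 1))⁻¹
      ∂(volume.withDensity fun z => ‖H z - H x‖ₑ)) ?_ ?_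
  · have h1 : ∫⁻ y, ‖((s ^ n : ℝ) : ℂ) * ψ (s • (x - y)) * H y - ((s ^ n : ℝ) : ℂ) * ψ (s • (x - y)) * H x‖ₑ =
        ENNReal.ofReal (s ^ n) * ∫⁻ y, ‖ψ (s • (x - y))‖ₑ ∂(volume.withDensity fun z => ‖H z - H x‖ₑ) := by
      have hm : AEMeasurable (fun z => ‖H z - H x‖ₑ) (volume : Measure (Euc n)) :=
        (hH.1.sub aestronglyMeasurable_const).enorm
      have hm2 : AEMeasurable (fun y => ‖ψ (s • (x - y))‖ₑ) (volume : Measure (Euc n)) :=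
        (ψ.continuous.comp (by fun_prop) : Continuous fun y => ψ (s • (x - y))).enorm.measurable.aemeasurable
      rw [lintegral_withDensity_eq_lintegral_mul₀ hm hm2, ← lintegral_const_mul'' _ (hm.mul hm2)]
      refine lintegral_congr fun y => ?_
      rw [← mul_sub, enorm_mul, enorm_mul, Pi.mul_apply, mul_comm ‖H y - H x‖ₑ, mul_assoc]
      congr 1
      rw [← ofReal_norm, Complex.norm_real, Real.norm_of_nonneg (by positivity)]
    rw [h1, mul_left_comm, hs]
    gcongr
    exact lintegral_enorm_scaled_le hC0.le hC _ J x
  · refine (mul_le_mul_right (ha J) _).trans ?_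
    rw [← hs, ← ENNReal.ofReal_mul (by positivity)]
    refine (ENNReal.ofReal_le_ofReal (le_of_eq ?_))
    field_simp

end FourierL2

section DyadicMultiplier

open scoped FourierTransform ContDiff

/-- A smooth cutoff equal to `1` on the unit ball and supported in the ball of radius `2`. -/
def IsCutoff (n : ℕ) (χ : Euc n → ℝ) : Prop :=
  ContDiff ℝ ∞ χ ∧ (∀ ξ ∈ ball (0 : Euc n) 1, χ ξ = 1) ∧ ∀ ξ, ξ ∉ ball (0 : Euc n) 2 → χ ξ = 0

lemma exists_isCutoff (n : ℕ) : ∃ χ, IsCutoff n χ := by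
  let b : ContDiffBump (0 : Euc n) := ⟨1, 2, one_pos, one_lt_two⟩
  exact ⟨b, b.contDiff, fun ξ hξ => b.one_of_mem_closedBall (ball_subset_closedBall hξ),
    fun ξ hξ => b.zero_of_le_dist (by simpa using hξ)⟩

variable {n : ℕ} {χ : Euc n → ℝ}

lemma IsCutoff.hasCompactSupport (h : IsCutoff n χ) : HasCompactSupport χ :=
  HasCompactSupport.intro (isCompact_closedBall (0 : Euc n) 2)
    fun ξ hξ => h.2.2 ξ fun h' => hξ (ball_subset_closedBall h')

lemma IsCutoff.contDiff_dyadic_smul {G : Type*} [NormedAddCommGroup G] [NormedSpace ℝ G]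
    (h : IsCutoff n χ) {m : Euc n → G} (hm : ∀ ξ, ξ ≠ 0 → ContDiffAt ℝ ∞ m ξ) :
    ContDiff ℝ ∞ fun ξ => (χ ((2 : ℝ)⁻¹ • ξ) - χ ξ) • m ξ := by
  rw [contDiff_iff_contDiffAt]
  intro ξ
  rcases eq_or_ne ξ 0 with rfl | hξ
  · refine (contDiffAt_const (c := (0 : G))).congr_of_eventuallyEq ?_
    filter_upwards [ball_mem_nhds (0 : Euc n) one_pos] with ξ hξ
    rw [h.2.1 ξ hξ, h.2.1 _ (by
      simp only [mem_ball_zero_iff, norm_smul, norm_inv, Real.norm_ofNat] at hξ ⊢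
      linarith [norm_nonneg ξ]), sub_self, zero_smul]
  · refine ContDiffAt.smul (ContDiff.contDiffAt ?_) (hm ξ hξ)
    exact (h.1.comp (contDiff_const_smul _)).sub h.1

lemma IsCutoff.hasCompactSupport_dyadic_smul {G : Type*} [NormedAddCommGroup G] [NormedSpace ℝ G]
    (h : IsCutoff n χ) (m : Euc n → G) :
    HasCompactSupport fun ξ => (χ ((2 : ℝ)⁻¹ • ξ) - χ ξ) • m ξ := by
  refine HasCompactSupport.intro (isCompact_closedBall (0 : Euc n) 4) fun ξ hξ => ?_
  have h4 : 4 < ‖ξ‖ := by simpa using hξ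
  rw [h.2.2 ξ (by simp only [mem_ball_zero_iff]; linarith), h.2.2 _ (by
    simp only [mem_ball_zero_iff, norm_smul, norm_inv, Real.norm_ofNat]; linarith), sub_self, zero_smul]

lemma IsCutoff.sum_dyadic_smul {G : Type*} [NormedAddCommGroup G] [NormedSpace ℝ G]
    (h : IsCutoff n χ) {m : Euc n → G} (hm : ∀ ξ, m ((2 : ℝ) • ξ) = m ξ) {J : ℕ} (hJ : 1 ≤ J) (ξ : Euc n) :
    ∑ j ∈ Finset.range J, (χ ((2 : ℝ)⁻¹ • (((2 : ℝ) ^ j)⁻¹ • ξ)) - χ (((2 : ℝ) ^ j)⁻¹ • ξ)) •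
      m (((2 : ℝ) ^ j)⁻¹ • ξ) = χ (((2 : ℝ) ^ J)⁻¹ • ξ) • (1 - χ ξ) • m ξ := by
  have hmj : ∀ j : ℕ, m (((2 : ℝ) ^ j)⁻¹ • ξ) = m ξ := by
    intro j
    induction j with
    | zero => simp
    | succ j ih =>
      rw [← ih, ← hm, smul_smul]
      congr 2
      field_simp
      ring
  have h1 : ∀ j : ℕ, (2 : ℝ)⁻¹ • (((2 : ℝ) ^ j)⁻¹ • ξ) = ((2 : ℝ) ^ (j + 1))⁻¹ • ξ := fun j => by
    rw [smul_smul, pow_succ, mul_inv, mul_comm]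
  simp only [hmj, h1, ← Finset.sum_smul]
  rw [Finset.sum_range_sub (fun j => χ (((2 : ℝ) ^ j)⁻¹ • ξ)), smul_smul]
  simp only [pow_zero, inv_one, one_smul]
  congr 1
  by_cases hξ : ξ ∈ ball (0 : Euc n) 2
  · have h2 : (2 : ℝ) ≤ 2 ^ J := le_self_pow₀ one_le_two (by omega)
    rw [h.2.1 (((2 : ℝ) ^ J)⁻¹ • ξ)]
    · ring
    · simp only [mem_ball_zero_iff, norm_smul, norm_inv, norm_pow, Real.norm_ofNat] at hξ ⊢
      rw [inv_mul_lt_iff₀ (by positivity)]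
      linarith
  · rw [h.2.2 ξ hξ]; ring

lemma HasCompactSupport.integrable_mul_mul_of_memLp_two {b : Euc n → ℂ} (hb : Continuous b) (hc : HasCompactSupport b)
    {e : Euc n → ℂ} (he : Continuous e) {g : Euc n → ℂ} (hg : MemLp g 2 volume) :
    Integrable (fun ξ => e ξ * b ξ * g ξ) := by
  have h1 : MemLp (fun ξ => e ξ * b ξ) 2 volume :=
    (he.mul hb).memLp_of_hasCompactSupport hc.mul_left
  exact h1.integrable_mul hg

theorem ae_tendsto_sum_dyadic_of_memLp (h : IsCutoff n χ) {m : Euc n → ℂ}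
    (hm : ∀ ξ, ξ ≠ 0 → ContDiffAt ℝ ∞ m ξ) (hm2 : ∀ ξ, m ((2 : ℝ) • ξ) = m ξ) {M : ℝ}
    (hmM : ∀ ξ, ‖m ξ‖ ≤ M) {θ : 𝓢(Euc n, ℝ)}
    (hθ : ∀ x, θ x = (𝓕⁻ (fun ξ => (χ ((2 : ℝ)⁻¹ • ξ) - χ ξ) • m ξ) x).re)
    {g : Euc n → ℝ} (hg : MemLp g 2 volume) :
    ∀ᵐ x, ∃ L, Tendsto (fun J => ∑ j ∈ Finset.range J, ((2 : ℝ) ^ j) ^ n *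
      ∫ z, g z * θ ((2 : ℝ) ^ j • (x - z))) atTop (𝓝 L) := by
  obtain ⟨D, hD⟩ : ∃ D : Euc n → ℂ, ∀ ξ, D ξ = (χ ((2 : ℝ)⁻¹ • ξ) - χ ξ) • m ξ := ⟨_, fun _ => rfl⟩
  have hDf := funext hD
  have hDs : ContDiff ℝ ∞ D := hDf ▸ h.contDiff_dyadic_smul hm
  have hDc : HasCompactSupport D := hDf ▸ h.hasCompactSupport_dyadic_smul m
  rw [← hDf] at hθ
  set DS := hDc.toSchwartzMap hDs with hDS
  have hFD : ∀ x, (𝓕⁻ DS) x = 𝓕⁻ D x := fun x => by rw [SchwartzMap.fourierInv_coe]; rfl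
  obtain ⟨X, hX⟩ : ∃ X : Euc n → ℂ, ∀ ξ, X ξ = (χ ξ : ℂ) := ⟨_, fun _ => rfl⟩
  have hXs : ContDiff ℝ ∞ X := by rw [funext hX]; exact Complex.ofRealCLM.contDiff.comp h.1
  have hXc : HasCompactSupport X := by
    rw [funext hX]; exact h.hasCompactSupport.comp_left (g := fun r : ℝ => (r : ℂ)) rfl
  set XS := hXc.toSchwartzMap hXs with hXS
  have hFX : ∀ x, (𝓕⁻ XS) x = 𝓕⁻ X x := fun x => by rw [SchwartzMap.fourierInv_coe]; rfl
  have hgC : MemLp (fun z => (g z : ℂ)) 2 volume := hg.ofReal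
  set G := hgC.toLp _ with hG
  obtain ⟨Gh, hGh⟩ : ∃ Gh : Lp (α := Euc n) ℂ 2 volume, Gh = 𝓕 G := ⟨_, rfl⟩
  obtain ⟨q, hq⟩ : ∃ q : Euc n → ℂ, ∀ ξ, q ξ = (1 - χ ξ) • m ξ := ⟨_, fun _ => rfl⟩
  have hqm : Measurable q := by
    have hmm : Measurable m := measurable_of_continuousOn_compl_singleton 0
      fun ξ hξ => (hm ξ hξ).continuousAt.continuousWithinAt
    rw [funext hq]
    exact (measurable_const.sub h.1.continuous.measurable).smul hmm
  obtain ⟨B, hB⟩ := h.hasCompactSupport.exists_bound_of_continuous h.1.continuous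
  have hqb : ∀ ξ, ‖q ξ‖ ≤ (1 + B) * M := fun ξ => by
    rw [hq, norm_smul]
    have : ‖1 - χ ξ‖ ≤ 1 + B := (norm_sub_le _ _).trans (by simpa using hB ξ)
    exact mul_le_mul this (hmM ξ) (norm_nonneg _) ((norm_nonneg _).trans this)
  have hqG : MemLp (fun ξ => q ξ * Gh ξ) 2 volume :=
    (Lp.memLp Gh).of_le_mul (c := (1 + B) * M) (hqm.aestronglyMeasurable.mul (Lp.aestronglyMeasurable Gh))
      (Eventually.of_forall fun ξ => by rw [norm_mul]; gcongr; exact hqb ξ)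
  set H : Lp (α := Euc n) ℂ 2 volume := 𝓕⁻ (hqG.toLp _) with hH
  have hFH : 𝓕 H = hqG.toLp _ := FourierTransform.fourier_fourierInv_eq _
  filter_upwards [ae_tendsto_integral_scaled (Lp.memLp H) (𝓕⁻ XS)] with x hx
  refine ⟨_, Tendsto.congr' ?_ (Complex.continuous_re.continuousAt.tendsto.comp hx)⟩
  filter_upwards [eventually_ge_atTop 1] with J hJ
  obtain ⟨e, he⟩ : ∃ e : Euc n → ℂ, ∀ ξ, e ξ = Complex.exp ((↑(2 * Real.pi * ⟪ξ, x⟫) * Complex.I)) :=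
    ⟨_, fun _ => rfl⟩
  have hec : Continuous e := by rw [funext he]; fun_prop
  have hsc : ∀ {b : Euc n → ℂ} (j : ℕ), ContDiff ℝ ∞ b → HasCompactSupport b →
      ContDiff ℝ ∞ (fun ξ => b (((2 : ℝ) ^ j)⁻¹ • ξ)) ∧
        HasCompactSupport (fun ξ => b (((2 : ℝ) ^ j)⁻¹ • ξ)) := fun j hb hc =>
    ⟨hb.comp (contDiff_const_smul _), hc.comp_smul (by positivity)⟩
  have hterm : ∀ {b : Euc n → ℂ} (j : ℕ), ContDiff ℝ ∞ b → HasCompactSupport b →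
      ∀ K : Lp (α := Euc n) ℂ 2 volume,
      ∫ y, ((((2 : ℝ) ^ j) ^ n : ℝ) : ℂ) * 𝓕⁻ b ((2 : ℝ) ^ j • (x - y)) * K y =
        ∫ ξ, e ξ * b (((2 : ℝ) ^ j)⁻¹ • ξ) * (𝓕 K : Lp (α := Euc n) ℂ 2 volume) ξ := by
    intro b j hb hc K
    simp only [he]
    rw [← integral_fourierInv_mul_Lp (hsc j hb hc).1 (hsc j hb hc).2 K x]
    simp_rw [fourierInv_comp_inv_smul b (show (0 : ℝ) < 2 ^ j by positivity)]
  have hterm2 : ∀ j : ℕ, ((2 : ℝ) ^ j) ^ n * ∫ z, g z * θ ((2 : ℝ) ^ j • (x - z)) =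
      (∫ y, ((((2 : ℝ) ^ j) ^ n : ℝ) : ℂ) * 𝓕⁻ D ((2 : ℝ) ^ j • (x - y)) * G y).re := by
    intro j
    have hi : Integrable fun y => ((((2 : ℝ) ^ j) ^ n : ℝ) : ℂ) * 𝓕⁻ D ((2 : ℝ) ^ j • (x - y)) * G y := by
      have h1 := (((𝓕⁻ DS).memLp_two_comp_smul_sub (show (0 : ℝ) < 2 ^ j by positivity) x).integrable_mul
        (Lp.memLp G)).const_mul ((((2 : ℝ) ^ j) ^ n : ℝ) : ℂ)
      refine h1.congr (Eventually.of_forall fun y => ?_)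
      simp only [Pi.mul_apply, hFD, mul_assoc]
    rw [← integral_const_mul]
    have := integral_re hi
    simp only [RCLike.re_to_complex] at this
    rw [← this]
    refine integral_congr_ae ?_
    filter_upwards [hgC.coeFn_toLp] with y hy
    rw [hy, mul_assoc, Complex.re_ofReal_mul, Complex.re_mul_ofReal, hθ, mul_comm (g y)]
  simp only [Function.comp_apply, hterm2]
  rw [← Complex.re_sum]
  congr 1
  simp only [hterm _ hDs hDc, hFX]
  rw [hterm _ hXs hXc, hFH, ← hGh, ← integral_finsetSum]
  · refine integral_congr_ae ?_
    filter_upwards [hqG.coeFn_toLp] with ξ hξ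
    rw [hξ, ← Finset.sum_mul, ← Finset.mul_sum]
    simp only [hD]
    rw [h.sum_dyadic_smul hm2 hJ, hX, hq]
    simp only [Complex.real_smul]
    ring
  · intro j _
    exact HasCompactSupport.integrable_mul_mul_of_memLp_two (hsc j hDs hDc).1.continuous (hsc j hDs hDc).2 hec (Lp.memLp _)

end DyadicMultiplier

section DyadicMeasure

variable {n : ℕ}

/-- The dyadic sums `∑_{j < J} 2^{jn} θ(2^j ·) ∗ μ` converge at `x`. -/
def DyadicConvAt (θ : Euc n → ℝ) (μ : Measure (Euc n)) (x : Euc n) : Prop :=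
  ∃ L, Tendsto (fun J => ∑ j ∈ Finset.range J, ((2 : ℝ) ^ j) ^ n *
    ∫ z, θ ((2 : ℝ) ^ j • (x - z)) ∂μ) atTop (𝓝 L)

lemma integrable_scaled_sub (θ : 𝓢(Euc n, ℝ)) (μ : Measure (Euc n)) [IsFiniteMeasure μ] (s : ℝ) (x : Euc n) :
    Integrable (fun z => θ (s • (x - z))) μ := by
  obtain ⟨C, hC0, hC⟩ := θ.exists_decay 0
  refine Integrable.of_bound (C := C) ?_ (Eventually.of_forall fun z => norm_le_of_decay hC0.le hC _)
  exact (θ.continuous.comp (by fun_prop : Continuous fun z => s • (x - z))).aestronglyMeasurable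

lemma DyadicConvAt.add {θ : 𝓢(Euc n, ℝ)} {μ ν : Measure (Euc n)} [IsFiniteMeasure μ] [IsFiniteMeasure ν]
    {x : Euc n} (h1 : DyadicConvAt θ μ x) (h2 : DyadicConvAt θ ν x) : DyadicConvAt θ (μ + ν) x := by
  obtain ⟨L1, h1⟩ := h1
  obtain ⟨L2, h2⟩ := h2
  refine ⟨L1 + L2, (h1.add h2).congr fun J => ?_⟩
  rw [← Finset.sum_add_distrib]
  refine Finset.sum_congr rfl fun j _ => ?_
  rw [integral_add_measure (integrable_scaled_sub _ _ _ _) (integrable_scaled_sub _ _ _ _), mul_add]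

variable {θ : 𝓢(Euc n, ℝ)}

lemma ae_dyadicConvAt_of_le_smul
    (hθ : ∀ g : Euc n → ℝ, MemLp g 2 volume → ∀ᵐ x, ∃ L, Tendsto (fun J => ∑ j ∈ Finset.range J,
      ((2 : ℝ) ^ j) ^ n * ∫ z, g z * θ ((2 : ℝ) ^ j • (x - z))) atTop (𝓝 L))
    {μ : Measure (Euc n)} [IsFiniteMeasure μ] {C : ℝ≥0∞} (hC : C ≠ ⊤) (hμ : μ ≤ C • volume) :
    ∀ᵐ x, DyadicConvAt θ μ x := by
  have hac : μ ≪ volume := (Measure.absolutelyContinuous_of_le hμ).trans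
    (Measure.smul_absolutelyContinuous)
  have hb : ∀ᵐ z, μ.rnDeriv volume z ≤ C := by
    refine ae_le_of_forall_setLIntegral_le_of_sigmaFinite (Measure.measurable_rnDeriv _ _) fun s hs _ => ?_
    rw [Measure.setLIntegral_rnDeriv hac, lintegral_const, Measure.restrict_apply_univ]
    exact hμ s
  have hg : MemLp (fun z => (μ.rnDeriv volume z).toReal) 2 volume := by
    have h1 : Integrable (fun z => (μ.rnDeriv volume z).toReal) := Measure.integrable_toReal_rnDeriv
    refine (memLp_two_iff_integrable_sq h1.1).2 ?_
    simp only [sq]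
    refine h1.mul_bdd (c := C.toReal) h1.1 ?_
    filter_upwards [hb] with z hz
    rw [Real.norm_of_nonneg ENNReal.toReal_nonneg]
    exact ENNReal.toReal_mono hC hz
  filter_upwards [hθ _ hg] with x hx
  obtain ⟨L, hL⟩ := hx
  refine ⟨L, hL.congr fun J => ?_⟩
  refine Finset.sum_congr rfl fun j _ => ?_
  congr 1
  exact integral_rnDeriv_smul hac

/-- The set of points where the density of `ν` is at most `L` at every scale. -/
def lowDensity (ν : Measure (Euc n)) (L : ℝ≥0∞) : Set (Euc n) :=
  {x | ∀ r, 0 < r → ν (closedBall x r) ≤ L * volume (closedBall x r)}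

lemma isClosed_lowDensity (ν : Measure (Euc n)) {L : ℝ≥0∞} (hL : L ≠ ⊤) : IsClosed (lowDensity ν L) := by
  refine isClosed_of_closure_subset fun x hx r hr => ?_
  have h1 : ∀ ε : ℝ, 0 < ε → ν (closedBall x r) ≤
      L * (ENNReal.ofReal ((r + ε) ^ n) * volume (ball (0 : Euc n) 1)) := by
    intro ε hε
    obtain ⟨y, hy, hxy⟩ := Metric.mem_closure_iff.1 hx ε hε
    have := hy (r + ε) (by positivity)
    rw [volume_closedBall_euc _ (by positivity)] at this
    exact (measure_mono (closedBall_subset_closedBall' (by linarith))).trans this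
  have h2 : Tendsto (fun ε : ℝ => L * (ENNReal.ofReal ((r + ε) ^ n) * volume (ball (0 : Euc n) 1)))
      (𝓝[>] 0) (𝓝 (L * volume (closedBall x r))) := by
    rw [volume_closedBall_euc _ hr.le]
    refine ENNReal.Tendsto.const_mul (ENNReal.Tendsto.mul_const ?_ (Or.inr volume_unit_ball_lt_top.ne)) (Or.inr hL)
    refine ENNReal.tendsto_ofReal (Tendsto.mono_left ?_ nhdsWithin_le_nhds)
    have : Continuous fun ε : ℝ => (r + ε) ^ n := by fun_prop
    simpa using this.tendsto 0
  exact ge_of_tendsto h2 (eventually_mem_nhdsWithin.mono fun ε hε => h1 ε hε)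

lemma restrict_lowDensity_le (ν : Measure (Euc n)) [IsFiniteMeasure ν] {L : ℝ≥0∞} (hL : L ≠ ⊤) :
    ν.restrict (lowDensity ν L) ≤ L • volume := by
  have hloc : IsLocallyFiniteMeasure (L • (volume : Measure (Euc n))) := by
    lift L to NNReal using hL
    exact inferInstanceAs (IsLocallyFiniteMeasure (L • (volume : Measure (Euc n))))
  refine Measure.le_iff.2 fun s hs => ?_
  rw [Measure.restrict_apply hs]
  refine le_trans ?_ (measure_mono Set.inter_subset_left : (L • volume) (s ∩ lowDensity ν L) ≤ _)
  refine (Besicovitch.vitaliFamily ν).measure_le_of_frequently_le (L • volume) Measure.AbsolutelyContinuous.rfl _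
    fun x hx => ?_
  refine (Besicovitch.tendsto_filterAt ν x).frequently (Eventually.frequently ?_)
  exact eventually_mem_nhdsWithin.mono fun r hr => hx.2 r hr

lemma ae_exists_mem_lowDensity (ν : Measure (Euc n)) [IsFiniteMeasure ν] :
    ∀ᵐ x, ∃ N : ℕ, x ∈ lowDensity ν N := by
  filter_upwards [Besicovitch.ae_tendsto_rnDeriv ν (volume : Measure (Euc n)), ν.rnDeriv_lt_top volume] with x hx hlt
  obtain ⟨N1, hN1⟩ := ENNReal.exists_nat_gt hlt.ne
  have h1 := hx.eventually_lt_const hN1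
  obtain ⟨δ, hδ, hδ'⟩ := mem_nhdsGT_iff_exists_Ioo_subset.1 h1
  have hδ : 0 < δ := hδ
  have hvpos : 0 < volume (closedBall x (δ / 2)) := measure_closedBall_pos _ _ (by positivity)
  obtain ⟨N2, hN2⟩ := ENNReal.exists_nat_gt (ENNReal.div_ne_top (measure_ne_top ν Set.univ) hvpos.ne')
  refine ⟨N1 + N2, fun r hr => ?_⟩
  have hvr : 0 < volume (closedBall x r) := measure_closedBall_pos _ _ hr
  rcases lt_or_ge r δ with h | h
  · have := hδ' ⟨hr, h⟩
    have := (ENNReal.div_lt_iff (Or.inl hvr.ne') (Or.inl measure_closedBall_lt_top.ne)).1 this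
    refine this.le.trans ?_
    gcongr
    exact le_self_add
  · have := (ENNReal.div_lt_iff (Or.inl hvpos.ne') (Or.inl measure_closedBall_lt_top.ne)).1 hN2
    refine (measure_mono (Set.subset_univ _)).trans (this.le.trans ?_)
    push_cast
    gcongr
    · exact le_add_self
    · linarith

end DyadicMeasure

section SmoothnessKernel

variable {n : ℕ}

lemma SchwartzMap.exists_lintegral_sub_le (θ : 𝓢(Euc n, ℝ)) :
    ∃ C : ℝ, 0 ≤ C ∧ ∀ (t : ℝ) (e : Euc n), 0 < t → ‖e‖ ≤ t / 2 →
      ∫⁻ w in {w : Euc n | t ≤ ‖w‖}, ‖θ w - θ (w + e)‖ₑ ≤ ENNReal.ofReal (C * (t / (1 + t) ^ 2)) := by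
  obtain ⟨C1, hC1, h1⟩ := θ.exists_iteratedFDeriv_decay (n + 3) 1
  set I := ∫⁻ y : Euc n, ENNReal.ofReal ((1 + ‖y‖) ^ (n + 1))⁻¹ with hI
  have hIt : I ≠ ⊤ := (lintegral_one_add_norm_lt_top n).ne
  refine ⟨C1 * 2 ^ (n + 3) * I.toReal, by positivity, fun t e ht he => ?_⟩
  have hpt : ∀ w : Euc n, t ≤ ‖w‖ → ‖θ w - θ (w + e)‖ₑ ≤
      ENNReal.ofReal (C1 * 2 ^ (n + 3) * (t / (1 + t) ^ 2)) * ENNReal.ofReal ((1 + ‖w‖) ^ (n + 1))⁻¹ := by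
    intro w hw
    refine enorm_le_ofReal_mul_ofReal (by positivity) ?_
    have hd : ∀ v ∈ closedBall w (t / 2), ‖fderiv ℝ θ v‖ ≤ C1 * 2 ^ (n + 3) * ((1 + ‖w‖) ^ (n + 3))⁻¹ := by
      intro v hv
      rw [← norm_iteratedFDeriv_one]
      refine (h1 v).trans ?_
      rw [mul_assoc]
      gcongr
      have : ‖w‖ ≤ ‖v‖ + t / 2 := by
        have h2 := norm_le_norm_add_norm_sub v w
        rw [mem_closedBall, dist_eq_norm] at hv
        rw [norm_sub_rev] at hv
        linarith [norm_sub_rev v w]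
      have h3 : 1 + ‖w‖ ≤ 2 * (1 + ‖v‖) := by linarith
      rw [inv_le_iff_one_le_mul₀ (by positivity), mul_right_comm, ← mul_pow, le_mul_inv_iff₀ (by positivity), one_mul]
      gcongr
    have hmv := (convex_closedBall w (t / 2)).norm_image_sub_le_of_norm_fderiv_le
      (f := θ) (𝕜 := ℝ) (fun v _ => θ.differentiableAt) hd
      (x := w + e) (y := w) (by simpa using he) (mem_closedBall_self (by positivity))
    refine hmv.trans ?_
    rw [sub_add_cancel_left, norm_neg]
    have h4 : ((1 + ‖w‖) ^ (n + 3))⁻¹ ≤ ((1 + t) ^ 2)⁻¹ * ((1 + ‖w‖) ^ (n + 1))⁻¹ := by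
      rw [← mul_inv]
      refine inv_anti₀ (by positivity) ?_
      rw [show (1 + ‖w‖) ^ (n + 3) = (1 + ‖w‖) ^ 2 * (1 + ‖w‖) ^ (n + 1) by ring]
      gcongr
    calc C1 * 2 ^ (n + 3) * ((1 + ‖w‖) ^ (n + 3))⁻¹ * ‖e‖
        ≤ C1 * 2 ^ (n + 3) * (((1 + t) ^ 2)⁻¹ * ((1 + ‖w‖) ^ (n + 1))⁻¹) * t := by
          gcongr
          linarith
      _ = _ := by ring
  have hms : MeasurableSet {w : Euc n | t ≤ ‖w‖} := measurableSet_le measurable_const measurable_norm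
  calc ∫⁻ w in {w : Euc n | t ≤ ‖w‖}, ‖θ w - θ (w + e)‖ₑ
      ≤ ∫⁻ w in {w : Euc n | t ≤ ‖w‖}, ENNReal.ofReal (C1 * 2 ^ (n + 3) * (t / (1 + t) ^ 2)) *
          ENNReal.ofReal ((1 + ‖w‖) ^ (n + 1))⁻¹ := setLIntegral_mono' hms hpt
    _ ≤ ENNReal.ofReal (C1 * 2 ^ (n + 3) * (t / (1 + t) ^ 2)) * I := by
        rw [lintegral_const_mul' _ _ ENNReal.ofReal_ne_top]
        gcongr
        exact setLIntegral_le_lintegral _ _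
    _ = _ := by
        nth_rewrite 1 [← ENNReal.ofReal_toReal hIt]
        rw [← ENNReal.ofReal_mul (by positivity)]
        congr 1
        ring

lemma tsum_dyadic_div_le {t : ℝ} (ht : 0 < t) :
    ∑' j : ℕ, ENNReal.ofReal (2 ^ j * t / (1 + 2 ^ j * t) ^ 2) ≤ 2 := by
  refine ENNReal.tsum_le_of_sum_range_le fun J => ?_
  rw [← ENNReal.ofReal_sum_of_nonneg fun j _ => by positivity]
  rw [show (2 : ℝ≥0∞) = ENNReal.ofReal 2 by simp]
  refine ENNReal.ofReal_le_ofReal ?_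
  have h : ∀ J : ℕ, ∑ j ∈ Finset.range J, 2 ^ j * t / (1 + 2 ^ j * t) ^ 2 ≤
      2 * (2 ^ J * t / (1 + 2 ^ J * t)) := by
    intro J
    induction J with
    | zero => simp only [Finset.range_zero, Finset.sum_empty]; positivity
    | succ J ih =>
      rw [Finset.sum_range_succ]
      obtain ⟨s, hs⟩ : ∃ s, s = 2 ^ J * t := ⟨_, rfl⟩
      have hs0 : 0 < s := by rw [hs]; positivity
      rw [show (2 : ℝ) ^ (J + 1) * t = 2 * s by rw [hs]; ring, ← hs]
      rw [← hs] at ih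
      have : s / (1 + s) ^ 2 ≤ 2 * (2 * s / (1 + 2 * s)) - 2 * (s / (1 + s)) := by
        have : 2 * (2 * s / (1 + 2 * s)) - 2 * (s / (1 + s)) = 2 * s / ((1 + 2 * s) * (1 + s)) := by
          field_simp; ring
        rw [this, div_le_div_iff₀ (by positivity) (by positivity)]
        nlinarith [mul_pos hs0 hs0, mul_pos (mul_pos hs0 hs0) hs0]
      linarith
  refine (h J).trans ?_
  have : 2 ^ J * t / (1 + 2 ^ J * t) ≤ 1 := by
    rw [div_le_one (by positivity)]; linarith
  linarith

lemma SchwartzMap.exists_tsum_lintegral_sub_le (θ : 𝓢(Euc n, ℝ)) :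
    ∃ C : ℝ≥0∞, C ≠ ⊤ ∧ ∀ (F : Set (Euc n)) (y z : Euc n) (d : ℝ), MeasurableSet F → 0 < d →
      (∀ x ∈ F, d ≤ ‖x - y‖) → ‖z - y‖ ≤ d / 2 →
      ∑' j : ℕ, ∫⁻ x in F, ENNReal.ofReal (((2 : ℝ) ^ j) ^ n) *
        ‖θ ((2 : ℝ) ^ j • (x - y)) - θ ((2 : ℝ) ^ j • (x - z))‖ₑ ≤ C := by
  obtain ⟨C, hC0, hC⟩ := θ.exists_lintegral_sub_le
  refine ⟨ENNReal.ofReal C * 2, ENNReal.mul_ne_top ENNReal.ofReal_ne_top (by simp),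
    fun F y z d hF hd hFd hyz => ?_⟩
  refine le_trans ?_ (mul_le_mul_right (tsum_dyadic_div_le hd) _)
  rw [← ENNReal.tsum_mul_left]
  refine ENNReal.tsum_le_tsum fun j => ?_
  obtain ⟨s, hs⟩ : ∃ s : ℝ, s = 2 ^ j := ⟨_, rfl⟩
  have hs0 : 0 < s := by rw [hs]; positivity
  rw [← hs, ← ENNReal.ofReal_mul hC0]
  refine le_trans ?_ (hC (s * d) (s • (y - z)) (by positivity) ?_)
  · rw [lintegral_const_mul' _ _ ENNReal.ofReal_ne_top]
    have hms : MeasurableSet {w : Euc n | s * d ≤ ‖w‖} := measurableSet_le measurable_const measurable_norm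
    set Φ : Euc n → ℝ≥0∞ := fun w => {w : Euc n | s * d ≤ ‖w‖}.indicator
      (fun w => ‖θ w - θ (w + s • (y - z))‖ₑ) w with hΦ
    have h1 : ∫⁻ x in F, ‖θ (s • (x - y)) - θ (s • (x - z))‖ₑ ≤ ∫⁻ x, Φ (s • (x - y)) := by
      refine (setLIntegral_mono' hF fun x hx => ?_).trans (setLIntegral_le_lintegral F _)
      rw [hΦ]
      simp only
      rw [Set.indicator_of_mem]
      · rw [← smul_add, sub_add_sub_cancel]
      · simp only [Set.mem_ofPred_eq, norm_smul, Real.norm_of_nonneg hs0.le]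
        gcongr
        exact hFd x hx
    rw [lintegral_sub_right_eq_self (fun x => Φ (s • x)) y, lintegral_comp_smul_euc Φ hs0, hΦ,
      lintegral_indicator hms] at h1
    refine (mul_le_mul_right h1 _).trans ?_
    rw [← mul_assoc, ← ENNReal.ofReal_mul (by positivity), mul_inv_cancel₀ (by positivity),
      ENNReal.ofReal_one, one_mul]
  · rw [norm_smul, Real.norm_of_nonneg hs0.le, norm_sub_rev, mul_div_assoc]
    gcongr

end SmoothnessKernel

section CalderonZygmund

variable {n : ℕ}

/-- The averaging kernel spreading a unit mass at `y` over the ball of radius `infDist y F / 2`. -/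
noncomputable def spreadKernel (F : Set (Euc n)) (q : Euc n × Euc n) : ℝ≥0∞ :=
  {q : Euc n × Euc n | dist q.2 q.1 < infDist q.1 F / 2}.indicator
    (fun q => (ENNReal.ofReal ((infDist q.1 F / 2) ^ n) * volume (ball (0 : Euc n) 1))⁻¹) q

/-- The measure `ν` coupled with its spread-out version away from `F`. -/
noncomputable def spreadCoupling (F : Set (Euc n)) (ν : Measure (Euc n)) : Measure (Euc n × Euc n) :=
  (ν.prod volume).withDensity (spreadKernel F)

lemma measurableSet_spread (F : Set (Euc n)) :
    MeasurableSet {q : Euc n × Euc n | dist q.2 q.1 < infDist q.1 F / 2} := by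
  refine (isOpen_lt (by fun_prop) ?_).measurableSet
  exact ((continuous_infDist_pt F).comp continuous_fst).div_const 2

lemma measurable_spreadKernel (F : Set (Euc n)) : Measurable (spreadKernel F) := by
  refine Measurable.indicator ?_ (measurableSet_spread F)
  refine Measurable.inv (Measurable.mul_const (ENNReal.measurable_ofReal.comp ?_) _)
  exact ((((continuous_infDist_pt F).comp continuous_fst).div_const 2).pow n).measurable

lemma lintegral_spreadKernel {F : Set (Euc n)} (hF : IsClosed F) (hne : F.Nonempty) (y : Euc n) :
    ∫⁻ z, spreadKernel F (y, z) = Fᶜ.indicator 1 y := by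
  have h1 : ∀ z, spreadKernel F (y, z) = (ball y (infDist y F / 2)).indicator
      (fun _ => (ENNReal.ofReal ((infDist y F / 2) ^ n) * volume (ball (0 : Euc n) 1))⁻¹) z := fun z => rfl
  simp only [h1]
  rw [lintegral_indicator measurableSet_ball, lintegral_const, Measure.restrict_apply_univ]
  by_cases hy : y ∈ F
  · simp [infDist_zero_of_mem hy, hy]
  · have hd : 0 < infDist y F := (hF.notMem_iff_infDist_pos hne).1 hy
    rw [Set.indicator_of_mem (by exact hy), volume_ball_euc y (show 0 < infDist y F / 2 by positivity), Pi.one_apply]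
    refine ENNReal.inv_mul_cancel ?_ ?_
    · exact mul_ne_zero (ENNReal.ofReal_pos.2 (by positivity)).ne' volume_unit_ball_pos.ne'
    · exact ENNReal.mul_ne_top ENNReal.ofReal_ne_top volume_unit_ball_lt_top.ne

lemma lintegral_spreadKernel_left_le {ν : Measure (Euc n)} {L : ℝ≥0∞} (hL : L ≠ ⊤)
    (hne : (lowDensity ν L).Nonempty) (z : Euc n) :
    ∫⁻ y, spreadKernel (lowDensity ν L) (y, z) ∂ν ≤ ENNReal.ofReal (6 ^ n) * L := by
  obtain ⟨F, hFdef⟩ : ∃ F, F = lowDensity ν L := ⟨_, rfl⟩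
  have hF : IsClosed F := hFdef ▸ isClosed_lowDensity ν hL
  rw [← hFdef] at hne ⊢
  obtain ⟨x0, hx0, hzx0⟩ := hF.exists_infDist_eq_dist hne z
  obtain ⟨D, hD⟩ : ∃ D, D = infDist z F := ⟨_, rfl⟩
  have hlip : ∀ y, infDist y F ≤ infDist z F + dist z y := fun y => by
    rw [dist_comm]; exact infDist_le_infDist_add_dist
  have hlip' : ∀ y, infDist z F ≤ infDist y F + dist z y := fun y => infDist_le_infDist_add_dist
  rcases (infDist_nonneg (x := z) (s := F)).eq_or_lt with h0 | hpos
  · refine le_trans (le_of_eq ?_) zero_le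
    refine (lintegral_congr fun y => ?_).trans lintegral_zero
    refine Set.indicator_of_notMem (fun h => ?_) _
    have h : dist z y < infDist y F / 2 := h
    have := hlip y
    have := dist_nonneg (x := z) (y := y)
    linarith
  · rw [← hD] at hpos hzx0
    have h1 : ∀ y, spreadKernel F (y, z) ≤ (closedBall x0 (2 * D)).indicator
        (fun _ => (ENNReal.ofReal ((D / 3) ^ n) * volume (ball (0 : Euc n) 1))⁻¹) y := by
      intro y
      by_cases h : dist z y < infDist y F / 2
      · have h2 := hlip y
        have h3 := hlip' y
        rw [← hD] at h2 h3
        rw [spreadKernel, Set.indicator_of_mem (by exact h), Set.indicator_of_mem]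
        · have h4 : D / 3 ≤ infDist y F / 2 := by linarith
          exact ENNReal.inv_le_inv.2 (mul_le_mul_left
            (ENNReal.ofReal_le_ofReal (pow_le_pow_left₀ (by positivity) h4 n)) _)
        · rw [mem_closedBall]
          have := dist_triangle y z x0
          rw [dist_comm y z] at this
          linarith
      · rw [spreadKernel, Set.indicator_of_notMem (by exact h)]
        exact zero_le
    refine (lintegral_mono h1).trans ?_
    rw [lintegral_indicator measurableSet_closedBall, lintegral_const, Measure.restrict_apply_univ]
    have h4 := (hFdef ▸ hx0 : x0 ∈ lowDensity ν L) (2 * D) (by positivity)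
    rw [volume_closedBall_euc _ (by positivity)] at h4
    refine (mul_le_mul_right h4 _).trans (le_of_eq ?_)
    have h5 : ENNReal.ofReal ((2 * D) ^ n) = ENNReal.ofReal (6 ^ n) * ENNReal.ofReal ((D / 3) ^ n) := by
      rw [← ENNReal.ofReal_mul (by positivity), ← mul_pow]
      congr 2
      ring
    obtain ⟨X, hX⟩ : ∃ X, X = ENNReal.ofReal ((D / 3) ^ n) * volume (ball (0 : Euc n) 1) := ⟨_, rfl⟩
    have hX0 : X ≠ 0 := by
      rw [hX]
      exact mul_ne_zero (ENNReal.ofReal_pos.2 (by positivity)).ne' volume_unit_ball_pos.ne'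
    have hXt : X ≠ ⊤ := by
      rw [hX]
      exact ENNReal.mul_ne_top ENNReal.ofReal_ne_top volume_unit_ball_lt_top.ne
    rw [h5, mul_assoc (ENNReal.ofReal (6 ^ n)), ← hX, mul_left_comm L, mul_left_comm X⁻¹, mul_comm L,
      ← mul_assoc X⁻¹, ENNReal.inv_mul_cancel hX0 hXt, one_mul]

lemma lintegral_spreadCoupling (F : Set (Euc n)) (ν : Measure (Euc n)) [IsFiniteMeasure ν]
    {f : Euc n × Euc n → ℝ≥0∞} (hf : Measurable f) :
    ∫⁻ q, f q ∂(spreadCoupling F ν) = ∫⁻ y, (∫⁻ z, spreadKernel F (y, z) * f (y, z)) ∂ν := by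
  rw [spreadCoupling, lintegral_withDensity_eq_lintegral_mul _ (measurable_spreadKernel F) hf,
    lintegral_prod _ ((measurable_spreadKernel F).mul hf).aemeasurable]
  simp only [Pi.mul_apply]

lemma map_fst_spreadCoupling {F : Set (Euc n)} (hF : IsClosed F) (hne : F.Nonempty) (ν : Measure (Euc n))
    [IsFiniteMeasure ν] : (spreadCoupling F ν).map Prod.fst = ν.restrict Fᶜ := by
  ext s hs
  have h0 : Measurable (s.indicator (1 : Euc n → ℝ≥0∞)) := measurable_one.indicator hs
  rw [← lintegral_indicator_one hs, lintegral_map h0 measurable_fst,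
    lintegral_spreadCoupling F ν (f := fun q => s.indicator 1 q.1) (h0.comp measurable_fst), ← lintegral_indicator_one hs]
  rw [← lintegral_indicator hF.measurableSet.compl]
  refine lintegral_congr fun y => ?_
  have hK : Measurable fun z => spreadKernel F (y, z) :=
    (measurable_spreadKernel F).comp measurable_prodMk_left
  simp only
  rw [lintegral_mul_const _ hK, lintegral_spreadKernel hF hne]
  by_cases hy : y ∈ Fᶜ <;> simp [Set.indicator_of_mem, Set.indicator_of_notMem, hy]

lemma map_snd_spreadCoupling_le {ν : Measure (Euc n)} [IsFiniteMeasure ν] {L : ℝ≥0∞} (hL : L ≠ ⊤)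
    (hne : (lowDensity ν L).Nonempty) :
    (spreadCoupling (lowDensity ν L) ν).map Prod.snd ≤ (ENNReal.ofReal (6 ^ n) * L) • volume := by
  refine Measure.le_iff.2 fun s hs => ?_
  have h0 : Measurable (s.indicator (1 : Euc n → ℝ≥0∞)) := measurable_one.indicator hs
  have hK := measurable_spreadKernel (lowDensity ν L)
  rw [← lintegral_indicator_one hs, lintegral_map h0 measurable_snd,
    lintegral_spreadCoupling _ ν (f := fun q => s.indicator 1 q.2) (h0.comp measurable_snd), lintegral_lintegral_swap]
  · calc ∫⁻ z, ∫⁻ y, spreadKernel (lowDensity ν L) (y, z) * s.indicator 1 z ∂ν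
        = ∫⁻ z, (∫⁻ y, spreadKernel (lowDensity ν L) (y, z) ∂ν) * s.indicator 1 z :=
          lintegral_congr fun z => lintegral_mul_const _ (hK.comp measurable_prodMk_right)
      _ ≤ ∫⁻ z, ENNReal.ofReal (6 ^ n) * L * s.indicator 1 z := by
          gcongr with z
          exact lintegral_spreadKernel_left_le hL hne z
      _ = _ := by
          rw [lintegral_const_mul _ h0, lintegral_indicator_one hs]
          rfl
  · exact (hK.mul (h0.comp measurable_snd)).aemeasurable

lemma ae_spreadCoupling (F : Set (Euc n)) (ν : Measure (Euc n)) :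
    ∀ᵐ q ∂(spreadCoupling F ν), dist q.2 q.1 < infDist q.1 F / 2 := by
  rw [spreadCoupling, ae_withDensity_iff (measurable_spreadKernel F)]
  refine Eventually.of_forall fun q hq => ?_
  by_contra h
  exact hq (Set.indicator_of_notMem (by exact h) _)

theorem ae_dyadicConvAt_restrict_compl {θ : 𝓢(Euc n, ℝ)}
    (hθ : ∀ g : Euc n → ℝ, MemLp g 2 volume → ∀ᵐ x, ∃ L, Tendsto (fun J => ∑ j ∈ Finset.range J,
      ((2 : ℝ) ^ j) ^ n * ∫ z, g z * θ ((2 : ℝ) ^ j • (x - z))) atTop (𝓝 L))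
    (ν : Measure (Euc n)) [IsFiniteMeasure ν] {L : ℝ≥0∞} (hL : L ≠ ⊤)
    (hne : (lowDensity ν L).Nonempty) :
    ∀ᵐ x, x ∈ lowDensity ν L → DyadicConvAt θ (ν.restrict (lowDensity ν L)ᶜ) x := by
  obtain ⟨F, hFdef⟩ : ∃ F, F = lowDensity ν L := ⟨_, rfl⟩
  have hF : IsClosed F := hFdef ▸ isClosed_lowDensity ν hL
  have hsnd := map_snd_spreadCoupling_le hL hne
  rw [← hFdef] at hne hsnd ⊢
  obtain ⟨ρ, hρdef⟩ : ∃ ρ, ρ = spreadCoupling F ν := ⟨_, rfl⟩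
  have hfst := map_fst_spreadCoupling hF hne ν
  have hae := ae_spreadCoupling F ν
  rw [← hρdef] at hfst hae hsnd
  have hfin : IsFiniteMeasure ρ := by
    refine ⟨?_⟩
    have : ρ Set.univ = (ρ.map Prod.fst) Set.univ := by
      rw [Measure.map_apply measurable_fst MeasurableSet.univ, Set.preimage_univ]
    rw [this, hfst]
    exact measure_lt_top _ _
  have hfin2 : IsFiniteMeasure (ρ.map Prod.snd) := inferInstance
  obtain ⟨C, hC, hCb⟩ := θ.exists_tsum_lintegral_sub_le
  set Θ : ℕ → Euc n → Euc n × Euc n → ℝ≥0∞ := fun j x q => ENNReal.ofReal (((2 : ℝ) ^ j) ^ n) *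
    ‖θ ((2 : ℝ) ^ j • (x - q.1)) - θ ((2 : ℝ) ^ j • (x - q.2))‖ₑ with hΘ
  have hΘm : ∀ j, Measurable (Function.uncurry (Θ j)) := fun j => by
    have hc : Continuous fun r : Euc n × Euc n × Euc n =>
        θ ((2 : ℝ) ^ j • (r.1 - r.2.1)) - θ ((2 : ℝ) ^ j • (r.1 - r.2.2)) :=
      (θ.continuous.comp (by fun_prop)).sub (θ.continuous.comp (by fun_prop))
    exact measurable_const.mul hc.enorm.measurable
  have hA : ∀ j, Measurable fun x => ∫⁻ q, Θ j x q ∂ρ := fun j => (hΘm j).lintegral_prod_right'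
  have hB : ∀ j, Measurable fun q => ∫⁻ x in F, Θ j x q := fun j => (hΘm j).lintegral_prod_left'
  have htot : ∫⁻ x in F, ∑' j, ∫⁻ q, Θ j x q ∂ρ ≠ ⊤ := by
    have h1 : ∫⁻ x in F, ∑' j, ∫⁻ q, Θ j x q ∂ρ = ∫⁻ q, (∑' j, ∫⁻ x in F, Θ j x q) ∂ρ := by
      rw [lintegral_tsum fun j => (hA j).aemeasurable, lintegral_tsum fun j => (hB j).aemeasurable]
      exact tsum_congr fun j => lintegral_lintegral_swap (hΘm j).aemeasurable
    rw [h1]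
    refine ((lintegral_mono_ae (g := fun _ => C) ?_).trans_lt ?_).ne
    · filter_upwards [hae] with q hq
      have hd : 0 < infDist q.1 F := by linarith [dist_nonneg (x := q.2) (y := q.1)]
      refine hCb F q.1 q.2 (infDist q.1 F) hF.measurableSet hd (fun x hx => ?_) ?_
      · rw [← dist_eq_norm, dist_comm]
        exact infDist_le_dist_of_mem hx
      · rw [← dist_eq_norm]
        exact hq.le
    · rw [lintegral_const]
      exact ENNReal.mul_lt_top hC.lt_top (measure_lt_top _ _)
  have hmeasS : Measurable fun x => ∑' j, ∫⁻ q, Θ j x q ∂ρ :=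
    Measurable.tsum hA
  have h2 := ae_lt_top hmeasS htot
  rw [ae_restrict_iff' hF.measurableSet] at h2
  filter_upwards [h2, ae_dyadicConvAt_of_le_smul hθ (ENNReal.mul_ne_top ENNReal.ofReal_ne_top hL) hsnd]
    with x hx hx2 hxF
  have hx := hx hxF
  obtain ⟨L2, hL2⟩ := hx2
  have hi1 : ∀ j : ℕ, Integrable (fun q : Euc n × Euc n => θ ((2 : ℝ) ^ j • (x - q.1))) ρ := fun j => by
    have := integrable_scaled_sub θ (ρ.map Prod.fst) (2 ^ j) x
    exact (integrable_map_measure this.1 measurable_fst.aemeasurable).1 this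
  have hi2 : ∀ j : ℕ, Integrable (fun q : Euc n × Euc n => θ ((2 : ℝ) ^ j • (x - q.2))) ρ := fun j => by
    have := integrable_scaled_sub θ (ρ.map Prod.snd) (2 ^ j) x
    exact (integrable_map_measure this.1 measurable_snd.aemeasurable).1 this
  set b : ℕ → ℝ := fun j => ((2 : ℝ) ^ j) ^ n * ∫ q, (θ ((2 : ℝ) ^ j • (x - q.1)) - θ ((2 : ℝ) ^ j • (x - q.2))) ∂ρ
    with hb
  have hbs : Summable b := by
    refine Summable.of_enorm ((lt_of_le_of_lt (ENNReal.tsum_le_tsum fun j => ?_) hx).ne)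
    rw [hb, enorm_mul]
    simp only [hΘ]
    rw [lintegral_const_mul' _ _ ENNReal.ofReal_ne_top, Real.enorm_of_nonneg (by positivity)]
    gcongr
    exact enorm_integral_le_lintegral_enorm _
  refine ⟨_, (hbs.hasSum.tendsto_sum_nat.add hL2).congr fun J => ?_⟩
  rw [← Finset.sum_add_distrib]
  refine Finset.sum_congr rfl fun j _ => ?_
  rw [hb, ← hfst]
  simp only
  rw [integral_sub (hi1 j) (hi2 j), integral_map measurable_fst.aemeasurable
    (integrable_scaled_sub θ (ρ.map Prod.fst) _ x).1, integral_map measurable_snd.aemeasurable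
    (integrable_scaled_sub θ (ρ.map Prod.snd) _ x).1]
  ring

theorem ae_dyadicConvAt {θ : 𝓢(Euc n, ℝ)}
    (hθ : ∀ g : Euc n → ℝ, MemLp g 2 volume → ∀ᵐ x, ∃ L, Tendsto (fun J => ∑ j ∈ Finset.range J,
      ((2 : ℝ) ^ j) ^ n * ∫ z, g z * θ ((2 : ℝ) ^ j • (x - z))) atTop (𝓝 L))
    (ν : Measure (Euc n)) [IsFiniteMeasure ν] : ∀ᵐ x, DyadicConvAt θ ν x := by
  have h : ∀ N : ℕ, ∀ᵐ x, x ∈ lowDensity ν N → DyadicConvAt θ ν x := by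
    intro N
    rcases (lowDensity ν N).eq_empty_or_nonempty with he | hne
    · exact Eventually.of_forall fun x hx => by simp [he] at hx
    filter_upwards [ae_dyadicConvAt_restrict_compl hθ ν (ENNReal.natCast_ne_top N) hne,
      ae_dyadicConvAt_of_le_smul hθ (ENNReal.natCast_ne_top N)
        (restrict_lowDensity_le ν (ENNReal.natCast_ne_top N))] with x h1 h2 hx
    have := h2.add (h1 hx)
    rwa [Measure.restrict_add_restrict_compl
      (isClosed_lowDensity ν (ENNReal.natCast_ne_top N)).measurableSet] at this
  filter_upwards [ae_all_iff.2 h, ae_exists_mem_lowDensity ν] with x hx ⟨N, hN⟩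
  exact hx N hN

theorem ae_tendsto_sum_dyadic {θ : 𝓢(Euc n, ℝ)}
    (hθ : ∀ g : Euc n → ℝ, MemLp g 2 volume → ∀ᵐ x, ∃ L, Tendsto (fun J => ∑ j ∈ Finset.range J,
      ((2 : ℝ) ^ j) ^ n * ∫ z, g z * θ ((2 : ℝ) ^ j • (x - z))) atTop (𝓝 L))
    (σ : Measure (Euc n)) [IsFiniteMeasure σ] {f : Euc n → ℝ} (hf : Measurable f) (hf1 : ∀ z, |f z| ≤ 1) :
    ∀ᵐ x, ∃ L, Tendsto (fun J => ∑ j ∈ Finset.range J,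
      ((2 : ℝ) ^ j) ^ n * ∫ z, f z * θ ((2 : ℝ) ^ j • (x - z)) ∂σ) atTop (𝓝 L) := by
  have hfinpos : ∀ g : Euc n → ℝ, (∀ z, |g z| ≤ 1) →
      IsFiniteMeasure (σ.withDensity fun z => ENNReal.ofReal (g z)) := fun g hg => by
    refine isFiniteMeasure_withDensity ?_
    refine ((lintegral_mono (g := fun _ => 1) fun z => ?_).trans_lt ?_).ne
    · exact ENNReal.ofReal_le_one.2 ((le_abs_self _).trans (hg z))
    · simp
  have h1 := hfinpos f hf1
  have h2 := hfinpos (fun z => -f z) (fun z => by simpa using hf1 z)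
  filter_upwards [ae_dyadicConvAt hθ (σ.withDensity fun z => ENNReal.ofReal (f z)),
    ae_dyadicConvAt hθ (σ.withDensity fun z => ENNReal.ofReal (-f z))] with x ⟨L1, hL1⟩ ⟨L2, hL2⟩
  refine ⟨L1 - L2, (hL1.sub hL2).congr fun J => ?_⟩
  rw [← Finset.sum_sub_distrib]
  refine Finset.sum_congr rfl fun j _ => ?_
  rw [← mul_sub]
  congr 1
  have hint := integrable_scaled_sub θ σ (2 ^ j) x
  have hw : ∀ g : Euc n → ℝ, Measurable g → ∫ z, θ ((2 : ℝ) ^ j • (x - z)) ∂(σ.withDensity fun z => ENNReal.ofReal (g z)) =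
      ∫ z, max (g z) 0 * θ ((2 : ℝ) ^ j • (x - z)) ∂σ := fun g hg => by
    rw [integral_withDensity_eq_integral_toReal_smul hg.ennreal_ofReal
      (Eventually.of_forall fun _ => ENNReal.ofReal_lt_top)]
    simp [ENNReal.toReal_ofReal']
  have hi : ∀ g : Euc n → ℝ, Measurable g → (∀ z, |g z| ≤ 1) →
      Integrable (fun z => max (g z) 0 * θ ((2 : ℝ) ^ j • (x - z))) σ := fun g hg hg1 =>
    hint.bdd_mul (c := 1) (hg.max measurable_const).aestronglyMeasurable (Eventually.of_forall fun z => by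
      rw [Real.norm_eq_abs, abs_of_nonneg (le_max_right _ _)]
      exact max_le ((le_abs_self _).trans (hg1 z)) zero_le_one)
  rw [hw _ hf, hw (fun z => -f z) hf.neg, ← integral_sub (hi _ hf hf1)
    (hi (fun z => -f z) hf.neg fun z => by simpa using hf1 z)]
  refine integral_congr_ae (Eventually.of_forall fun z => ?_)
  simp only
  rw [← sub_mul]
  congr 1
  rcases le_total 0 (f z) with h | h
  · rw [max_eq_left h, max_eq_right (by linarith), sub_zero]
  · rw [max_eq_right h, max_eq_left (by linarith), zero_sub, neg_neg]

end CalderonZygmund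

section Symbol

open scoped ContDiff

variable {n k : ℕ} {V W : Type*}
  [NormedAddCommGroup V] [InnerProductSpace ℝ V] [NormedAddCommGroup W] [InnerProductSpace ℝ W]

lemma symbolMap_smul (A : CoeffOp n k V W) (c : ℝ) (ξ : Euc n) :
    symbolMap n k A (c • ξ) = c ^ k • symbolMap n k A ξ := by
  simp [symbolMap, Finset.prod_mul_distrib, Finset.smul_sum, smul_smul]

variable [FiniteDimensional ℝ V]

lemma contDiff_symbolMap (A : CoeffOp n k V W) :
    ContDiff ℝ ∞ fun ξ => LinearMap.toContinuousLinearMap (symbolMap n k A ξ) := by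
  have : (fun ξ => LinearMap.toContinuousLinearMap (symbolMap n k A ξ)) =
      fun ξ : Euc n => ∑ I : Fin k → Fin n, (∏ i, ξ (I i)) • LinearMap.toContinuousLinearMap (A I) := by
    ext ξ v
    simp [symbolMap]
  rw [this]
  fun_prop

variable [FiniteDimensional ℝ W]

/-- The symbol of an elliptic operator has a left inverse which is smooth away from the origin and
homogeneous of degree `-k`. -/
theorem IsElliptic.exists_leftInverse {A : CoeffOp n k V W} (hA : IsElliptic n k A) (hk : 1 ≤ k) :
    ∃ T : Euc n → W →L[ℝ] V, (∀ ξ, ξ ≠ 0 → ContDiffAt ℝ ∞ T ξ) ∧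
      (∀ (c : ℝ) ξ, T (c • ξ) = (c ^ k)⁻¹ • T ξ) ∧ ∀ ξ, ξ ≠ 0 → ∀ v, T ξ (symbolMap n k A ξ v) = v := by
  obtain ⟨S, hS⟩ : ∃ S : Euc n → V →L[ℝ] W, ∀ ξ, S ξ = LinearMap.toContinuousLinearMap (symbolMap n k A ξ) :=
    ⟨_, fun _ => rfl⟩
  have hSv : ∀ ξ v, S ξ v = symbolMap n k A ξ v := fun ξ v => by rw [hS]; rfl
  have hSc : ∀ (c : ℝ) ξ, S (c • ξ) = c ^ k • S ξ := fun c ξ => by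
    ext v; simp [hSv, symbolMap_smul]
  have hSd : ContDiff ℝ ∞ S := by
    have := contDiff_symbolMap A
    rwa [← funext hS] at this
  have hadj : ContDiff ℝ ∞ fun ξ => ContinuousLinearMap.adjoint (S ξ) :=
    (ContinuousLinearMap.adjoint (𝕜 := ℝ) (E := V) (F := W)).toContinuousLinearEquiv.contDiff.comp hSd
  obtain ⟨M, hM⟩ : ∃ M : Euc n → V →L[ℝ] V, ∀ ξ, M ξ = (ContinuousLinearMap.adjoint (S ξ)) ∘L (S ξ) :=
    ⟨_, fun _ => rfl⟩
  have hMd : ContDiff ℝ ∞ M := by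
    rw [funext hM]
    exact hadj.clm_comp hSd
  have hMu : ∀ ξ, ξ ≠ 0 → IsUnit (M ξ) := fun ξ hξ => by
    rw [ContinuousLinearMap.isUnit_iff_isUnit_toLinearMap, LinearMap.isUnit_iff_ker_eq_bot,
      LinearMap.ker_eq_bot']
    intro v hv
    have h1 : ⟪M ξ v, v⟫ = ⟪S ξ v, S ξ v⟫ := by
      rw [hM]; exact ContinuousLinearMap.adjoint_inner_left (S ξ) v (S ξ v)
    have h2 : M ξ v = 0 := hv
    rw [h2, inner_zero_left, eq_comm, inner_self_eq_zero, hSv] at h1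
    exact hA ξ hξ (by rw [h1, map_zero])
  have hMc : ∀ (c : ℝ) ξ, M (c • ξ) = (c ^ k * c ^ k) • M ξ := fun c ξ => by
    rw [hM, hM, hSc]
    ext v
    simp [smul_smul]
  refine ⟨fun ξ => Ring.inverse (M ξ) ∘L ContinuousLinearMap.adjoint (S ξ), fun ξ hξ => ?_, fun c ξ => ?_,
    fun ξ hξ v => ?_⟩
  · have h1 : ContDiffAt ℝ ∞ (fun ξ => Ring.inverse (M ξ)) ξ := by
      obtain ⟨u, hu⟩ := hMu ξ hξ
      have := contDiffAt_ringInverse ℝ u (n := ∞)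
      rw [hu] at this
      exact this.comp ξ hMd.contDiffAt
    exact h1.clm_comp hadj.contDiffAt
  · rcases eq_or_ne c 0 with rfl | hc
    · have hk0 : (0 : ℝ) ^ k = 0 := zero_pow (by omega)
      have h0 : S 0 = 0 := by simpa [hk0] using hSc 0 0
      simp [h0, hk0]
    have h1 : Ring.inverse (M (c • ξ)) = (c ^ k * c ^ k)⁻¹ • Ring.inverse (M ξ) := by
      have hcomm : Commute (algebraMap ℝ (V →L[ℝ] V) (c ^ k * c ^ k)) (M ξ) := Algebra.commutes _ _
      have hinv : Ring.inverse (algebraMap ℝ (V →L[ℝ] V) (c ^ k * c ^ k)) =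
          algebraMap ℝ (V →L[ℝ] V) (c ^ k * c ^ k)⁻¹ := by
        have hc' : c ^ k * c ^ k ≠ 0 := mul_ne_zero (pow_ne_zero _ hc) (pow_ne_zero _ hc)
        refine Ring.inverse_unit ((Units.mk0 _ hc').map (algebraMap ℝ (V →L[ℝ] V)).toMonoidHom)
      rw [hMc, Algebra.smul_def, hcomm.eq, Ring.mul_inverse_rev' hcomm.symm, hinv, Algebra.smul_def]
    simp only
    rw [h1, hSc]
    ext w
    simp only [ContinuousLinearMap.comp_apply, smul_apply, map_smul, smul_smul]
    congr 1
    have : c ^ k ≠ 0 := pow_ne_zero _ hc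
    simp
    field_simp
  · have h1 : Ring.inverse (M ξ) * M ξ = 1 := Ring.inverse_mul_cancel _ (hMu ξ hξ)
    have h2 := congrArg (fun L : V →L[ℝ] V => L v) h1
    simp only [one_apply_eq_self] at h2
    rw [← hSv]
    simp only [hM] at h2 ⊢
    exact h2

/-- A function that is homogeneous of degree zero and continuous away from the origin is bounded. -/
lemma exists_bound_of_homogeneous {G : Type*} [NormedAddCommGroup G] {m : Euc n → G}
    (hm : ∀ ξ, ξ ≠ 0 → ContinuousAt m ξ) (hc : ∀ (c : ℝ) ξ, c ≠ 0 → m (c • ξ) = m ξ) :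
    ∃ M, ∀ ξ, ‖m ξ‖ ≤ M := by
  have h1 : ContinuousOn m (sphere 0 1) := fun ξ hξ =>
    (hm ξ (ne_zero_of_mem_unit_sphere (⟨ξ, hξ⟩ : sphere (0 : Euc n) 1))).continuousWithinAt
  obtain ⟨M, hM⟩ := (isCompact_sphere (0 : Euc n) 1).exists_bound_of_continuousOn h1
  refine ⟨max M ‖m 0‖, fun ξ => ?_⟩
  rcases eq_or_ne ξ 0 with rfl | hξ
  · exact le_max_right _ _
  · have h2 : ‖ξ‖⁻¹ ≠ 0 := inv_ne_zero (norm_ne_zero_iff.2 hξ)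
    rw [← hc _ ξ h2]
    refine (hM _ ?_).trans (le_max_left _ _)
    rw [mem_sphere_zero_iff_norm, norm_smul, norm_inv, norm_norm, inv_mul_cancel₀ (norm_ne_zero_iff.2 hξ)]

end Symbol

section RealFourierInverse

open scoped ContDiff FourierTransform LineDeriv

variable {n m : ℕ}

/-- The real part of the inverse Fourier transform on Schwartz functions. -/
noncomputable def reFourierInv (n : ℕ) : 𝓢(Euc n, ℂ) →ₗ[ℝ] 𝓢(Euc n, ℝ) :=
  (SchwartzMap.postcompCLM Complex.reCLM : 𝓢(Euc n, ℂ) →L[ℝ] 𝓢(Euc n, ℝ)).toLinearMap ∘ₗ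
    FourierTransform.fourierInvₗ ℝ 𝓢(Euc n, ℂ)

lemma reFourierInv_apply (G : 𝓢(Euc n, ℂ)) (x : Euc n) :
    reFourierInv n G x = (𝓕⁻ (G : Euc n → ℂ) x).re := by
  rw [← SchwartzMap.fourierInv_coe]; rfl

lemma integral_reFourierInv (G : 𝓢(Euc n, ℂ)) : ∫ x, reFourierInv n G x = (G 0).re := by
  have h1 : ∀ x, reFourierInv n G x = RCLike.re ((𝓕⁻ G) x) := fun x => rfl
  simp only [h1]
  rw [integral_re ((𝓕⁻ G).integrable)]
  have h2 : (𝓕 (𝓕⁻ G)) 0 = G 0 := by rw [FourierTransform.fourier_fourierInv_eq]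
  rw [← h2, SchwartzMap.fourier_coe, Real.fourier_eq]
  simp

theorem exists_dirDeriv_reFourierInv (G : 𝓢(Euc n, ℂ)) (I : Fin m → Fin n) :
    ∃ G' : 𝓢(Euc n, ℂ), (∀ ξ, G' ξ = (2 * Real.pi * Complex.I) ^ m * (∏ i, (ξ (I i) : ℂ)) * G ξ) ∧
      dirDeriv n m I (reFourierInv n G) = reFourierInv n G' := by
  induction m generalizing G with
  | zero => exact ⟨G, fun ξ => by simp, by simp⟩
  | succ m ih =>
    obtain ⟨e, he⟩ : ∃ e, e = stdVec n (I (Fin.last m)) := ⟨_, rfl⟩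
    obtain ⟨H, hH⟩ : ∃ H : 𝓢(Euc n, ℂ), H = (2 * Real.pi * Complex.I) •
      SchwartzMap.smulLeftCLM ℂ (inner ℝ · e) G := ⟨_, rfl⟩
    have h1 : (fun y => fderiv ℝ (reFourierInv n G) y e) = reFourierInv n H := by
      ext y
      have h2 : (reFourierInv n G : Euc n → ℝ) = Complex.reCLM ∘ (𝓕⁻ G : 𝓢(Euc n, ℂ)) := rfl
      rw [h2, fderiv_comp _ Complex.reCLM.differentiableAt (𝓕⁻ G).differentiableAt, ContinuousLinearMap.fderiv]
      have h3 : reFourierInv n H y = (𝓕⁻ H y).re := rfl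
      rw [h3, hH, ← SchwartzMap.lineDerivOp_fourierInv_eq, SchwartzMap.lineDerivOp_apply_eq_fderiv]
      rfl
    obtain ⟨G', hG', hG'2⟩ := ih H (Fin.init I)
    refine ⟨G', fun ξ => ?_, ?_⟩
    · have htg : (fun ξ : Euc n => inner ℝ ξ e).HasTemperateGrowth := by fun_prop
      have : H ξ = 2 * Real.pi * Complex.I * (ξ (I (Fin.last m)) * G ξ) := by
        rw [hH, smul_apply, SchwartzMap.smulLeftCLM_apply_apply htg, he, real_inner_comm, inner_stdVec]
        simp
      rw [hG', this, Fin.prod_univ_castSucc]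
      simp only [Fin.init]
      ring
    · rw [dirDeriv_succ_right ((reFourierInv n G).smooth ⊤), ← he, h1, hG'2]

end RealFourierInverse

section Parametrix

open scoped ContDiff FourierTransform

variable {n k : ℕ} {V W : Type*}
  [NormedAddCommGroup V] [InnerProductSpace ℝ V] [FiniteDimensional ℝ V]
  [NormedAddCommGroup W] [InnerProductSpace ℝ W] [FiniteDimensional ℝ W]

/-- For an elliptic operator there are Schwartz functions `K a b` whose dyadic dilates sum up to a
fundamental solution. -/
theorem IsElliptic.exists_dyadic_parametrix {ι κ : Type*} [Fintype ι] [DecidableEq ι] [Fintype κ]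
    (e : OrthonormalBasis ι ℝ V) (w : OrthonormalBasis κ ℝ W) {A : CoeffOp n k V W}
    (hA : IsElliptic n k A) (hn : 1 ≤ n) (hnk : n ≤ k) :
    ∃ (K : ι → κ → 𝓢(Euc n, ℝ)) (ψ : 𝓢(Euc n, ℝ)), ∫ x, ψ x = 1 ∧
      (∀ a a' x, ∑ b, ∑ I, ⟪w b, A I (e a')⟫ * dirDeriv n k I (K a b) x =
        if a = a' then (2 : ℝ) ^ n * ψ ((2 : ℝ) • x) - ψ x else 0) ∧
      ∀ a b (α : Fin (k - n) → Fin n), ∃ l : 𝓢(Euc n, ℝ), dirDeriv n (k - n) α (K a b) = l ∧ ∫ x, l x = 0 ∧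
        ∀ (σ : Measure (Euc n)) [IsFiniteMeasure σ] (f : Euc n → ℝ), Measurable f → (∀ z, |f z| ≤ 1) →
          ∀ᵐ x, ∀ I : Fin n → Fin n, ∃ L, Tendsto (fun J => ∑ j ∈ Finset.range J,
            ((2 : ℝ) ^ j) ^ n * ∫ z, f z * dirDeriv n n I l ((2 : ℝ) ^ j • (x - z)) ∂σ) atTop (𝓝 L) := by
  obtain ⟨T, hTs, hTh, hTi⟩ := hA.exists_leftInverse (hn.trans hnk)
  obtain ⟨χ, hχ⟩ := exists_isCutoff n
  obtain ⟨c, hc⟩ : ∃ c : ℂ, c = 2 * Real.pi * Complex.I := ⟨_, rfl⟩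
  have hc0 : c ≠ 0 := by simp [hc, Real.pi_ne_zero]
  obtain ⟨t, ht⟩ : ∃ t : ι → κ → Euc n → ℂ, ∀ a b ξ, t a b ξ = ((⟪e a, T ξ (w b)⟫ : ℝ) : ℂ) :=
    ⟨_, fun _ _ _ => rfl⟩
  have hts : ∀ a b ξ, ξ ≠ 0 → ContDiffAt ℝ ∞ (t a b) ξ := fun a b ξ hξ => by
    rw [funext (ht a b)]
    exact Complex.ofRealCLM.contDiff.contDiffAt.comp ξ
      (contDiffAt_const.inner ℝ ((hTs ξ hξ).clm_apply contDiffAt_const))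
  have hth : ∀ a b (s : ℝ) ξ, t a b (s • ξ) = ((s : ℂ) ^ k)⁻¹ * t a b ξ := fun a b s ξ => by
    rw [ht, ht, hTh]
    simp [inner_smul_right]
  have hG : ∀ a b, ∃ G : 𝓢(Euc n, ℂ), ∀ ξ, G ξ = (χ ((2 : ℝ)⁻¹ • ξ) - χ ξ) • ((c ^ k)⁻¹ * t a b ξ) :=
    fun a b => ⟨(hχ.hasCompactSupport_dyadic_smul _).toSchwartzMap
      (hχ.contDiff_dyadic_smul fun ξ hξ => contDiffAt_const.mul (hts a b ξ hξ)), fun ξ => rfl⟩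
  choose G hG using hG
  have hX : ∃ X : 𝓢(Euc n, ℂ), ∀ ξ, X ξ = (χ ξ : ℂ) :=
    ⟨(hχ.hasCompactSupport.comp_left (g := fun x : ℝ => (x : ℂ)) (by simp)).toSchwartzMap
      (Complex.ofRealCLM.contDiff.comp hχ.1), fun ξ => rfl⟩
  obtain ⟨X, hX⟩ := hX
  have hY : ∃ Y : 𝓢(Euc n, ℂ), ∀ ξ, Y ξ = (χ ((2 : ℝ)⁻¹ • ξ) - χ ξ) • (1 : ℂ) :=
    ⟨(hχ.hasCompactSupport_dyadic_smul _).toSchwartzMap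
      (hχ.contDiff_dyadic_smul fun ξ hξ => contDiffAt_const), fun ξ => rfl⟩
  obtain ⟨Y, hY⟩ := hY
  have hχ0 : χ 0 = 1 := hχ.2.1 0 (by simp)
  refine ⟨fun a b => reFourierInv n (G a b), reFourierInv n X, ?_, ?_, ?_⟩
  · rw [integral_reFourierInv, hX, hχ0]
    simp
  · intro a a' x
    choose D hD1 hD2 using fun b (I : Fin k → Fin n) => exists_dirDeriv_reFourierInv (G a b) I
    simp only [hD2]
    have h1 : ∑ b, ∑ I, ⟪w b, A I (e a')⟫ • D b I = if a = a' then Y else 0 := by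
      ext ξ
      have h2 : (∑ b, ∑ I, ⟪w b, A I (e a')⟫ • D b I) ξ =
          (χ ((2 : ℝ)⁻¹ • ξ) - χ ξ) • ((⟪e a, T ξ (symbolMap n k A ξ (e a'))⟫ : ℝ) : ℂ) := by
        have h3 : symbolMap n k A ξ (e a') = ∑ b, ⟪w b, symbolMap n k A ξ (e a')⟫ • w b :=
          (w.sum_repr' _).symm
        rw [h3, map_sum, inner_sum, Complex.ofReal_sum, Finset.smul_sum]
        simp only [sum_apply]
        refine Finset.sum_congr rfl fun b _ => ?_
        rw [map_smul, inner_smul_right]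
        simp only [symbolMap, LinearMap.sum_apply, LinearMap.smul_apply, inner_sum, inner_smul_right]
        rw [Finset.sum_mul, Complex.ofReal_sum, Finset.smul_sum]
        refine Finset.sum_congr rfl fun I _ => ?_
        rw [smul_apply, hD1, hG, ht, ← hc]
        push_cast
        simp only [Complex.real_smul]
        push_cast
        field_simp
      rw [h2]
      rcases eq_or_ne ξ 0 with rfl | hξ
      · split_ifs
        · simp [hY]
        · simp
      · rw [hTi ξ hξ, e.inner_eq_ite]
        split_ifs
        · simp [hY]
        · simp
    have h4 : ∑ b, ∑ I, ⟪w b, A I (e a')⟫ * reFourierInv n (D b I) x =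
        reFourierInv n (∑ b, ∑ I, ⟪w b, A I (e a')⟫ • D b I) x := by
      simp only [map_sum, map_smul, sum_apply, smul_apply, smul_eq_mul]
    rw [h4, h1]
    split_ifs
    · have h5 : ∃ X2 : 𝓢(Euc n, ℂ), ∀ ξ, X2 ξ = X ((2 : ℝ)⁻¹ • ξ) :=
        ⟨Y + X, fun ξ => by simp [hY, hX]⟩
      obtain ⟨X2, hX2⟩ := h5
      have h6 : Y = X2 - X := by
        ext ξ
        rw [sub_apply, hX2, hX, hX, hY]
        simp
      rw [h6, map_sub, sub_apply]
      congr 1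
      rw [reFourierInv_apply, reFourierInv_apply, funext hX2, fourierInv_comp_inv_smul _ two_pos,
        Complex.re_ofReal_mul]
    · simp
  · intro a b α
    obtain ⟨G1, hG1, hG1'⟩ := exists_dirDeriv_reFourierInv (G a b) α
    refine ⟨reFourierInv n G1, hG1', ?_, fun σ _ f hf hf1 => ae_all_iff.2 fun I => ?_⟩
    · rw [integral_reFourierInv, hG1, hG]
      simp
    · obtain ⟨G2, hG2, hG2'⟩ := exists_dirDeriv_reFourierInv G1 I
      rw [hG2']
      obtain ⟨μ, hμ⟩ : ∃ μ : Euc n → ℂ, ∀ ξ, μ ξ = (∏ i, (ξ (I i) : ℂ)) * (∏ i, (ξ (α i) : ℂ)) * t a b ξ :=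
        ⟨_, fun _ => rfl⟩
      have hμs : ∀ ξ, ξ ≠ 0 → ContDiffAt ℝ ∞ μ ξ := fun ξ hξ => by
        rw [funext hμ]
        have hp : ∀ {m : ℕ} (β : Fin m → Fin n), ContDiff ℝ ∞ fun ξ : Euc n => ∏ i, (ξ (β i) : ℂ) :=
          fun β => contDiff_prod fun i _ => Complex.ofRealCLM.contDiff.comp (by fun_prop)
        exact ((hp I).mul (hp α)).contDiffAt.mul (hts a b ξ hξ)
      have hμh : ∀ (s : ℝ) ξ, s ≠ 0 → μ (s • ξ) = μ ξ := fun s ξ hs => by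
        have hs' : (s : ℂ) ≠ 0 := by exact_mod_cast hs
        have hpow : (s : ℂ) ^ k = (s : ℂ) ^ n * (s : ℂ) ^ (k - n) := by
          rw [← pow_add]; congr 1; omega
        rw [hμ, hμ, hth]
        simp only [PiLp.smul_apply, smul_eq_mul, Complex.ofReal_mul, Finset.prod_mul_distrib, Finset.prod_const,
          Finset.card_univ, Fintype.card_fin]
        rw [hpow]
        field_simp
      obtain ⟨M, hM⟩ := exists_bound_of_homogeneous (fun ξ hξ => (hμs ξ hξ).continuousAt) hμh
      refine ae_tendsto_sum_dyadic (fun g hg => ae_tendsto_sum_dyadic_of_memLp hχ hμs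
        (fun ξ => hμh 2 ξ two_ne_zero) hM (fun x => ?_) hg) σ hf hf1
      have hfun : (G2 : Euc n → ℂ) = fun ξ => (χ ((2 : ℝ)⁻¹ • ξ) - χ ξ) • μ ξ := by
        ext ξ
        rw [hG2, hG1, hG, hμ, ← hc]
        simp only [Complex.real_smul]
        have hpow : c ^ k = c ^ n * c ^ (k - n) := by
          rw [← pow_add]; congr 1; omega
        rw [hpow]
        field_simp
      rw [reFourierInv_apply, hfun]

end Parametrix

section MeasureConvolution

variable {n : ℕ} {μ : Measure (Euc n)} {g H φ : Euc n → ℝ}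

/-- The convolution of the measure `g μ` with the function `H`. -/
noncomputable def mconv (μ : Measure (Euc n)) (g H : Euc n → ℝ) (x : Euc n) : ℝ :=
  ∫ y, g y * H (x - y) ∂μ

lemma mconv_eq_convolution (μ : Measure (Euc n)) (g H : Euc n → ℝ) :
    mconv μ g H = convolution g H (ContinuousLinearMap.mul ℝ ℝ) μ := rfl

lemma contDiff_mconv (hg : LocallyIntegrable g μ) (hH : IsTestFun n H) :
    ContDiff ℝ (⊤ : ℕ∞) (mconv μ g H) :=
  hH.2.contDiff_convolution_right (ContinuousLinearMap.mul ℝ ℝ) hg hH.1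

lemma continuous_mconv (hg : LocallyIntegrable g μ) (hH : Continuous H) (hc : HasCompactSupport H) :
    Continuous (mconv μ g H) :=
  hc.continuous_convolution_right (ContinuousLinearMap.mul ℝ ℝ) hg hH

lemma integrable_mconv (hg : LocallyIntegrable g μ) (hH : Continuous H) (hc : HasCompactSupport H)
    (x : Euc n) : Integrable (fun y => g y * H (x - y)) μ :=
  hc.convolutionExists_right (ContinuousLinearMap.mul ℝ ℝ) hg hH x

lemma hasCompactSupport_mconv (hg : HasCompactSupport g) (hH : HasCompactSupport H) :
    HasCompactSupport (mconv μ g H) := by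
  rw [mconv_eq_convolution]
  exact hg.convolution (ContinuousLinearMap.mul ℝ ℝ) hH

lemma fderiv_mconv (hg : LocallyIntegrable g volume) (hH : IsTestFun n H) (e : Euc n) :
    (fun x => fderiv ℝ (mconv volume g H) x e) = mconv volume g (fun z => fderiv ℝ H z e) := by
  ext x
  have h1 : ContDiff ℝ 1 H := hH.1.of_le (by exact_mod_cast le_top)
  have h := hH.2.hasFDerivAt_convolution_right (ContinuousLinearMap.mul ℝ ℝ) hg h1 x
  rw [mconv_eq_convolution, h.fderiv,
    convolution_precompR_apply _ hg (hH.2.fderiv ℝ) (h1.continuous_fderiv (by simp))]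
  rfl

lemma dirDeriv_mconv {m : ℕ} (hg : LocallyIntegrable g volume) (hH : IsTestFun n H) (I : Fin m → Fin n) :
    dirDeriv n m I (mconv volume g H) = mconv volume g (dirDeriv n m I H) := by
  induction m generalizing H with
  | zero => simp
  | succ m ih =>
    rw [dirDeriv_succ_right (contDiff_mconv hg hH), fderiv_mconv hg hH, ih (hH.fderiv_apply_const _),
      dirDeriv_succ_right hH.1]

lemma mconv_sum {ι : Type*} (s : Finset ι) (hg : LocallyIntegrable g μ) {H : ι → Euc n → ℝ}
    (hH : ∀ i ∈ s, IsTestFun n (H i)) (x : Euc n) :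
    mconv μ g (fun z => ∑ i ∈ s, H i z) x = ∑ i ∈ s, mconv μ g (H i) x := by
  simp only [mconv, Finset.mul_sum]
  exact integral_finsetSum _ fun i hi => integrable_mconv hg (hH i hi).1.continuous (hH i hi).2 x

lemma mconv_sub {H' : Euc n → ℝ} (hg : LocallyIntegrable g μ) (hH : IsTestFun n H) (hH' : IsTestFun n H')
    (x : Euc n) : mconv μ g (fun z => H z - H' z) x = mconv μ g H x - mconv μ g H' x := by
  simp only [mconv, mul_sub]
  exact integral_sub (integrable_mconv hg hH.1.continuous hH.2 x)
    (integrable_mconv hg hH'.1.continuous hH'.2 x)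

lemma mconv_const_mul (c : ℝ) (x : Euc n) : mconv μ g (fun z => c * H z) x = c * mconv μ g H x := by
  simp only [mconv, mul_left_comm _ c]
  exact integral_const_mul _ _

lemma IsTestFun.comp_neg (hH : IsTestFun n H) : IsTestFun n fun z => H (-z) :=
  ⟨hH.1.comp contDiff_neg, hH.2.comp_homeomorph (Homeomorph.neg (Euc n))⟩

/-- The adjoint of convolution with `H`, applied to a test function. -/
lemma isTestFun_adjoint (hH : IsTestFun n H) (hφ : IsTestFun n φ) :
    IsTestFun n fun y => ∫ x, H (x - y) * φ x := by
  have h : (fun y => ∫ x, H (x - y) * φ x) = mconv volume φ fun z => H (-z) := by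
    ext y; simp [mconv, mul_comm]
  rw [h]
  exact ⟨contDiff_mconv hφ.1.continuous.locallyIntegrable hH.comp_neg,
    hasCompactSupport_mconv hφ.2 hH.comp_neg.2⟩

lemma dirDeriv_adjoint {m : ℕ} (hH : IsTestFun n H) (hφ : IsTestFun n φ) (I : Fin m → Fin n) (y : Euc n) :
    dirDeriv n m I (fun y => ∫ x, H (x - y) * φ x) y =
      (-1) ^ m * ∫ x, dirDeriv n m I H (x - y) * φ x := by
  have h : (fun y => ∫ x, H (x - y) * φ x) = mconv volume φ fun z => H (-z) := by
    ext y; simp [mconv, mul_comm]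
  rw [h, dirDeriv_mconv hφ.1.continuous.locallyIntegrable hH.comp_neg, mconv, ← integral_const_mul]
  congr 1; ext x
  have := dirDeriv_comp_const_sub hH.1 I 0 (y - x)
  simp only [zero_sub, neg_sub, smul_eq_mul] at this
  rw [this]; ring

lemma integral_comp_sub_mul_dirDeriv {m : ℕ} (hH : IsTestFun n H) (hφ : IsTestFun n φ)
    (I : Fin m → Fin n) (y : Euc n) :
    ∫ x, H (x - y) * dirDeriv n m I φ x = (-1) ^ m * ∫ x, dirDeriv n m I H (x - y) * φ x := by
  rw [integral_mul_dirDeriv (f := fun x => H (x - y)) (hH.1.comp (contDiff_id.sub contDiff_const)) hφ]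
  simp only [dirDeriv_comp_sub_const]

lemma integral_mul_adjoint [IsLocallyFiniteMeasure μ] (hg : LocallyIntegrable g μ) (hH : IsTestFun n H)
    (hφ : IsTestFun n φ) :
    ∫ y, g y * (∫ x, H (x - y) * φ x) ∂μ = ∫ x, φ x * mconv μ g H x := by
  obtain ⟨C, hC⟩ := hH.2.exists_bound_of_continuous hH.1.continuous
  obtain ⟨K, hK, hKs⟩ : ∃ K : Set (Euc n), IsCompact K ∧
      ∀ x y, y ∉ K → H (x - y) * φ x = 0 := by
    refine ⟨(fun q : Euc n × Euc n => q.1 - q.2) '' (tsupport φ ×ˢ tsupport H),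
      (hφ.2.isCompact.prod hH.2.isCompact).image (by fun_prop), fun x y hy => ?_⟩
    by_contra h
    refine hy ⟨(x, x - y), ⟨subset_tsupport _ (right_ne_zero_of_mul h),
      subset_tsupport _ (left_ne_zero_of_mul h)⟩, by simp⟩
  have hgK : Integrable (K.indicator g) μ :=
    (integrable_indicator_iff hK.measurableSet).2 (hg.integrableOn_isCompact hK)
  have hφi : Integrable φ volume := hφ.1.continuous.integrable_of_hasCompactSupport hφ.2
  have hint : Integrable (Function.uncurry fun y x => g y * (H (x - y) * φ x)) (μ.prod volume) := by
    have h1 := (hgK.mul_prod hφi).mul_bdd (c := C) (g := fun q : Euc n × Euc n => H (q.2 - q.1))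
      (hH.1.continuous.comp (continuous_snd.sub continuous_fst)).aestronglyMeasurable (ae_of_all _ fun q => hC _)
    refine h1.congr (ae_of_all _ fun q => ?_)
    by_cases hq : q.1 ∈ K
    · simp only [Function.uncurry, Set.indicator_of_mem hq]; ring
    · simp only [Function.uncurry, Set.indicator_of_notMem hq, hKs _ _ hq]; simp
  simp only [mconv, ← integral_const_mul]
  rw [integral_integral_swap hint]
  congr 1; ext x; congr 1; ext y; ring

end MeasureConvolution

section Series

variable {n : ℕ}

lemma ae_of_forall_ae_ball {P : Euc n → Prop}
    (h : ∀ R : ℕ, ∀ᵐ x ∂(volume : Measure (Euc n)), x ∈ ball (0 : Euc n) R → P x) : ∀ᵐ x, P x := by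
  filter_upwards [ae_all_iff.2 h] with x hx
  obtain ⟨R, hR⟩ := exists_nat_gt ‖x‖
  exact hx R (by simpa using hR)

section LocallySummable

variable {F : ℕ → Euc n → ℝ}

lemma ae_summable_of_locally_summable (hF : ∀ j, Continuous (F j))
    (hs : ∀ R : ℕ, ∑' j, ∫⁻ x in ball (0 : Euc n) R, ‖F j x‖ₑ ≠ ∞) :
    ∀ᵐ x, Summable fun j => F j x := by
  refine ae_of_forall_ae_ball fun R => ?_
  have h := hs R
  rw [← lintegral_tsum fun j => (hF j).measurable.enorm.aemeasurable] at h
  have := ae_lt_top' (AEMeasurable.tsum fun j => (hF j).measurable.enorm.aemeasurable) h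
  rw [ae_restrict_iff' measurableSet_ball] at this
  filter_upwards [this] with x hx hxR
  have h2 := (hx hxR).ne
  refine Summable.of_norm ?_
  simpa using ENNReal.summable_toReal h2

lemma aestronglyMeasurable_tsum_of_locally_summable (hF : ∀ j, Continuous (F j))
    (hs : ∀ R : ℕ, ∑' j, ∫⁻ x in ball (0 : Euc n) R, ‖F j x‖ₑ ≠ ∞) :
    AEStronglyMeasurable (fun x => ∑' j, F j x) volume := by
  refine aestronglyMeasurable_of_tendsto_ae atTop (f := fun J x => ∑ j ∈ Finset.range J, F j x)
    (fun J => (continuous_finsetSum _ fun j _ => hF j).aestronglyMeasurable) ?_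
  filter_upwards [ae_summable_of_locally_summable hF hs] with x hx
  exact hx.hasSum.tendsto_sum_nat

lemma locallyIntegrable_tsum_of_locally_summable (hF : ∀ j, Continuous (F j))
    (hs : ∀ R : ℕ, ∑' j, ∫⁻ x in ball (0 : Euc n) R, ‖F j x‖ₑ ≠ ∞) :
    LocallyIntegrable (fun x => ∑' j, F j x) volume := by
  intro x
  obtain ⟨R, hR⟩ := exists_nat_gt ‖x‖
  refine ⟨ball 0 R, isOpen_ball.mem_nhds (by simpa using hR), ?_⟩
  refine ⟨(aestronglyMeasurable_tsum_of_locally_summable hF hs).restrict, ?_⟩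
  refine lt_of_le_of_lt (lintegral_mono fun x => enorm_tsum_le_tsum_enorm) ?_
  rw [lintegral_tsum fun j => (hF j).measurable.enorm.aemeasurable]
  exact (hs R).lt_top

lemma hasSum_integral_mul_of_locally_summable (hF : ∀ j, Continuous (F j))
    (hs : ∀ R : ℕ, ∑' j, ∫⁻ x in ball (0 : Euc n) R, ‖F j x‖ₑ ≠ ∞)
    {φ : Euc n → ℝ} (hφ : Continuous φ)
    (hc : HasCompactSupport φ) :
    HasSum (fun j => ∫ x, φ x * F j x) (∫ x, φ x * ∑' j, F j x) := by
  obtain ⟨C, hC⟩ := hc.exists_bound_of_continuous hφ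
  have hC0 : 0 ≤ C := (norm_nonneg _).trans (hC 0)
  obtain ⟨R, hR⟩ := hc.isCompact.isBounded.subset_ball_lt 0 (0 : Euc n)
  obtain ⟨N, hN⟩ := exists_nat_ge R
  have hz : ∀ x, x ∉ ball (0 : Euc n) N → φ x = 0 := fun x hx =>
    image_eq_zero_of_notMem_tsupport fun h => hx (ball_subset_ball hN (hR.2 h))
  have hint : ∀ j, Integrable (fun x => φ x * F j x) := fun j =>
    (hφ.mul (hF j)).integrable_of_hasCompactSupport hc.mul_right
  have hb : ∀ j, ∫⁻ x, ‖φ x * F j x‖ₑ ≤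
      ENNReal.ofReal C * ∫⁻ x in ball (0 : Euc n) N, ‖F j x‖ₑ := fun j => by
    rw [← lintegral_const_mul' _ _ ENNReal.ofReal_ne_top, ← lintegral_indicator measurableSet_ball]
    refine lintegral_mono fun x => ?_
    by_cases hx : x ∈ ball (0 : Euc n) N
    · rw [Set.indicator_of_mem hx, enorm_mul]
      gcongr
      rw [← ofReal_norm]
      exact ENNReal.ofReal_le_ofReal (hC x)
    · simp [hz x hx]
  have hsum : ∑' j, ∫⁻ x, ‖φ x * F j x‖ₑ ≠ ∞ := by
    refine ne_top_of_le_ne_top ?_ (ENNReal.tsum_le_tsum hb)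
    rw [ENNReal.tsum_mul_left]
    exact ENNReal.mul_ne_top ENNReal.ofReal_ne_top (hs N)
  have := hasSum_integral_of_summable_integral_norm hint (by
    simpa only [integral_norm_eq_lintegral_enorm (hint _).aestronglyMeasurable] using
      ENNReal.summable_toReal hsum)
  simpa only [tsum_mul_left] using this

end LocallySummable

variable {μ : Measure (Euc n)} {g : Euc n → ℝ}

lemma lintegral_mconv_le [IsLocallyFiniteMeasure μ] (hg : LocallyIntegrable g μ) {H : Euc n → ℝ}
    (hH : Continuous H) (hH2 : ∀ z, 2 < ‖z‖ → H z = 0) (R : ℝ) :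
    ∫⁻ x in ball (0 : Euc n) R, ‖mconv μ g H x‖ₑ ≤
      (∫⁻ y in ball (0 : Euc n) (R + 3), ‖g y‖ₑ ∂μ) * ∫⁻ z, ‖H z‖ₑ := by
  have h1 : ∀ x ∈ ball (0 : Euc n) R, ‖mconv μ g H x‖ₑ ≤
      ∫⁻ y in ball (0 : Euc n) (R + 3), ‖g y‖ₑ * ‖H (x - y)‖ₑ ∂μ := fun x hx => by
    refine (enorm_integral_le_lintegral_enorm _).trans ?_
    rw [← lintegral_indicator measurableSet_ball]
    refine lintegral_mono fun y => ?_
    by_cases hy : y ∈ ball (0 : Euc n) (R + 3)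
    · rw [Set.indicator_of_mem hy, enorm_mul]
    · rw [hH2 (x - y)]
      · simp
      · simp only [mem_ball_zero_iff, not_lt] at hx hy
        have := norm_sub_norm_le y x
        rw [norm_sub_rev] at this
        linarith
  calc _ ≤ ∫⁻ x in ball (0 : Euc n) R, ∫⁻ y in ball (0 : Euc n) (R + 3), ‖g y‖ₑ * ‖H (x - y)‖ₑ ∂μ :=
        setLIntegral_mono' measurableSet_ball h1
    _ ≤ ∫⁻ x, ∫⁻ y in ball (0 : Euc n) (R + 3), ‖g y‖ₑ * ‖H (x - y)‖ₑ ∂μ :=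
        setLIntegral_le_lintegral _ _
    _ = ∫⁻ y in ball (0 : Euc n) (R + 3), (∫⁻ x, ‖g y‖ₑ * ‖H (x - y)‖ₑ) ∂μ := by
        refine lintegral_lintegral_swap ?_
        have h2 : Measurable fun q : Euc n × Euc n => ‖H (q.1 - q.2)‖ₑ :=
          (hH.comp (continuous_fst.sub continuous_snd)).measurable.enorm
        exact hg.aestronglyMeasurable.restrict.enorm.comp_snd.mul h2.aemeasurable
    _ = _ := by
        rw [← lintegral_mul_const'' _ hg.aestronglyMeasurable.restrict.enorm]
        congr 1; ext y
        rw [lintegral_const_mul' _ _ enorm_ne_top, lintegral_sub_right_eq_self (fun z => ‖H z‖ₑ)]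

lemma tsum_lintegral_mconv_ne_top [IsLocallyFiniteMeasure μ] (hg : LocallyIntegrable g μ)
    {H : ℕ → Euc n → ℝ} (hH : ∀ j, Continuous (H j)) (hH2 : ∀ j z, 2 < ‖z‖ → H j z = 0)
    (hs : ∑' j, ∫⁻ z, ‖H j z‖ₑ ≠ ∞) (R : ℕ) :
    ∑' j, ∫⁻ x in ball (0 : Euc n) R, ‖mconv μ g (H j) x‖ₑ ≠ ∞ := by
  refine ne_top_of_le_ne_top ?_ (ENNReal.tsum_le_tsum fun j => lintegral_mconv_le hg (hH j) (hH2 j) R)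
  rw [ENNReal.tsum_mul_left]
  refine ENNReal.mul_ne_top ?_ hs
  have := (hg.integrableOn_isCompact (isCompact_closedBall (0 : Euc n) (R + 3))).mono_set
    ball_subset_closedBall
  exact this.2.ne

end Series

section ApproximateIdentity

variable {n : ℕ}

lemma integral_scaled_mul_comp_add {s : ℝ} (hs : 0 < s) (ψ ζ β : Euc n → ℝ) (y : Euc n) :
    ∫ x, ζ (x - y) * (s ^ n * ψ (s • (x - y))) * β x = ∫ w, ζ (s⁻¹ • w) * ψ w * β (s⁻¹ • w + y) := by
  have h1 := integral_sub_right_eq_self (μ := (volume : Measure (Euc n)))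
    (fun z => ζ z * (s ^ n * ψ (s • z)) * β (z + y)) y
  simp only [sub_add_cancel] at h1
  have h2 := Measure.integral_comp_smul (volume : Measure (Euc n))
    (fun w => ζ (s⁻¹ • w) * ψ w * β (s⁻¹ • w + y)) s
  simp only [inv_smul_smul₀ hs.ne', finrank_euclideanSpace, Fintype.card_fin, smul_eq_mul] at h2
  rw [h1]
  have h3 : ∀ z, ζ z * (s ^ n * ψ (s • z)) * β (z + y) = s ^ n * (ζ z * ψ (s • z) * β (z + y)) :=
    fun z => by ring
  simp only [h3]
  rw [integral_const_mul, h2, abs_of_pos (by positivity), mul_inv_cancel_left₀ (by positivity)]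

lemma tendsto_integral_mul_scaled {u ζ β : Euc n → ℝ} (hu : LocallyIntegrable u volume)
    (hζ : IsCutoff n ζ) (hβ : IsTestFun n β) (ψ : 𝓢(Euc n, ℝ)) (hψ : ∫ x, ψ x = 1) :
    Tendsto (fun J : ℕ => ∫ y, u y * ∫ x, ζ (x - y) * (((2 : ℝ) ^ J) ^ n * ψ ((2 : ℝ) ^ J • (x - y))) * β x)
      atTop (𝓝 (∫ y, u y * β y)) := by
  obtain ⟨C, hC⟩ := hζ.hasCompactSupport.exists_bound_of_continuous hζ.1.continuous
  obtain ⟨B, hB⟩ := hβ.2.exists_bound_of_continuous hβ.1.continuous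
  have hC0 : 0 ≤ C := (norm_nonneg _).trans (hC 0)
  have hB0 : 0 ≤ B := (norm_nonneg _).trans (hB 0)
  obtain ⟨R, hR⟩ := hβ.2.isCompact.isBounded.subset_ball_lt 0 (0 : Euc n)
  have hz : ∀ x, x ∉ ball (0 : Euc n) R → β x = 0 := fun x hx =>
    image_eq_zero_of_notMem_tsupport fun h => hx (hR.2 h)
  have hψi : Integrable ψ volume := ψ.integrable
  have hlim : Tendsto (fun J : ℕ => ((2 : ℝ) ^ J)⁻¹) atTop (𝓝 0) := by
    simpa [inv_pow] using tendsto_pow_atTop_nhds_zero_of_lt_one (r := (2 : ℝ)⁻¹) (by norm_num) (by norm_num)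
  have hbd : ∀ (J : ℕ) y w, ‖ζ (((2 : ℝ) ^ J)⁻¹ • w) * ψ w * β (((2 : ℝ) ^ J)⁻¹ • w + y)‖ ≤
      C * B * ‖ψ w‖ := fun J y w => by
    rw [norm_mul, norm_mul]
    calc _ ≤ C * ‖ψ w‖ * B := by gcongr; exacts [hC _, hB _]
      _ = _ := by ring
  have hηb : ∀ (J : ℕ) y, ‖∫ x, ζ (x - y) * (((2 : ℝ) ^ J) ^ n * ψ ((2 : ℝ) ^ J • (x - y))) * β x‖ ≤
      C * B * ∫ w, ‖ψ w‖ := fun J y => by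
    rw [integral_scaled_mul_comp_add (by positivity), ← integral_const_mul]
    exact norm_integral_le_of_norm_le (hψi.norm.const_mul _) (ae_of_all _ fun w => hbd J y w)
  have hηz : ∀ (J : ℕ) y, y ∉ closedBall (0 : Euc n) (R + 2) →
      ∫ x, ζ (x - y) * (((2 : ℝ) ^ J) ^ n * ψ ((2 : ℝ) ^ J • (x - y))) * β x = 0 := fun J y hy => by
    refine integral_eq_zero_of_ae (ae_of_all _ fun x => ?_)
    by_cases hx : x ∈ ball (0 : Euc n) R
    · simp only [mem_closedBall_zero_iff, not_le, mem_ball_zero_iff] at hx hy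
      have := norm_sub_norm_le y x
      rw [norm_sub_rev] at this
      simp [hζ.2.2 (x - y) (by simp only [mem_ball_zero_iff]; linarith)]
    · simp [hz x hx]
  have hη : ∀ y, Tendsto (fun J : ℕ =>
      ∫ x, ζ (x - y) * (((2 : ℝ) ^ J) ^ n * ψ ((2 : ℝ) ^ J • (x - y))) * β x) atTop (𝓝 (β y)) := by
    intro y
    have h0 : β y = ∫ w, ζ 0 * ψ w * β y := by
      rw [integral_mul_const, integral_const_mul, hψ, hζ.2.1 0 (by simp)]; ring
    rw [h0]
    have h2 : ∀ J : ℕ, (0 : ℝ) < 2 ^ J := fun J => by positivity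
    simp only [integral_scaled_mul_comp_add (h2 _)]
    refine tendsto_integral_of_dominated_convergence (fun w => C * B * ‖ψ w‖) (fun J => ?_)
      (hψi.norm.const_mul _) (fun J => ae_of_all _ fun w => hbd J y w) (ae_of_all _ fun w => ?_)
    · have := hζ.1.continuous
      have := hβ.1.continuous
      have := ψ.continuous
      exact Continuous.aestronglyMeasurable (by fun_prop)
    · have h1 : Tendsto (fun J : ℕ => ((2 : ℝ) ^ J)⁻¹ • w) atTop (𝓝 0) := by
        simpa using hlim.smul_const w
      have h3 : Tendsto (fun J : ℕ => ((2 : ℝ) ^ J)⁻¹ • w + y) atTop (𝓝 y) := by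
        simpa using h1.add_const y
      exact (((hζ.1.continuous.tendsto 0).comp h1).mul_const _).mul
        ((hβ.1.continuous.tendsto y).comp h3)
  have hui : Integrable ((closedBall (0 : Euc n) (R + 2)).indicator u) volume :=
    (integrable_indicator_iff measurableSet_closedBall).2 (hu.integrableOn_isCompact (isCompact_closedBall _ _))
  refine tendsto_integral_of_dominated_convergence
    (fun y => ‖(closedBall (0 : Euc n) (R + 2)).indicator u y‖ * (C * B * ∫ w, ‖ψ w‖)) (fun J => ?_)
    (hui.norm.mul_const _) (fun J => ae_of_all _ fun y => ?_)
    (ae_of_all _ fun y => (hη y).const_mul _)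
  · refine hu.aestronglyMeasurable.mul ?_
    refine Continuous.aestronglyMeasurable ?_
    have hH : IsTestFun n fun z => ζ z * (((2 : ℝ) ^ J) ^ n * ψ ((2 : ℝ) ^ J • z)) :=
      ⟨hζ.1.mul (contDiff_const.mul ((ψ.smooth ⊤).comp (contDiff_const_smul _))),
        hζ.hasCompactSupport.mul_right⟩
    exact (isTestFun_adjoint hH hβ).1.continuous
  · by_cases hy : y ∈ closedBall (0 : Euc n) (R + 2)
    · rw [norm_mul, Set.indicator_of_mem hy]
      gcongr
      exact hηb J y
    · rw [hηz J y hy]; simp only [mul_zero, norm_zero]; positivity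

end ApproximateIdentity

section SmallSequence

variable {n : ℕ}

/-- Sequences of smooth functions all of whose derivatives decay geometrically, uniformly. -/
def SmallSeq (n : ℕ) (r : ℕ → Euc n → ℝ) : Prop :=
  (∀ j, ContDiff ℝ (⊤ : ℕ∞) (r j)) ∧
    ∀ m, ∃ C, ∀ j x, ‖iteratedFDeriv ℝ m (r j) x‖ ≤ C * (1 / 2) ^ j

lemma SmallSeq.add {r s : ℕ → Euc n → ℝ} (hr : SmallSeq n r) (hs : SmallSeq n s) :
    SmallSeq n fun j x => r j x + s j x := by
  refine ⟨fun j => (hr.1 j).add (hs.1 j), fun m => ?_⟩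
  obtain ⟨C, hC⟩ := hr.2 m
  obtain ⟨D, hD⟩ := hs.2 m
  refine ⟨C + D, fun j x => ?_⟩
  rw [fun_iteratedFDeriv_add_apply ((hr.1 j).contDiffAt.of_le (by exact_mod_cast le_top))
    ((hs.1 j).contDiffAt.of_le (by exact_mod_cast le_top)), add_mul]
  exact (norm_add_le _ _).trans (add_le_add (hC j x) (hD j x))

lemma SmallSeq.const_mul {r : ℕ → Euc n → ℝ} (hr : SmallSeq n r) (c : ℝ) :
    SmallSeq n fun j x => c * r j x := by
  refine ⟨fun j => contDiff_const.mul (hr.1 j), fun m => ?_⟩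
  obtain ⟨C, hC⟩ := hr.2 m
  refine ⟨|c| * C, fun j x => ?_⟩
  have := iteratedFDeriv_const_smul_apply' (a := c) (i := m) (x := x)
    ((hr.1 j).contDiffAt.of_le (by exact_mod_cast le_top))
  simp only [smul_eq_mul] at this
  rw [this, norm_smul, Real.norm_eq_abs, mul_assoc]
  gcongr
  exact hC j x

lemma SmallSeq.sub {r s : ℕ → Euc n → ℝ} (hr : SmallSeq n r) (hs : SmallSeq n s) :
    SmallSeq n fun j x => r j x - s j x := by
  simpa [sub_eq_add_neg] using hr.add (hs.const_mul (-1))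

lemma SmallSeq.zero : SmallSeq n fun _ _ => 0 :=
  ⟨fun _ => contDiff_const, fun m => ⟨0, fun j x => by simp [iteratedFDeriv_fun_zero]⟩⟩

lemma SmallSeq.sum {ι : Type*} (s : Finset ι) {r : ι → ℕ → Euc n → ℝ} (hr : ∀ i ∈ s, SmallSeq n (r i)) :
    SmallSeq n fun j x => ∑ i ∈ s, r i j x := by
  classical
  induction s using Finset.induction_on with
  | empty => simpa using SmallSeq.zero
  | insert a s ha ih =>
    simp only [Finset.sum_insert ha]
    exact (hr a (by simp)).add (ih fun i hi => hr i (by simp [hi]))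

lemma SmallSeq.fderiv_apply {r : ℕ → Euc n → ℝ} (hr : SmallSeq n r) (e : Euc n) :
    SmallSeq n fun j x => fderiv ℝ (r j) x e := by
  refine ⟨fun j => (hr.1 j).fderiv_apply_const e, fun m => ?_⟩
  obtain ⟨C, hC⟩ := hr.2 (m + 1)
  refine ⟨‖e‖ * C, fun j x => ?_⟩
  have h1 : ContDiff ℝ (⊤ : ℕ∞) (fderiv ℝ (r j)) := (hr.1 j).fderiv_right (by simp)
  refine (norm_iteratedFDeriv_clm_apply_const h1.contDiffAt (by exact_mod_cast le_top)).trans ?_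
  rw [norm_iteratedFDeriv_fderiv, mul_assoc]
  gcongr
  exact hC j x

lemma SmallSeq.dirDeriv {r : ℕ → Euc n → ℝ} (hr : SmallSeq n r) {m : ℕ} (I : Fin m → Fin n) :
    SmallSeq n fun j => dirDeriv n m I (r j) := by
  induction m generalizing r with
  | zero => simpa using hr
  | succ m ih =>
    simp only [dirDeriv_succ_right (hr.1 _)]
    exact ih (hr.fderiv_apply _) _

lemma SmallSeq.exists_bound {r : ℕ → Euc n → ℝ} (hr : SmallSeq n r) :
    ∃ C, ∀ j x, ‖r j x‖ ≤ C * (1 / 2) ^ j := by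
  obtain ⟨C, hC⟩ := hr.2 0
  exact ⟨C, fun j x => by simpa using hC j x⟩

lemma SmallSeq.summable {r : ℕ → Euc n → ℝ} (hr : SmallSeq n r) (x : Euc n) :
    Summable fun j => r j x := by
  obtain ⟨C, hC⟩ := hr.exists_bound
  exact Summable.of_norm_bounded (summable_geometric_two.mul_left C) fun j => hC j x

lemma SmallSeq.contDiff_tsum {r : ℕ → Euc n → ℝ} (hr : SmallSeq n r) :
    ContDiff ℝ (⊤ : ℕ∞) fun x => ∑' j, r j x := by
  choose C hC using hr.2
  exact _root_.contDiff_tsum hr.1 (v := fun m j => C m * (1 / 2) ^ j)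
    (fun m _ => summable_geometric_two.mul_left (C m)) fun m j x _ => hC m j x

lemma exists_bound_iteratedFDeriv_one_sub {ζ : Euc n → ℝ} (hζ : IsCutoff n ζ) (m : ℕ) :
    ∃ C, ∀ x, ‖iteratedFDeriv ℝ m (fun x => 1 - ζ x) x‖ ≤ C := by
  obtain ⟨B, hB⟩ := (hζ.hasCompactSupport.iteratedFDeriv (𝕜 := ℝ) m).exists_bound_of_continuous
    (hζ.1.continuous_iteratedFDeriv (by exact_mod_cast le_top))
  refine ⟨1 + B, fun x => ?_⟩
  have h : ContDiff ℝ (⊤ : ℕ∞) ζ := hζ.1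
  have h1 : (fun x => 1 - ζ x) = (fun _ => 1) - ζ := rfl
  rw [h1, iteratedFDeriv_sub_apply contDiffAt_const (h.contDiffAt.of_le (by exact_mod_cast le_top))]
  refine (norm_sub_le _ _).trans (add_le_add ?_ (hB x))
  rcases m with _ | m
  · simp
  · simp [iteratedFDeriv_succ_const]

lemma smallSeq_one_sub_cutoff_mul {ζ : Euc n → ℝ} (hζ : IsCutoff n ζ) (g : 𝓢(Euc n, ℝ)) {c : ℕ → ℝ}
    (hc : ∀ j, |c j| ≤ ((2 : ℝ) ^ j) ^ n) :
    SmallSeq n fun j x => (1 - ζ x) * (c j * g ((2 : ℝ) ^ j • x)) := by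
  have hζ1 : ContDiff ℝ (⊤ : ℕ∞) fun x => 1 - ζ x := contDiff_const.sub hζ.1
  have hg1 : ContDiff ℝ (⊤ : ℕ∞) g := g.smooth ⊤
  have hgj : ∀ j : ℕ, ContDiff ℝ (⊤ : ℕ∞) fun x => g ((2 : ℝ) ^ j • x) := fun j =>
    hg1.comp (contDiff_const_smul _)
  have hcg : ∀ j : ℕ, ContDiff ℝ (⊤ : ℕ∞) fun x => c j * g ((2 : ℝ) ^ j • x) := fun j =>
    contDiff_const.mul (hgj j)
  refine ⟨fun j => hζ1.mul (hcg j), fun m => ?_⟩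
  choose B hB using exists_bound_iteratedFDeriv_one_sub hζ
  choose D hD0 hD using fun l => g.exists_iteratedFDeriv_decay (n + l + 1) l
  refine ⟨∑ i ∈ Finset.range (m + 1), (m.choose i : ℝ) * B i * D (m - i), fun j x => ?_⟩
  have hB0 : ∀ i, 0 ≤ B i := fun i => (norm_nonneg _).trans (hB i 0)
  by_cases hx : x ∈ ball (0 : Euc n) 1
  · have : (fun x => (1 - ζ x) * (c j * g ((2 : ℝ) ^ j • x))) =ᶠ[𝓝 x] fun _ => 0 := by
      filter_upwards [isOpen_ball.mem_nhds hx] with y hy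
      rw [hζ.2.1 y hy]; simp
    rw [(this.iteratedFDeriv ℝ m).eq_of_nhds, iteratedFDeriv_fun_zero]
    simp only [Pi.zero_apply, norm_zero]
    exact mul_nonneg (Finset.sum_nonneg fun i _ => mul_nonneg (mul_nonneg (by positivity) (hB0 i))
      (hD0 _).le) (by positivity)
  · have hx1 : 1 ≤ ‖x‖ := by simpa using hx
    refine (norm_iteratedFDeriv_mul_le hζ1 (hcg j) x (by exact_mod_cast le_top)).trans ?_
    rw [Finset.sum_mul]
    refine Finset.sum_le_sum fun i _ => ?_
    rw [mul_assoc _ (D _)]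
    have hl : ‖iteratedFDeriv ℝ (m - i) (fun x => c j * g ((2 : ℝ) ^ j • x)) x‖ ≤
        D (m - i) * (1 / 2) ^ j := by
      obtain ⟨l, hl⟩ : ∃ l, l = m - i := ⟨_, rfl⟩
      rw [← hl]
      have h1 := iteratedFDeriv_const_smul_apply' (a := c j) (i := l) (x := x)
        ((hgj j).contDiffAt.of_le (by exact_mod_cast le_top))
      simp only [smul_eq_mul] at h1
      rw [h1, iteratedFDeriv_comp_const_smul _ (hg1.of_le (by exact_mod_cast le_top)), norm_smul,
        norm_smul, Real.norm_eq_abs, norm_pow, norm_pow, Real.norm_ofNat]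
      obtain ⟨s, hs⟩ : ∃ s : ℝ, s = 2 ^ j := ⟨_, rfl⟩
      have hs0 : 0 < s := by rw [hs]; positivity
      have hcj := hc j
      rw [← hs] at hcj ⊢
      have h2 : ((1 / 2 : ℝ)) ^ j = s⁻¹ := by rw [hs, one_div, inv_pow]
      have h3 : s ≤ 1 + ‖s • x‖ := by
        rw [norm_smul, Real.norm_of_nonneg hs0.le]; nlinarith
      rw [h2]
      calc _ ≤ s ^ n * (s ^ l * (D l * (s ^ (n + l + 1))⁻¹)) := by
            gcongr
            refine (hD l _).trans ?_
            have := (hD0 l).le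
            gcongr
        _ = _ := by field_simp; ring
    have := hB i x
    have := hB0 i
    gcongr

end SmallSequence

section LocalizedKernels

variable {n k : ℕ}

lemma SmallSeq.comp_succ {r : ℕ → Euc n → ℝ} (hr : SmallSeq n r) : SmallSeq n fun j => r (j + 1) := by
  refine ⟨fun j => hr.1 _, fun m => ?_⟩
  obtain ⟨C, hC⟩ := hr.2 m
  exact ⟨C * (1 / 2), fun j x => (hC (j + 1) x).trans_eq (by ring)⟩

lemma dirDeriv_eq_zero_of_two_lt {m : ℕ} {H : Euc n → ℝ} (hH : ∀ z, 2 < ‖z‖ → H z = 0) (I : Fin m → Fin n)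
    (z : Euc n) (hz : 2 < ‖z‖) : dirDeriv n m I H z = 0 := by
  have : H =ᶠ[𝓝 z] fun _ => 0 := by
    filter_upwards [(isOpen_lt continuous_const continuous_norm).mem_nhds hz] with y hy using hH y hy
  rw [dirDeriv, (this.iteratedFDeriv ℝ m).eq_of_nhds, iteratedFDeriv_fun_zero]
  rfl

lemma hasCompactSupport_of_two_lt {H : Euc n → ℝ} (hH : ∀ z, 2 < ‖z‖ → H z = 0) : HasCompactSupport H :=
  HasCompactSupport.intro (isCompact_closedBall (0 : Euc n) 2) fun z hz => hH z (by simpa using hz)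

/-- Localization of a dyadic parametrix to the ball of radius two. -/
lemma exists_localized_kernels {ι κ : Type*} [Fintype ι] [DecidableEq ι] [Fintype κ] (hnk : n ≤ k)
    {c : κ → ι → (Fin k → Fin n) → ℝ} {a : ι} {K : κ → 𝓢(Euc n, ℝ)} {ψ : 𝓢(Euc n, ℝ)}
    (hK : ∀ a' x, ∑ b, ∑ I, c b a' I * dirDeriv n k I (K b) x =
      if a = a' then (2 : ℝ) ^ n * ψ ((2 : ℝ) • x) - ψ x else 0)
    {ζ : Euc n → ℝ} (hζ : IsCutoff n ζ) (α : Fin (k - n) → Fin n) {l : κ → 𝓢(Euc n, ℝ)}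
    (hl : ∀ b, dirDeriv n (k - n) α (K b) = l b) :
    ∃ (h : κ → ℕ → Euc n → ℝ) (r : ι → ℕ → Euc n → ℝ) (y : κ → ℕ → Euc n → ℝ),
      (∀ b j, IsTestFun n (h b j)) ∧ (∀ b j z, 2 < ‖z‖ → h b j z = 0) ∧
      (∀ a', SmallSeq n (r a')) ∧ (∀ a' j z, 2 < ‖z‖ → r a' j z = 0) ∧ (∀ b, SmallSeq n (y b)) ∧
      (∀ b j x, dirDeriv n (k - n) α (h b j) x = l b ((2 : ℝ) ^ j • x) - y b j x) ∧
      ∀ a' j x, ∑ b, ∑ I, c b a' I * dirDeriv n k I (h b j) x = r a' j x +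
        if a = a' then ζ x * (((2 : ℝ) ^ (j + 1)) ^ n * ψ ((2 : ℝ) ^ (j + 1) • x)) -
          ζ x * (((2 : ℝ) ^ j) ^ n * ψ ((2 : ℝ) ^ j • x)) else 0 := by
  have hpos : ∀ j : ℕ, (0 : ℝ) < 2 ^ j := fun j => by positivity
  have hζ2 : ∀ z : Euc n, 2 < ‖z‖ → ζ z = 0 := fun z hz => hζ.2.2 z (by simpa using hz.le)
  have hc : ∀ j : ℕ, |((2 : ℝ) ^ j) ^ n / ((2 : ℝ) ^ j) ^ k| ≤ ((2 : ℝ) ^ j) ^ n := fun j => by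
    have h0 := hpos j
    rw [abs_of_pos (by positivity)]
    exact div_le_self (by positivity) (one_le_pow₀ (one_le_pow₀ (by norm_num)))
  have hKs : ∀ b j, ContDiff ℝ (⊤ : ℕ∞) fun x => K b ((2 : ℝ) ^ j • x) := fun b j =>
    ((K b).smooth ⊤).comp (contDiff_const_smul _)
  obtain ⟨g, hg⟩ : ∃ g : κ → ℕ → Euc n → ℝ, ∀ b j x, g b j x =
      ((2 : ℝ) ^ j) ^ n / ((2 : ℝ) ^ j) ^ k * K b ((2 : ℝ) ^ j • x) := ⟨_, fun _ _ _ => rfl⟩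
  have hgs : ∀ b j, ContDiff ℝ (⊤ : ℕ∞) (g b j) := fun b j => by
    rw [funext (hg b j)]; exact contDiff_const.mul (hKs b j)
  have hgd : ∀ b j (m : ℕ) (I : Fin m → Fin n) x, dirDeriv n m I (g b j) x =
      ((2 : ℝ) ^ j) ^ n / ((2 : ℝ) ^ j) ^ k * (((2 : ℝ) ^ j) ^ m * dirDeriv n m I (K b) ((2 : ℝ) ^ j • x)) :=
    fun b j m I x => by
      rw [funext (hg b j), dirDeriv_const_mul _ (hKs b j), dirDeriv_comp_smul ((K b).smooth ⊤), smul_eq_mul]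
  obtain ⟨Y, hY⟩ : ∃ Y : κ → ℕ → Euc n → ℝ, ∀ b j x, Y b j x = (1 - ζ x) * g b j x :=
    ⟨_, fun _ _ _ => rfl⟩
  have hYs : ∀ b, SmallSeq n (Y b) := fun b => by
    rw [funext fun j => funext (hY b j)]
    simp only [hg]
    exact smallSeq_one_sub_cutoff_mul hζ (K b) hc
  obtain ⟨P, hP⟩ : ∃ P : ℕ → Euc n → ℝ, ∀ j x, P j x = ((2 : ℝ) ^ j) ^ n * ψ ((2 : ℝ) ^ j • x) :=
    ⟨_, fun _ _ => rfl⟩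
  have hPs : SmallSeq n fun j x => (1 - ζ x) * P j x := by
    simp only [hP]
    exact smallSeq_one_sub_cutoff_mul hζ ψ fun j => (abs_of_pos (by positivity)).le
  obtain ⟨h, hh⟩ : ∃ h : κ → ℕ → Euc n → ℝ, ∀ b j x, h b j x = ζ x * g b j x := ⟨_, fun _ _ _ => rfl⟩
  have hhs : ∀ b j, IsTestFun n (h b j) := fun b j => by
    rw [funext (hh b j)]
    exact ⟨hζ.1.mul (hgs b j), hζ.hasCompactSupport.mul_right⟩
  have hh2 : ∀ b j z, 2 < ‖z‖ → h b j z = 0 := fun b j z hz => by rw [hh, hζ2 z hz, zero_mul]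
  have hhd : ∀ b j (m : ℕ) (I : Fin m → Fin n) x, dirDeriv n m I (h b j) x =
      dirDeriv n m I (g b j) x - dirDeriv n m I (Y b j) x := fun b j m I x => by
    rw [← dirDeriv_sub (hgs b j) ((hYs b).1 j)]
    congr 1; ext z; rw [hh, hY]; ring
  obtain ⟨r, hr⟩ : ∃ r : ι → ℕ → Euc n → ℝ, ∀ a' j x, r a' j x =
      (if a = a' then 1 else 0) * ((1 - ζ x) * P (j + 1) x - (1 - ζ x) * P j x) -
        ∑ b, ∑ I, c b a' I * dirDeriv n k I (Y b j) x := ⟨_, fun _ _ _ => rfl⟩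
  have hsum : ∀ a' j x, ∑ b, ∑ I, c b a' I * dirDeriv n k I (g b j) x =
      if a = a' then P (j + 1) x - P j x else 0 := fun a' j x => by
    have h1 : ∀ b I, c b a' I * dirDeriv n k I (g b j) x =
        ((2 : ℝ) ^ j) ^ n * (c b a' I * dirDeriv n k I (K b) ((2 : ℝ) ^ j • x)) := fun b I => by
      have := hpos j
      rw [hgd]; field_simp
    simp only [h1, ← Finset.mul_sum, hK]
    split_ifs
    · rw [hP, hP, smul_smul, ← pow_succ']; ring
    · simp
  have hid : ∀ a' j x, ∑ b, ∑ I, c b a' I * dirDeriv n k I (h b j) x = r a' j x +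
      if a = a' then ζ x * P (j + 1) x - ζ x * P j x else 0 := fun a' j x => by
    simp only [hhd, mul_sub, Finset.sum_sub_distrib, hsum, hr]
    split_ifs <;> ring
  refine ⟨h, r, fun b j => dirDeriv n (k - n) α (Y b j), hhs, hh2, fun a' => ?_, fun a' j z hz => ?_,
    fun b => (hYs b).dirDeriv α, fun b j x => ?_, fun a' j x => ?_⟩
  · rw [funext fun j => funext (hr a' j)]
    exact ((hPs.comp_succ.sub hPs).const_mul _).sub
      (SmallSeq.sum _ fun b _ => SmallSeq.sum _ fun I _ => ((hYs b).dirDeriv I).const_mul _)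
  · have := hid a' j z
    simpa [dirDeriv_eq_zero_of_two_lt (hh2 _ j) _ z hz, hζ2 z hz] using this.symm
  · rw [hhd, hgd, hl]
    congr 1
    rw [← mul_assoc, div_mul_eq_mul_div, ← pow_add, Nat.add_sub_cancel' hnk,
      div_self (pow_pos (hpos j) _).ne', one_mul]
  · rw [hid]; simp only [hP]

end LocalizedKernels

section PairMconv

variable {n k : ℕ} {μ : Measure (Euc n)} {g : Euc n → ℝ}

lemma integrable_mul_mconv (hg : LocallyIntegrable g μ) {H φ : Euc n → ℝ} (hH : IsTestFun n H)
    (hφ : IsTestFun n φ) : Integrable fun x => φ x * mconv μ g H x :=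
  (hφ.1.continuous.mul (contDiff_mconv hg hH).continuous).integrable_of_hasCompactSupport hφ.2.mul_right

lemma integral_mul_mconv_sum {ι : Type*} (s : Finset ι) (hg : LocallyIntegrable g μ) (c : ι → ℝ)
    {H : ι → Euc n → ℝ} (hH : ∀ i ∈ s, IsTestFun n (H i)) {φ : Euc n → ℝ} (hφ : IsTestFun n φ) :
    ∫ x, φ x * mconv μ g (fun z => ∑ i ∈ s, c i * H i z) x =
      ∑ i ∈ s, c i * ∫ x, φ x * mconv μ g (H i) x := by
  have h1 : ∀ i ∈ s, IsTestFun n fun z => c i * H i z := fun i hi =>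
    ⟨contDiff_const.mul (hH i hi).1, (hH i hi).2.mul_left⟩
  have h2 : ∀ x, φ x * mconv μ g (fun z => ∑ i ∈ s, c i * H i z) x =
      ∑ i ∈ s, c i * (φ x * mconv μ g (H i) x) := fun x => by
    rw [mconv_sum s hg h1, Finset.mul_sum]
    refine Finset.sum_congr rfl fun i _ => ?_
    rw [mconv_const_mul]; ring
  simp only [h2]
  rw [integral_finsetSum _ fun i hi => (integrable_mul_mconv hg (hH i hi) hφ).const_mul _]
  simp only [integral_const_mul]

variable [IsLocallyFiniteMeasure μ]

lemma integral_dirDeriv_mul_mconv (hg : LocallyIntegrable g μ) {H φ : Euc n → ℝ} (hH : IsTestFun n H)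
    (hφ : IsTestFun n φ) {m : ℕ} (I : Fin m → Fin n) :
    ∫ x, dirDeriv n m I φ x * mconv μ g H x = (-1) ^ m * ∫ x, φ x * mconv μ g (dirDeriv n m I H) x := by
  rw [← integral_mul_adjoint hg hH (hφ.dirDeriv I), ← integral_mul_adjoint hg (hH.dirDeriv I) hφ,
    ← integral_const_mul]
  congr 1; ext y
  rw [integral_comp_sub_mul_dirDeriv hH hφ]; ring

/-- The system of weak equations tested against convolutions. -/
lemma sum_integral_mul_mconv {ι κ : Type*} [Fintype ι] [Fintype κ]
    {c : κ → ι → (Fin k → Fin n) → ℝ} {f : κ → Euc n → ℝ} {u : ι → Euc n → ℝ}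
    (hf : ∀ b, LocallyIntegrable (f b) μ) (hu : ∀ a, LocallyIntegrable (u a) volume)
    (heq : ∀ b η, IsTestFun n η → (-1) ^ k * ∑ I, ∑ a, c b a I * ∫ x, u a x * dirDeriv n k I η x =
      ∫ x, f b x * η x ∂μ)
    {h : κ → Euc n → ℝ} (hh : ∀ b, IsTestFun n (h b)) {β : Euc n → ℝ} (hβ : IsTestFun n β) :
    ∑ b, ∫ x, β x * mconv μ (f b) (h b) x =
      ∑ a, ∫ x, β x * mconv volume (u a) (fun z => ∑ b, ∑ I, c b a I * dirDeriv n k I (h b) z) x := by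
  have h1 : ∀ b, ∫ x, β x * mconv μ (f b) (h b) x =
      ∑ I, ∑ a, c b a I * ∫ x, β x * mconv volume (u a) (dirDeriv n k I (h b)) x := fun b => by
    rw [← integral_mul_adjoint (hf b) (hh b) hβ, ← heq b _ (isTestFun_adjoint (hh b) hβ)]
    simp only [dirDeriv_adjoint (hh b) hβ]
    rw [Finset.mul_sum]
    refine Finset.sum_congr rfl fun I _ => ?_
    rw [Finset.mul_sum]
    refine Finset.sum_congr rfl fun a _ => ?_
    rw [← integral_mul_adjoint (hu a) ((hh b).dirDeriv I) hβ]
    simp only [mul_left_comm _ ((-1 : ℝ) ^ k)]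
    rw [integral_const_mul, mul_left_comm, ← mul_assoc ((-1 : ℝ) ^ k), ← mul_pow]
    simp
  have h2 : ∀ a, ∫ x, β x * mconv volume (u a)
      (fun z => ∑ b, ∑ I, c b a I * dirDeriv n k I (h b) z) x =
      ∑ b, ∑ I, c b a I * ∫ x, β x * mconv volume (u a) (dirDeriv n k I (h b)) x := fun a => by
    have := integral_mul_mconv_sum (Finset.univ ×ˢ Finset.univ) (hu a)
      (fun q : κ × (Fin k → Fin n) => c q.1 a q.2) (H := fun q => dirDeriv n k q.2 (h q.1))
      (fun q _ => (hh q.1).dirDeriv q.2) hβ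
    simpa only [Finset.sum_product] using this
  simp only [h1, h2]
  conv_rhs => rw [Finset.sum_comm]
  exact Finset.sum_congr rfl fun b _ => Finset.sum_comm

end PairMconv

section WeakDerivative

variable {n k m : ℕ} {ι κ : Type*} [Fintype ι] [DecidableEq ι] [Fintype κ] {σ : Measure (Euc n)}
  [IsLocallyFiniteMeasure σ] {c : κ → ι → (Fin k → Fin n) → ℝ} {f : κ → Euc n → ℝ} {u : ι → Euc n → ℝ}

lemma locallyIntegrable_tsum_mconv {μ : Measure (Euc n)} [IsLocallyFiniteMeasure μ] {g : Euc n → ℝ}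
    (hg : LocallyIntegrable g μ) {H : ℕ → Euc n → ℝ} (hH : ∀ j, Continuous (H j))
    (hH2 : ∀ j z, 2 < ‖z‖ → H j z = 0) (hs : ∑' j, ∫⁻ z, ‖H j z‖ₑ ≠ ∞) :
    LocallyIntegrable (fun x => ∑' j, mconv μ g (H j) x) volume :=
  locallyIntegrable_tsum_of_locally_summable
    (fun j => continuous_mconv hg (hH j) (hasCompactSupport_of_two_lt (hH2 j)))
    (tsum_lintegral_mconv_ne_top hg hH hH2 hs)

lemma hasSum_integral_mul_mconv {μ : Measure (Euc n)} [IsLocallyFiniteMeasure μ] {g : Euc n → ℝ}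
    (hg : LocallyIntegrable g μ) {H : ℕ → Euc n → ℝ} (hH : ∀ j, Continuous (H j))
    (hH2 : ∀ j z, 2 < ‖z‖ → H j z = 0) (hs : ∑' j, ∫⁻ z, ‖H j z‖ₑ ≠ ∞) {φ : Euc n → ℝ}
    (hφ : IsTestFun n φ) :
    HasSum (fun j => ∫ x, φ x * mconv μ g (H j) x) (∫ x, φ x * ∑' j, mconv μ g (H j) x) :=
  hasSum_integral_mul_of_locally_summable
    (fun j => continuous_mconv hg (hH j) (hasCompactSupport_of_two_lt (hH2 j)))
    (tsum_lintegral_mconv_ne_top hg hH hH2 hs) hφ.1.continuous hφ.2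

/-- A dyadic representation formula for the weak derivative `∂^α u_a`. -/
lemma integral_mul_dirDeriv_eq_of_localized_kernels
    (hf : ∀ b, LocallyIntegrable (f b) σ) (hu : ∀ a, LocallyIntegrable (u a) volume)
    (heq : ∀ b η, IsTestFun n η → (-1) ^ k * ∑ I, ∑ a, c b a I * ∫ x, u a x * dirDeriv n k I η x =
      ∫ x, f b x * η x ∂σ)
    {a : ι} {ψ : 𝓢(Euc n, ℝ)} (hψ : ∫ x, ψ x = 1) {ζ : Euc n → ℝ} (hζ : IsCutoff n ζ)
    {h : κ → ℕ → Euc n → ℝ} {r : ι → ℕ → Euc n → ℝ} (hh : ∀ b j, IsTestFun n (h b j))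
    (hh2 : ∀ b j z, 2 < ‖z‖ → h b j z = 0) (hr : ∀ a' j, ContDiff ℝ (⊤ : ℕ∞) (r a' j))
    (hr2 : ∀ a' j z, 2 < ‖z‖ → r a' j z = 0)
    (hhr : ∀ a' j x, ∑ b, ∑ I, c b a' I * dirDeriv n k I (h b j) x = r a' j x +
        if a = a' then ζ x * (((2 : ℝ) ^ (j + 1)) ^ n * ψ ((2 : ℝ) ^ (j + 1) • x)) -
          ζ x * (((2 : ℝ) ^ j) ^ n * ψ ((2 : ℝ) ^ j • x)) else 0)
    (α : Fin m → Fin n) (hhs : ∀ b, ∑' j, ∫⁻ z, ‖dirDeriv n m α (h b j) z‖ₑ ≠ ∞)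
    (hrs : ∀ a', ∑' j, ∫⁻ z, ‖dirDeriv n m α (r a' j) z‖ₑ ≠ ∞) {φ : Euc n → ℝ} (hφ : IsTestFun n φ) :
    ∫ x, dirDeriv n m α φ x * u a x = (-1) ^ m * ∫ x, φ x *
      (∑ b, ∑' j, mconv σ (f b) (dirDeriv n m α (h b j)) x +
        mconv volume (u a) (dirDeriv n m α fun z => ζ z * ψ z) x -
        ∑ a', ∑' j, mconv volume (u a') (dirDeriv n m α (r a' j)) x) := by
  have hβ := hφ.dirDeriv α
  have hrt : ∀ a' j, IsTestFun n (r a' j) := fun a' j => ⟨hr a' j, hasCompactSupport_of_two_lt (hr2 a' j)⟩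
  obtain ⟨Z, hZ⟩ : ∃ Z : ℕ → Euc n → ℝ, ∀ j x, Z j x =
      ζ x * (((2 : ℝ) ^ j) ^ n * ψ ((2 : ℝ) ^ j • x)) := ⟨_, fun _ _ => rfl⟩
  have hZt : ∀ j, IsTestFun n (Z j) := fun j => by
    rw [funext (hZ j)]
    exact ⟨hζ.1.mul (contDiff_const.mul ((ψ.smooth ⊤).comp (contDiff_const_smul _))),
      hζ.hasCompactSupport.mul_right⟩
  obtain ⟨P, hP⟩ : ∃ P : ℕ → ℝ, ∀ j, P j = ∫ x, dirDeriv n m α φ x * mconv volume (u a) (Z j) x :=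
    ⟨_, fun _ => rfl⟩
  have hPlim : Tendsto P atTop (𝓝 (∫ y, dirDeriv n m α φ y * u a y)) := by
    have := tendsto_integral_mul_scaled (hu a) hζ hβ ψ hψ
    simp only [← hZ] at this
    simp only [integral_mul_adjoint (hu a) (hZt _) hβ, ← hP] at this
    simpa only [mul_comm (u a _)] using this
  have hstep : ∀ j, P (j + 1) - P j = (-1) ^ m *
      ((∑ b, ∫ x, φ x * mconv σ (f b) (dirDeriv n m α (h b j)) x) -
        ∑ a', ∫ x, φ x * mconv volume (u a') (dirDeriv n m α (r a' j)) x) := fun j => by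
    have h1 := sum_integral_mul_mconv hf hu heq (fun b => hh b j) hβ
    have h2 : ∀ a', ∫ x, dirDeriv n m α φ x * mconv volume (u a')
        (fun z => ∑ b, ∑ I, c b a' I * dirDeriv n k I (h b j) z) x =
        (∫ x, dirDeriv n m α φ x * mconv volume (u a') (r a' j) x) +
          if a = a' then P (j + 1) - P j else 0 := fun a' => by
      simp only [hhr, ← hZ]
      split_ifs with ha
      · subst ha
        have h3 : ∀ x, mconv volume (u a) (fun z => r a j z + (Z (j + 1) z - Z j z)) x =
            mconv volume (u a) (r a j) x + (mconv volume (u a) (Z (j + 1)) x -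
              mconv volume (u a) (Z j) x) := fun x => by
          have e1 := mconv_sub (hu a) (hrt a j) (H' := fun z => Z j z - Z (j + 1) z)
            ⟨(hZt _).1.sub (hZt _).1, (hZt _).2.sub (hZt _).2⟩ x
          have e2 := mconv_sub (hu a) (hZt j) (hZt (j + 1)) x
          rw [e2] at e1
          rw [show (fun z => r a j z + (Z (j + 1) z - Z j z)) = fun z => r a j z - (Z j z - Z (j + 1) z)
            from funext fun z => by ring, e1]
          ring
        simp only [h3, mul_add, mul_sub]
        have i0 := integrable_mul_mconv (hu a) (hrt a j) hβ
        have i1 := integrable_mul_mconv (hu a) (hZt (j + 1)) hβ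
        have i2 := integrable_mul_mconv (hu a) (hZt j) hβ
        have i3 := integral_add i0 (i1.sub i2)
        simp only [Pi.sub_apply] at i3
        rw [i3, integral_sub i1 i2, hP, hP]
      · simp
    simp only [h2, Finset.sum_add_distrib, Finset.sum_ite_eq, Finset.mem_univ, if_true] at h1
    simp only [integral_dirDeriv_mul_mconv (hf _) (hh _ j) hφ,
      integral_dirDeriv_mul_mconv (hu _) (hrt _ j) hφ, ← Finset.mul_sum] at h1
    rw [mul_sub]
    linarith
  have hcd : ∀ b j, Continuous (dirDeriv n m α (h b j)) := fun b j => ((hh b j).dirDeriv α).1.continuous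
  have hrd : ∀ a j, Continuous (dirDeriv n m α (r a j)) := fun b j => ((hrt b j).dirDeriv α).1.continuous
  have hcd2 : ∀ b j z, 2 < ‖z‖ → dirDeriv n m α (h b j) z = 0 := fun b j =>
    dirDeriv_eq_zero_of_two_lt (hh2 b j) α
  have hrd2 : ∀ b j z, 2 < ‖z‖ → dirDeriv n m α (r b j) z = 0 := fun b j =>
    dirDeriv_eq_zero_of_two_lt (hr2 b j) α
  have hS := ((hasSum_sum (s := Finset.univ) fun b _ =>
    hasSum_integral_mul_mconv (hf b) (hcd b) (hcd2 b) (hhs b) hφ).sub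
      (hasSum_sum (s := Finset.univ) fun a' _ =>
        hasSum_integral_mul_mconv (hu a') (hrd a') (hrd2 a') (hrs a') hφ)).mul_left ((-1 : ℝ) ^ m)
  simp only [← hstep] at hS
  have hS' := hS.tendsto_sum_nat
  simp only [Finset.sum_range_sub] at hS'
  have hfin := tendsto_nhds_unique hS' (hPlim.sub_const (P 0))
  have hP0 : P 0 = (-1) ^ m * ∫ x, φ x * mconv volume (u a) (dirDeriv n m α fun z => ζ z * ψ z) x := by
    rw [hP, integral_dirDeriv_mul_mconv (hu a) (hZt 0) hφ, funext (hZ 0)]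
    simp
  have hZ0 : IsTestFun n fun z => ζ z * ψ z := by
    have := hZt 0
    rw [funext (hZ 0)] at this
    simpa using this
  have hloc : ∀ {g : Euc n → ℝ}, LocallyIntegrable g volume → Integrable fun x => φ x * g x := fun hg => by
    simpa using hg.integrable_smul_left_of_hasCompactSupport hφ.1.continuous hφ.2
  have I1 : ∀ b, Integrable fun x => φ x * ∑' j, mconv σ (f b) (dirDeriv n m α (h b j)) x := fun b =>
    hloc (locallyIntegrable_tsum_mconv (hf b) (hcd b) (hcd2 b) (hhs b))
  have I2 : ∀ b, Integrable fun x => φ x * ∑' j, mconv volume (u b) (dirDeriv n m α (r b j)) x := fun b =>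
    hloc (locallyIntegrable_tsum_mconv (hu b) (hrd b) (hrd2 b) (hrs b))
  have I3 := integrable_mul_mconv (hu a) (hZ0.dirDeriv α) hφ
  simp only [mul_add, mul_sub, Finset.mul_sum]
  have J1 := integrable_finsetSum Finset.univ fun b _ => I1 b
  have J2 := integrable_finsetSum Finset.univ fun b _ => I2 b
  have J3 := integral_sub (J1.add I3) J2
  simp only [Pi.add_apply] at J3
  rw [J3, integral_add J1 I3, integral_finsetSum _ fun b _ => I1 b, integral_finsetSum _ fun b _ => I2 b]
  rw [hP0] at hfin
  linarith

end WeakDerivative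

section TsumMconv

variable {n : ℕ} {μ : Measure (Euc n)} {g : Euc n → ℝ}

lemma tsum_lintegral_closedBall_ne_top (C : ℝ) :
    ∑' j : ℕ, ∫⁻ _ in closedBall (0 : Euc n) 2, ENNReal.ofReal (C * (1 / 2) ^ j) ≠ ∞ := by
  simp only [lintegral_const, Measure.restrict_apply_univ]
  rw [ENNReal.tsum_mul_right]
  refine ENNReal.mul_ne_top ?_ measure_closedBall_lt_top.ne
  exact (summable_geometric_two.mul_left C).tsum_ofReal_ne_top

lemma tsum_lintegral_ne_top_of_le (hn : 1 ≤ n) (l : 𝓢(Euc n, ℝ)) {q y : ℕ → Euc n → ℝ}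
    (hy : SmallSeq n y) (hq : ∀ j x, q j x = l ((2 : ℝ) ^ j • x) - y j x)
    (hq2 : ∀ j z, 2 < ‖z‖ → q j z = 0) : ∑' j, ∫⁻ z, ‖q j z‖ₑ ≠ ∞ := by
  obtain ⟨C, hC⟩ := hy.exists_bound
  have h1 : ∀ j z, ‖q j z‖ₑ ≤ ‖l ((2 : ℝ) ^ j • z)‖ₑ +
      (closedBall (0 : Euc n) 2).indicator (fun _ => ENNReal.ofReal (C * (1 / 2) ^ j)) z := fun j z => by
    by_cases hz : z ∈ closedBall (0 : Euc n) 2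
    · rw [Set.indicator_of_mem hz, hq]
      refine enorm_sub_le.trans (add_le_add_right ?_ _)
      rw [← ofReal_norm]
      exact ENNReal.ofReal_le_ofReal (hC j z)
    · rw [hq2 j z (by simpa using hz)]
      simp
  refine ne_top_of_le_ne_top ?_ (ENNReal.tsum_le_tsum fun j => lintegral_mono (h1 j))
  have h2 : ∀ j : ℕ, ∫⁻ z, ‖l ((2 : ℝ) ^ j • z)‖ₑ + (closedBall (0 : Euc n) 2).indicator
      (fun _ => ENNReal.ofReal (C * (1 / 2) ^ j)) z ≤
      ENNReal.ofReal ((1 / 2) ^ j) * (∫⁻ z, ‖l z‖ₑ) +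
        ∫⁻ _ in closedBall (0 : Euc n) 2, ENNReal.ofReal (C * (1 / 2) ^ j) := fun j => by
    rw [lintegral_add_right _ (measurable_const.indicator measurableSet_closedBall),
      lintegral_indicator measurableSet_closedBall,
      lintegral_comp_smul_euc (fun z => ‖l z‖ₑ) (by positivity : (0 : ℝ) < 2 ^ j)]
    gcongr
    rw [one_div, inv_pow]
    gcongr
    exact le_self_pow₀ (one_le_pow₀ (by norm_num)) (by omega)
  refine ne_top_of_le_ne_top ?_ (ENNReal.tsum_le_tsum h2)
  rw [ENNReal.tsum_add, ENNReal.tsum_mul_right]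
  refine ENNReal.add_ne_top.2 ⟨ENNReal.mul_ne_top ?_ ?_, tsum_lintegral_closedBall_ne_top C⟩
  · exact summable_geometric_two.tsum_ofReal_ne_top
  · exact l.integrable.2.ne

lemma SmallSeq.tsum_lintegral_ne_top {r : ℕ → Euc n → ℝ} (hr : SmallSeq n r)
    (hr2 : ∀ j z, 2 < ‖z‖ → r j z = 0) : ∑' j, ∫⁻ z, ‖r j z‖ₑ ≠ ∞ := by
  obtain ⟨C, hC⟩ := hr.exists_bound
  refine ne_top_of_le_ne_top (tsum_lintegral_closedBall_ne_top (n := n) C)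
    (ENNReal.tsum_le_tsum fun j => ?_)
  rw [← lintegral_indicator measurableSet_closedBall]
  refine lintegral_mono fun z => ?_
  by_cases hz : z ∈ closedBall (0 : Euc n) 2
  · rw [Set.indicator_of_mem hz, ← ofReal_norm]
    exact ENNReal.ofReal_le_ofReal (hC j z)
  · rw [hr2 j z (by simpa using hz)]
    simp

lemma SmallSeq.contDiff_tsum_mconv {r : ℕ → Euc n → ℝ} (hr : SmallSeq n r)
    (hr2 : ∀ j z, 2 < ‖z‖ → r j z = 0) (hg : LocallyIntegrable g μ) :
    ContDiff ℝ (⊤ : ℕ∞) fun x => ∑' j, mconv μ g (r j) x := by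
  obtain ⟨C, hC⟩ := hr.exists_bound
  have hR2 : ∀ z : Euc n, 2 < ‖z‖ → ∑' j, r j z = 0 := fun z hz => by simp [hr2 _ z hz]
  have h : (fun x => ∑' j, mconv μ g (r j) x) = mconv μ g fun z => ∑' j, r j z := by
    ext x
    have hint : ∀ j, Integrable (fun y => g y * r j (x - y)) μ := fun j =>
      integrable_mconv hg (hr.1 j).continuous (hasCompactSupport_of_two_lt (hr2 j)) x
    have hgi : Integrable (fun y => (closedBall x 2).indicator (fun y => ‖g y‖) y) μ :=
      IntegrableOn.integrable_indicator (hg.integrableOn_isCompact (isCompact_closedBall x 2)).norm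
        measurableSet_closedBall
    have hb : ∀ j, ∫ y, ‖g y * r j (x - y)‖ ∂μ ≤
        C * (1 / 2) ^ j * ∫ y, (closedBall x 2).indicator (fun y => ‖g y‖) y ∂μ := fun j => by
      rw [← integral_const_mul]
      refine integral_mono (hint j).norm (hgi.const_mul _) fun y => ?_
      by_cases hy : y ∈ closedBall x 2
      · simp only [Set.indicator_of_mem hy, norm_mul]
        rw [mul_comm]
        gcongr
        exact hC j _
      · rw [hr2 j (x - y) (by rw [← dist_eq_norm, dist_comm]; simpa using hy)]
        simp [Set.indicator_of_notMem hy]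
    have := hasSum_integral_of_summable_integral_norm hint
      (Summable.of_nonneg_of_le (fun j => integral_nonneg fun y => norm_nonneg _) hb
        ((summable_geometric_two.mul_left C).mul_right _))
    simp only [tsum_mul_left] at this
    exact this.tsum_eq
  rw [h]
  exact contDiff_mconv hg ⟨hr.contDiff_tsum, hasCompactSupport_of_two_lt hR2⟩

/-- Almost everywhere Taylor expansions of a localized dyadic series. -/
theorem ae_taylorLp_tsum_mconv {p : ℝ} (hn : 1 ≤ n) (hp : 1 < p) {σ : Measure (Euc n)}
    [IsLocallyFiniteMeasure σ] {f : Euc n → ℝ} (hf : Measurable f) (hf1 : ∀ z, |f z| ≤ 1)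
    (l : 𝓢(Euc n, ℝ)) (hl : ∫ x, l x = 0)
    (hconv : ∀ (σ : Measure (Euc n)) [IsFiniteMeasure σ] (f : Euc n → ℝ), Measurable f → (∀ z, |f z| ≤ 1) →
      ∀ᵐ x, ∀ I : Fin n → Fin n, ∃ L, Tendsto (fun J => ∑ j ∈ Finset.range J,
        ((2 : ℝ) ^ j) ^ n * ∫ z, f z * dirDeriv n n I l ((2 : ℝ) ^ j • (x - z)) ∂σ) atTop (𝓝 L))
    {q y : ℕ → Euc n → ℝ} (hy : SmallSeq n y) (hq : ∀ j x, q j x = l ((2 : ℝ) ^ j • x) - y j x)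
    (hq2 : ∀ j z, 2 < ‖z‖ → q j z = 0) :
    ∀ᵐ x, TaylorLp n n p (fun x => ∑' j, mconv σ f (q j) x) x := by
  have hfl : ∀ (μ : Measure (Euc n)) [IsLocallyFiniteMeasure μ], LocallyIntegrable f μ := fun μ _ =>
    (locallyIntegrable_const (1 : ℝ)).mono hf.aestronglyMeasurable
      (ae_of_all _ fun z => by simpa using hf1 z)
  have hqc : ∀ j, Continuous (q j) := fun j => by
    rw [funext (hq j)]
    exact (l.continuous.comp (continuous_const_smul _)).sub (hy.1 j).continuous
  obtain ⟨C, hC⟩ := hy.exists_bound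
  obtain ⟨χ, hχ⟩ := exists_isCutoff n
  refine ae_of_forall_ae_ball fun R => ?_
  obtain ⟨ν, hν⟩ : ∃ ν, ν = σ.restrict (ball 0 ((R : ℝ) + 3)) := ⟨_, rfl⟩
  have hνf : IsFiniteMeasure ν := by
    rw [hν]; exact isFiniteMeasure_restrict.2 measure_ball_lt_top.ne
  have hR : (0 : ℝ) < 2 * R + 3 := by positivity
  obtain ⟨Y, hY⟩ : ∃ Y : Euc n → ℝ, ∀ z, Y z = χ ((2 * R + 3 : ℝ)⁻¹ • z) * ∑' j, y j z :=
    ⟨_, fun _ => rfl⟩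
  have hYt : IsTestFun n Y := by
    rw [funext hY]
    refine ⟨(hχ.1.comp (contDiff_const_smul _)).mul hy.contDiff_tsum, ?_⟩
    have := hχ.hasCompactSupport.comp_homeomorph (Homeomorph.smulOfNeZero _ (inv_ne_zero hR.ne'))
    exact HasCompactSupport.mul_right this
  have hint_l : ∀ j (x : Euc n), Integrable (fun z => f z * l ((2 : ℝ) ^ j • (x - z))) ν := fun j x => by
    obtain ⟨B, hB0, hB⟩ := l.exists_decay 0
    exact integrable_bdd_smul hf hf1 (φ := fun z => l ((2 : ℝ) ^ j • (x - z))) (by fun_prop)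
      fun z => norm_le_of_decay hB0.le hB _
  have hint_y : ∀ j (x : Euc n), Integrable (fun z => f z * y j (x - z)) ν := fun j x =>
    integrable_bdd_smul hf hf1 (φ := fun z => y j (x - z))
      ((hy.1 j).continuous.comp (by fun_prop)) fun z => hC j _
  have hsplit : ∀ x ∈ ball (0 : Euc n) R, ∀ j, mconv σ f (q j) x =
      (∫ z, f z * l ((2 : ℝ) ^ j • (x - z)) ∂ν) - ∫ z, f z * y j (x - z) ∂ν := fun x hx j => by
    rw [← integral_sub (hint_l j x) (hint_y j x), hν, setIntegral_eq_integral_of_forall_compl_eq_zero]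
    · simp only [mconv, hq, mul_sub]
    · intro z hz
      have hxz : 2 < ‖x - z‖ := by
        have h1 : (R : ℝ) + 3 ≤ ‖z‖ := by simpa using hz
        have h2 : ‖x‖ < R := by simpa using hx
        have := norm_sub_norm_le z x
        rw [norm_sub_rev]; linarith
      rw [← mul_sub, ← hq, hq2 j _ hxz, mul_zero]
  have hysum : ∀ x ∈ ball (0 : Euc n) R, HasSum (fun j => ∫ z, f z * y j (x - z) ∂ν) (mconv ν f Y x) := by
    intro x hx
    have h1 := hasSum_integral_of_summable_integral_norm (hint_y · x) (Summable.of_nonneg_of_le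
      (g := fun j => ∫ z, ‖f z * y j (x - z)‖ ∂ν) (f := fun j => C * (1 / 2) ^ j * ν.real Set.univ)
      (fun j => integral_nonneg fun z => norm_nonneg _) (fun j => ?_)
      ((summable_geometric_two.mul_left C).mul_right _))
    · suffices h : mconv ν f Y x = ∫ z, ∑' j, f z * y j (x - z) ∂ν by rwa [h]
      rw [mconv, hν]
      refine setIntegral_congr_fun measurableSet_ball fun z hz => ?_
      simp only [tsum_mul_left, hY]
      rw [hχ.2.1, one_mul]
      have h1 : ‖z‖ < (R : ℝ) + 3 := by simpa using hz
      have h2 : ‖x‖ < R := by simpa using hx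
      have := norm_sub_le x z
      rw [mem_ball_zero_iff, norm_smul, norm_inv, Real.norm_of_nonneg hR.le, inv_mul_lt_iff₀ hR]
      linarith
    · calc ∫ z, ‖f z * y j (x - z)‖ ∂ν ≤ ∫ _, C * (1 / 2) ^ j ∂ν := by
            refine integral_mono (hint_y j x).norm (integrable_const _) fun z => ?_
            have h1 : ‖f z‖ ≤ 1 := hf1 z
            simp only [norm_mul]
            exact (mul_le_of_le_one_left (norm_nonneg _) h1).trans (hC j _)
        _ = _ := by simp [mul_comm]
  have hae := ae_summable_of_locally_summable
    (fun j => continuous_mconv (hfl σ) (hqc j) (hasCompactSupport_of_two_lt (hq2 j)))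
    (tsum_lintegral_mconv_ne_top (hfl σ) hqc hq2 (tsum_lintegral_ne_top_of_le hn l hy hq hq2))
  filter_upwards [hconv ν f hf hf1, ae_lebPoint (σ := ν) hf hf1] with x hx hxL hxR
  have hcore := taylorLp_tsum_of_lebPoint hn hp hf hf1 hxL l hl hx
  have hsm : ContDiff ℝ (⊤ : ℕ∞) fun x => -mconv ν f Y x := (contDiff_mconv (hfl ν) hYt).neg
  refine TaylorLp.congr (isOpen_ball.mem_nhds hxR) ?_ (TaylorLp.add hp.le
    hsm.continuous.aestronglyMeasurable (hsm.taylorLp (by linarith) x) hcore)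
  filter_upwards [hae] with z hz hzR
  simp only [hsplit z hzR] at hz ⊢
  have h1 := (hysum z hzR)
  have h2 := hz.add h1.summable
  simp only [sub_add_cancel] at h2
  rw [h2.tsum_sub h1.summable, h1.tsum_eq]
  ring

end TsumMconv

section Elliptic

variable {n k : ℕ} {p : ℝ}

/-- Scalar components of weak derivatives of solutions of a system with a dyadic parametrix. -/
theorem exists_weakDeriv_taylorLp {ι κ : Type*} [Fintype ι] [DecidableEq ι] [Fintype κ] (hn : 1 ≤ n)
    (hnk : n ≤ k) (hp : 1 < p) {σ : Measure (Euc n)} [IsLocallyFiniteMeasure σ]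
    {c : κ → ι → (Fin k → Fin n) → ℝ} {f : κ → Euc n → ℝ} {u : ι → Euc n → ℝ}
    (hf : ∀ b, Measurable (f b)) (hf1 : ∀ b z, |f b z| ≤ 1) (hu : ∀ a, LocallyIntegrable (u a) volume)
    (heq : ∀ b η, IsTestFun n η → (-1) ^ k * ∑ I, ∑ a, c b a I * ∫ x, u a x * dirDeriv n k I η x =
      ∫ x, f b x * η x ∂σ)
    {a : ι} {K : κ → 𝓢(Euc n, ℝ)} {ψ : 𝓢(Euc n, ℝ)} (hψ : ∫ x, ψ x = 1)
    (hK : ∀ a' x, ∑ b, ∑ I, c b a' I * dirDeriv n k I (K b) x =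
      if a = a' then (2 : ℝ) ^ n * ψ ((2 : ℝ) • x) - ψ x else 0)
    (α : Fin (k - n) → Fin n) {l : κ → 𝓢(Euc n, ℝ)} (hl : ∀ b, dirDeriv n (k - n) α (K b) = l b)
    (hl0 : ∀ b, ∫ x, l b x = 0)
    (hconv : ∀ b (σ : Measure (Euc n)) [IsFiniteMeasure σ] (f : Euc n → ℝ), Measurable f →
      (∀ z, |f z| ≤ 1) → ∀ᵐ x, ∀ I : Fin n → Fin n, ∃ L, Tendsto (fun J => ∑ j ∈ Finset.range J,
        ((2 : ℝ) ^ j) ^ n * ∫ z, f z * dirDeriv n n I (l b) ((2 : ℝ) ^ j • (x - z)) ∂σ) atTop (𝓝 L)) :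
    ∃ v : Euc n → ℝ, LocallyIntegrable v volume ∧
      (∀ φ, IsTestFun n φ → ∫ x, dirDeriv n (k - n) α φ x * u a x = (-1) ^ (k - n) * ∫ x, φ x * v x) ∧
      ∀ᵐ x, TaylorLp n n p v x := by
  obtain ⟨ζ, hζ⟩ := exists_isCutoff n
  obtain ⟨h, r, y, hh, hh2, hr, hr2, hy, hhy, hhr⟩ := exists_localized_kernels hnk hK hζ α hl
  have hfl : ∀ b, LocallyIntegrable (f b) σ := fun b =>
    (locallyIntegrable_const (1 : ℝ)).mono (hf b).aestronglyMeasurable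
      (ae_of_all _ fun z => by simpa using hf1 b z)
  have hhd2 : ∀ b j z, 2 < ‖z‖ → dirDeriv n (k - n) α (h b j) z = 0 := fun b j =>
    dirDeriv_eq_zero_of_two_lt (hh2 b j) α
  have hrd2 : ∀ b j z, 2 < ‖z‖ → dirDeriv n (k - n) α (r b j) z = 0 := fun b j =>
    dirDeriv_eq_zero_of_two_lt (hr2 b j) α
  have hhs := fun b => tsum_lintegral_ne_top_of_le hn (l b) (hy b) (hhy b) (hhd2 b)
  have hrs := fun a' => ((hr a').dirDeriv α).tsum_lintegral_ne_top (hrd2 a')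
  have hζψ : IsTestFun n fun z => ζ z * ψ z := ⟨hζ.1.mul (ψ.smooth ⊤), hζ.hasCompactSupport.mul_right⟩
  have L1 : ∀ b, LocallyIntegrable (fun x => ∑' j, mconv σ (f b) (dirDeriv n (k - n) α (h b j)) x) volume :=
    fun b => locallyIntegrable_tsum_mconv (hfl b) (fun j => ((hh b j).dirDeriv α).1.continuous) (hhd2 b) (hhs b)
  have hS : ContDiff ℝ (⊤ : ℕ∞) fun x => mconv volume (u a) (dirDeriv n (k - n) α fun z => ζ z * ψ z) x -
      ∑ a', ∑' j, mconv volume (u a') (dirDeriv n (k - n) α (r a' j)) x :=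
    (contDiff_mconv (hu a) (hζψ.dirDeriv α)).sub
      (ContDiff.sum fun a' _ => ((hr a').dirDeriv α).contDiff_tsum_mconv (hrd2 a') (hu a'))
  refine ⟨fun x => (mconv volume (u a) (dirDeriv n (k - n) α fun z => ζ z * ψ z) x -
      ∑ a', ∑' j, mconv volume (u a') (dirDeriv n (k - n) α (r a' j)) x) +
      ∑ b, ∑' j, mconv σ (f b) (dirDeriv n (k - n) α (h b j)) x, ?_, fun φ hφ => ?_, ?_⟩
  · exact hS.continuous.locallyIntegrable.add (locallyIntegrable_finsetSum _ fun b _ => L1 b)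
  · rw [integral_mul_dirDeriv_eq_of_localized_kernels hfl hu heq hψ hζ hh hh2 (fun a' => (hr a').1) hr2 hhr α
      hhs hrs hφ]
    congr 2; ext x; ring
  · have h1 := fun b => ae_taylorLp_tsum_mconv hn hp (σ := σ) (hf b) (hf1 b) (l b) (hl0 b) (hconv b) (hy b)
      (hhy b) (hhd2 b)
    filter_upwards [ae_all_iff.2 h1] with x hx
    exact TaylorLp.add hp.le hS.continuous.aestronglyMeasurable (hS.taylorLp (by linarith) x)
      (TaylorLp.sum hp.le _ (fun b _ => (L1 b).aestronglyMeasurable) fun b _ => hx b)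

variable {V W : Type*} [NormedAddCommGroup V] [InnerProductSpace ℝ V] [FiniteDimensional ℝ V]
  [NormedAddCommGroup W] [InnerProductSpace ℝ W] [FiniteDimensional ℝ W]

theorem IsElliptic.exists_isWeakDerivFamily_memT {A : CoeffOp n k V W} (hA : IsElliptic n k A)
    (hn : 1 ≤ n) (hnk : n ≤ k) (hp : 1 < p) {u : Euc n → V} (hu : MemBVAloc n k A u) :
    ∃ v : (Fin (k - n) → Fin n) → Euc n → V, IsWeakDerivFamily n (k - n) u v ∧
      ∀ᵐ x ∂(volume : Measure (Euc n)), ∀ I, MemT n n p (v I) x := by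
  obtain ⟨hul, σ, f, hσ, hfl, hf1, hdist⟩ := hu
  have e := stdOrthonormalBasis ℝ V
  have w := stdOrthonormalBasis ℝ W
  obtain ⟨K, ψ, hψ, hK, hl⟩ := hA.exists_dyadic_parametrix e w hn hnk
  choose l hl hl0 hconv using hl
  have hfm := hfl.aestronglyMeasurable
  have hg : ∀ b, ∃ g : Euc n → ℝ, Measurable g ∧ (∀ z, |g z| ≤ 1) ∧ ∀ᵐ z ∂σ, g z = ⟪f z, w b⟫ := fun b => by
    refine ⟨fun z => max (-1) (min 1 ⟪hfm.mk f z, w b⟫), ?_, fun z => ?_, ?_⟩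
    · have : Measurable fun z => ⟪hfm.mk f z, w b⟫ :=
        (hfm.stronglyMeasurable_mk.inner stronglyMeasurable_const).measurable
      fun_prop
    · exact abs_le.2 ⟨le_max_left _ _, max_le (by norm_num) (min_le_left _ _)⟩
    · filter_upwards [hf1, hfm.ae_eq_mk] with z hz hz'
      rw [← hz']
      have := abs_le.1 (abs_real_inner_le_norm (f z) (w b))
      rw [hz, w.norm_eq_one, mul_one] at this
      rw [min_eq_right this.2, max_eq_right this.1]
  choose g hgm hg1 hgf using hg
  have hua : ∀ a, LocallyIntegrable (fun x => ⟪e a, u x⟫) volume := fun a x => by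
    obtain ⟨s, hs, h⟩ := hul x
    exact ⟨s, hs, (innerSL ℝ (e a)).integrable_comp h⟩
  have hui : ∀ a {φ : Euc n → ℝ}, IsTestFun n φ → Integrable fun x => ⟪e a, u x⟫ * φ x := fun a φ hφ => by
    simpa [mul_comm] using (hua a).integrable_smul_left_of_hasCompactSupport hφ.1.continuous hφ.2
  have heq : ∀ b η, IsTestFun n η → (-1 : ℝ) ^ k * ∑ I, ∑ a, ⟪w b, A I (e a)⟫ *
      ∫ x, ⟪e a, u x⟫ * dirDeriv n k I η x = ∫ x, g b x * η x ∂σ := fun b η hη => by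
    have h1 := hdist (fun x => η x • w b) ⟨hη.1.smul contDiff_const, hη.2.smul_right⟩
    have h2 : ∀ I x, dirDeriv n k I (fun x => η x • w b) x = dirDeriv n k I η x • w b := fun I x =>
      dirDeriv_clm_comp (ContinuousLinearMap.toSpanSingleton ℝ (w b)) hη.1 I x
    have h3 : ∀ I x, ⟪u x, LinearMap.adjoint (A I) (dirDeriv n k I (fun x => η x • w b) x)⟫ =
        ∑ a, ⟪w b, A I (e a)⟫ * (⟪e a, u x⟫ * dirDeriv n k I η x) := fun I x => by
      rw [h2, map_smul, inner_smul_right, LinearMap.adjoint_inner_right]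
      conv_lhs => rw [← e.sum_repr' (u x)]
      simp only [map_sum, map_smul, sum_inner, real_inner_smul_left, Finset.mul_sum]
      refine Finset.sum_congr rfl fun a _ => ?_
      rw [real_inner_comm (w b)]; ring
    simp only [h3] at h1
    simp only [integral_finsetSum _ fun a _ => (hui a (hη.dirDeriv _)).const_mul _, integral_const_mul] at h1
    rw [h1]
    refine integral_congr_ae ?_
    filter_upwards [hgf b] with x hx
    rw [hx, real_inner_smul_right, mul_comm]
  have hv := fun a α => exists_weakDeriv_taylorLp hn hnk hp hgm hg1 hua heq hψ (hK a) α
    (fun b => hl a b α) (fun b => hl0 a b α) (fun b => hconv a b α)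
  choose v hv1 hv2 hv3 using hv
  refine ⟨fun I x => ∑ a, v a I x • e a, ⟨fun I => ?_, fun I φ hφ => ?_⟩, ?_⟩
  · refine locallyIntegrable_finsetSum _ fun a _ x => ?_
    obtain ⟨s, hs, h⟩ := hv1 a I x
    exact ⟨s, hs, h.smul_const _⟩
  · have h1 : ∀ x, dirDeriv n (k - n) I φ x • u x =
        ∑ a, (dirDeriv n (k - n) I φ x * ⟪e a, u x⟫) • e a := fun x => by
      conv_lhs => rw [← e.sum_repr' (u x)]
      simp only [Finset.smul_sum, mul_smul]
    have h2 : ∀ x, φ x • ∑ a, v a I x • e a = ∑ a, (φ x * v a I x) • e a := fun x => by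
      simp only [Finset.smul_sum, mul_smul]
    have h3 : ∀ a, Integrable fun x => φ x * v a I x := fun a => by
      simpa using (hv1 a I).integrable_smul_left_of_hasCompactSupport hφ.1.continuous hφ.2
    simp only [h1, h2]
    rw [integral_finsetSum _ fun a _ => Integrable.smul_const (by
        simpa only [mul_comm] using hui a (hφ.dirDeriv I)) _,
      integral_finsetSum _ fun a _ => (h3 a).smul_const _, Finset.smul_sum]
    refine Finset.sum_congr rfl fun a _ => ?_
    rw [integral_smul_const, integral_smul_const, hv2 a I φ hφ, mul_smul]
  · filter_upwards [ae_all_iff.2 fun a => ae_all_iff.2 (hv3 a)] with x hx I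
    refine TaylorLp.memT hp.le (TaylorLp.sum hp.le _ (fun a _ => ?_) fun a _ => ?_)
    · exact (hv1 a I).aestronglyMeasurable.smul_const _
    · exact (hx a I).clm_comp (by linarith) (ContinuousLinearMap.toSpanSingleton ℝ (e a))

end Elliptic

/-- Theorem 1.4(2): for `k ≥ n` and `1 < p < ∞`,
`𝒜` is elliptic iff `D^{k-n} u ∈ t^{n,p}(x)` a.e. for every `u ∈ BV^𝒜_loc`. -/
theorem statement6 (n k : ℕ) (p : ℝ) {V W : Type*}
    [NormedAddCommGroup V] [InnerProductSpace ℝ V] [FiniteDimensional ℝ V]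
    [NormedAddCommGroup W] [InnerProductSpace ℝ W] [FiniteDimensional ℝ W]
    (A : CoeffOp n k V W) (hA : IsSymmetricOp n k A)
    (hn : 1 ≤ n) (hnk : n ≤ k) (hp1 : 1 < p) :
    IsElliptic n k A ↔
      ∀ u : Euc n → V, MemBVAloc n k A u →
        ∃ v : (Fin (k - n) → Fin n) → Euc n → V, IsWeakDerivFamily n (k - n) u v ∧
          ∀ᵐ x ∂(volume : Measure (Euc n)), ∀ I, MemT n n p (v I) x := by
  exact ⟨fun h u hu => h.exists_isWeakDerivFamily_memT hn hnk hp1 hu,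
    fun H => isElliptic_of_forall_memT n k p A hn hp1 H⟩
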